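/- Let ω ∈ A₁ and f ∈ BMO(ω). If S(f)(x₀) < +∞ for at least one point x₀ ∈ ℝⁿ, then S(f)(x) < +∞ for almost every x ∈ ℝⁿ, and there exists a constant C > 0, independent of f, such that ‖S(f)‖_{BLO(ω)} ≤ C · ‖f‖_{BMO(ω)}. -/

import Mathlib

open MeasureTheory Metric Set ENNReal

noncomputable section

namespace LPW

variable {n : ℕ}

/-- n-dimensional Euclidean space. -/
abbrev Rn (n : ℕ) := EuclideanSpace ℝ (Fin n)

/-- Axis-parallel open cube with center `c` and half-side `h`. -/
def cube (c : Rn n) (h : ℝ) : Set (Rn n) := {y : Rn n | ∀ i, |y i - c i| < h}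

/-- The ω-measure `ω(E) = ∫_E ω`. -/
def wInt (ω : Rn n → ℝ) (E : Set (Rn n)) : ℝ := ∫ x in E, ω x

/-- The Lebesgue mean value `f_E = (1/m(E)) ∫_E f`. -/
def avg (f : Rn n → ℝ) (E : Set (Rn n)) : ℝ := ((volume E).toReal)⁻¹ * ∫ x in E, f x

/-- Weighted mean oscillation `(1/ω(E)) ∫_E |f - f_E|`. -/
def bmoAvg (ω f : Rn n → ℝ) (E : Set (Rn n)) : ℝ :=
  (wInt ω E)⁻¹ * ∫ x in E, |f x - avg f E|

/-- Weighted lower oscillation `(1/ω(E)) ∫_E (f - essinf_E f)`. -/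
def bloAvg (ω f : Rn n → ℝ) (E : Set (Rn n)) : ℝ :=
  (wInt ω E)⁻¹ * ∫ x in E, (f x - essInf f (volume.restrict E))

/-- `‖f‖_{BMO(ω)}`, supremum over all balls, valued in `[0,∞]`. -/
def bmoNorm (ω f : Rn n → ℝ) : ℝ≥0∞ :=
  ⨆ (c : Rn n) (ρ : ℝ) (_ : 0 < ρ), ENNReal.ofReal (bmoAvg ω f (Metric.ball c ρ))

/-- `‖f‖_{BLO(ω)}`, supremum over all balls, valued in `[0,∞]`. -/
def bloNorm (ω f : Rn n → ℝ) : ℝ≥0∞ :=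
  ⨆ (c : Rn n) (ρ : ℝ) (_ : 0 < ρ), ENNReal.ofReal (bloAvg ω f (Metric.ball c ρ))

/-- `‖f‖_{L^∞(ω)}`, supremum over all balls of `(essinf_B ω)⁻¹ · esssup_B |f|`. -/
def linfNorm (ω f : Rn n → ℝ) : ℝ≥0∞ :=
  ⨆ (c : Rn n) (ρ : ℝ) (_ : 0 < ρ),
    ENNReal.ofReal ((essInf ω (volume.restrict (Metric.ball c ρ)))⁻¹ *
      essSup (fun x => |f x|) (volume.restrict (Metric.ball c ρ)))

/-- `‖f‖_{BMO(ω)}` taken over cubes. -/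
def bmoNormC (ω f : Rn n → ℝ) : ℝ≥0∞ :=
  ⨆ (c : Rn n) (h : ℝ) (_ : 0 < h), ENNReal.ofReal (bmoAvg ω f (cube c h))

/-- `‖f‖_{BLO(ω)}` taken over cubes. -/
def bloNormC (ω f : Rn n → ℝ) : ℝ≥0∞ :=
  ⨆ (c : Rn n) (h : ℝ) (_ : 0 < h), ENNReal.ofReal (bloAvg ω f (cube c h))

/-- `‖f‖_{BMO^p(ω)}` taken over cubes (extended-valued). -/
def bmoPNorm (p : ℝ) (ω f : Rn n → ℝ) : ℝ≥0∞ :=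
  ⨆ (c : Rn n) (h : ℝ) (_ : 0 < h),
    ((ENNReal.ofReal (wInt ω (cube c h)))⁻¹ *
      ∫⁻ x in cube c h,
        ENNReal.ofReal (|f x - avg f (cube c h)| ^ p * (ω x) ^ (1 - p))) ^ (1/p)

/-- `‖f‖_{BLO^p(ω)}` taken over cubes (extended-valued). -/
def bloPNorm (p : ℝ) (ω f : Rn n → ℝ) : ℝ≥0∞ :=
  ⨆ (c : Rn n) (h : ℝ) (_ : 0 < h),
    ((ENNReal.ofReal (wInt ω (cube c h)))⁻¹ *
      ∫⁻ x in cube c h,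
        ENNReal.ofReal ((f x - essInf f (volume.restrict (cube c h))) ^ p * (ω x) ^ (1 - p))) ^ (1/p)

/-- A weight: nonnegative, locally integrable, positive a.e. -/
def IsWeight (ω : Rn n → ℝ) : Prop :=
  (∀ x, 0 ≤ ω x) ∧ LocallyIntegrable ω volume ∧
    ∀ᵐ x ∂(volume : Measure (Rn n)), 0 < ω x

/-- `C` is an `A₁` bound for `ω` (over balls). -/
def A1ballBound (ω : Rn n → ℝ) (C : ℝ) : Prop :=
  0 < C ∧ ∀ (c : Rn n) (ρ : ℝ), 0 < ρ →
    avg ω (Metric.ball c ρ) ≤ C * essInf ω (volume.restrict (Metric.ball c ρ))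

/-- `ω ∈ A₁` (over balls). -/
def IsA1ball (ω : Rn n → ℝ) : Prop := ∃ C, A1ballBound ω C

/-- `[ω]_{A₁}` (over balls), the least `A₁` bound. -/
def A1ballConst (ω : Rn n → ℝ) : ℝ := sInf {C | A1ballBound ω C}

/-- `C` is an `A₁` bound for `ω` (over cubes). -/
def A1cubeBound (ω : Rn n → ℝ) (C : ℝ) : Prop :=
  0 < C ∧ ∀ (c : Rn n) (h : ℝ), 0 < h →
    avg ω (cube c h) ≤ C * essInf ω (volume.restrict (cube c h))

/-- `ω ∈ A₁` (over cubes). -/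
def IsA1cube (ω : Rn n → ℝ) : Prop := ∃ C, A1cubeBound ω C

/-- `[ω]_{A₁}` (over cubes), the least `A₁` bound. -/
def A1cubeConst (ω : Rn n → ℝ) : ℝ := sInf {C | A1cubeBound ω C}

/-- `C` is an `A₂` bound for `ω` (over balls). -/
def A2ballBound (ω : Rn n → ℝ) (C : ℝ) : Prop :=
  0 < C ∧ ∀ (c : Rn n) (ρ : ℝ), 0 < ρ →
    avg ω (Metric.ball c ρ) * avg (fun x => (ω x)⁻¹) (Metric.ball c ρ) ≤ C

/-- `ω ∈ A₂` (over balls). -/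
def IsA2ball (ω : Rn n → ℝ) : Prop := ∃ C, A2ballBound ω C

/-- `[ω]_{A₂}` (over balls), the least `A₂` bound. -/
def A2ballConst (ω : Rn n → ℝ) : ℝ := sInf {C | A2ballBound ω C}

/-- Conditions (P1), (P2), (P3) on the kernel ψ. -/
def PsiKernel (n : ℕ) (C₁ C₂ δ γ : ℝ) (ψ : Rn n → ℝ) : Prop :=
  Integrable ψ volume ∧ (∫ x, ψ x) = 0 ∧
  (∀ x : Rn n, |ψ x| ≤ C₁ * (1 + ‖x‖) ^ (-((n : ℝ) + δ))) ∧
  (∀ x h : Rn n, 2 * ‖h‖ ≤ ‖x‖ →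
    |ψ (x + h) - ψ x| ≤ C₂ * ‖h‖ ^ γ * (1 + ‖x‖) ^ (-((n : ℝ) + δ + γ)))

/-- The convolution `(ψ_t * f)(x)` where `ψ_t(x) = t^{-n} ψ(x/t)`. -/
def cvl (ψ : Rn n → ℝ) (t : ℝ) (f : Rn n → ℝ) (x : Rn n) : ℝ :=
  ∫ y, (t ^ n)⁻¹ * ψ (t⁻¹ • (x - y)) * f y

/-- The generalized Littlewood–Paley g-function `G(f)(x)`, valued in `[0,∞]`. -/
def Gfun (ψ f : Rn n → ℝ) (x : Rn n) : ℝ≥0∞ :=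
  (∫⁻ t in Ioi (0:ℝ), ENNReal.ofReal ((cvl ψ t f x) ^ 2 / t)) ^ (1/2 : ℝ)

/-- The dilated Lusin area integral `S_a(f)(x)` (aperture `a`), valued in `[0,∞]`. -/
def Sdil (ψ : Rn n → ℝ) (a : ℝ) (f : Rn n → ℝ) (x : Rn n) : ℝ≥0∞ :=
  (∫⁻ t in Ioi (0:ℝ), ∫⁻ y in Metric.ball x (a * t),
      ENNReal.ofReal ((cvl ψ t f y) ^ 2 / t ^ (n + 1))) ^ (1/2 : ℝ)

/-- The generalized Lusin area integral `S(f)(x)`, valued in `[0,∞]`. -/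
def Sfun (ψ f : Rn n → ℝ) (x : Rn n) : ℝ≥0∞ := Sdil ψ 1 f x

/-- Stein's function `G*_λ(f)(x)`, valued in `[0,∞]`. -/
def Gstar (ψ : Rn n → ℝ) (lam : ℝ) (f : Rn n → ℝ) (x : Rn n) : ℝ≥0∞ :=
  (∫⁻ t in Ioi (0:ℝ), ∫⁻ y,
      ENNReal.ofReal ((t / (t + dist x y)) ^ (lam * (n : ℝ)) *
        (cvl ψ t f y) ^ 2 / t ^ (n + 1))) ^ (1/2 : ℝ)



open scoped FourierTransform SchwartzMap in
/-- The `L²` Fourier transform agrees with the integral on `L¹ ∩ L²`. -/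
theorem fourier_L1L2_ae (u : Rn n → ℂ) (h1 : Integrable u) (h2 : MemLp u 2) :
    (𝓕 (h2.toLp u) : Lp (α := Rn n) ℂ 2) =ᵐ[volume] 𝓕 u := by
  have hcont : Continuous (𝓕 u) :=
    VectorFourier.fourierIntegral_continuous Real.continuous_fourierChar
      (by exact continuous_inner) h1
  apply ae_eq_of_integral_contDiff_smul_eq
  · exact (Lp.memLp _).locallyIntegrable (by norm_num)
  · exact hcont.locallyIntegrable
  · intro g hg hgc
    have hgC : ContDiff ℝ ((⊤ : ℕ∞) : WithTop ℕ∞) (fun x => (g x : ℂ)) := by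
      exact Complex.ofRealCLM.contDiff.comp hg
    have hgcC : HasCompactSupport (fun x => (g x : ℂ)) :=
      hgc.comp_left (g := fun r : ℝ => (r : ℂ)) (by simp)
    let φ : 𝓢(Rn n, ℂ) := hgcC.toSchwartzMap hgC
    have hφ : ∀ x, φ x = (g x : ℂ) := fun x => rfl
    have e1 := congrArg (fun T => T φ) (Lp.fourier_toTemperedDistribution_eq (h2.toLp u))
    simp only [TemperedDistribution.fourier_apply, Lp.toTemperedDistribution_apply] at e1
    have e2 : ∫ x, (𝓕 φ) x • (h2.toLp u) x = ∫ x, (𝓕 φ) x • u x := by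
      apply integral_congr_ae
      filter_upwards [h2.coeFn_toLp] with x hx
      rw [hx]
    have e3 : ∫ x, (𝓕 (φ : Rn n → ℂ)) x • u x = ∫ x, φ x • 𝓕 u x :=
      VectorFourier.integral_fourierIntegral_smul_eq_flip Real.continuous_fourierChar
      (L := innerₗ (Rn n)) (by exact continuous_inner) φ.integrable h1 |>.trans (by
        rw [flip_innerₗ]; rfl)
    have e4 : ∀ v : Rn n → ℂ, ∫ x, g x • v x = ∫ x, φ x • v x := by
      intro v
      congr 1
    rw [e4, e4, ← e3, ← SchwartzMap.fourier_coe, ← e2, e1]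

open scoped FourierTransform in
theorem plancherel_lintegral (u : Rn n → ℂ) (h1 : Integrable u) (h2 : MemLp u 2) :
    ∫⁻ x, ‖𝓕 u x‖ₑ ^ 2 = ∫⁻ x, ‖u x‖ₑ ^ 2 := by
  have h := Lp.norm_fourier_eq (h2.toLp u)
  have h' : eLpNorm (𝓕 u) 2 volume = eLpNorm u 2 volume := by
    rw [← eLpNorm_congr_ae (fourier_L1L2_ae u h1 h2), ← eLpNorm_congr_ae h2.coeFn_toLp,
      ← Lp.enorm_def, ← Lp.enorm_def, ← ofReal_norm, ← ofReal_norm, h]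
  have key : ∀ v : Rn n → ℂ, ∫⁻ x, ‖v x‖ₑ ^ 2 = (eLpNorm v 2 volume) ^ 2 := by
    intro v
    rw [eLpNorm_eq_lintegral_rpow_enorm_toReal (by norm_num) (by norm_num)]
    simp only [ENNReal.toReal_ofNat, ENNReal.rpow_two]
    rw [← ENNReal.rpow_natCast, ← ENNReal.rpow_mul]
    norm_num
  rw [key, key, h']

theorem finrank_Rn : Module.finrank ℝ (Rn n) = n := by simp

theorem lintegral_smul_inv (F : Rn n → ℝ≥0∞) {t : ℝ} (ht : 0 < t) :
    ∫⁻ y, F (t⁻¹ • y) = ENNReal.ofReal (t ^ n) * ∫⁻ y, F y := by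
  have h := Measure.map_addHaar_smul (volume : Measure (Rn n)) (inv_ne_zero ht.ne')
  have e : MeasurableEmbedding (fun y : Rn n => t⁻¹ • y) :=
    measurableEmbedding_const_smul₀ (inv_ne_zero ht.ne')
  have h2 := e.lintegral_map F (μ := volume)
  rw [← h2]
  erw [h]
  rw [lintegral_smul_measure, finrank_Rn]
  simp only [inv_pow, inv_inv, smul_eq_mul]
  rw [abs_of_pos (by positivity)]

theorem lintegral_scale_sub (F : Rn n → ℝ≥0∞) {t : ℝ} (ht : 0 < t) (z : Rn n) :
    ∫⁻ y, F (t⁻¹ • (y - z)) = ENNReal.ofReal (t ^ n) * ∫⁻ y, F y := by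
  rw [← lintegral_smul_inv F ht]
  exact lintegral_sub_right_eq_self (fun y => F (t⁻¹ • y)) z

theorem lintegral_scale_sub' (F : Rn n → ℝ≥0∞) {t : ℝ} (ht : 0 < t) (z : Rn n) :
    ∫⁻ y, F (t⁻¹ • (z - y)) = ENNReal.ofReal (t ^ n) * ∫⁻ y, F y := by
  rw [← lintegral_smul_inv F ht]
  exact lintegral_sub_left_eq_self (fun y => F (t⁻¹ • y)) z

/-- The constant `∫ (1+|x|)^{-(n+ε)} dx`. -/
def japC (n : ℕ) (ε : ℝ) : ℝ := (∫⁻ x : Rn n, ENNReal.ofReal ((1 + ‖x‖) ^ (-((n:ℝ) + ε)))).toReal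

theorem lintegral_jap {ε : ℝ} (hε : 0 < ε) :
    ∫⁻ x : Rn n, ENNReal.ofReal ((1 + ‖x‖) ^ (-((n:ℝ) + ε))) = ENNReal.ofReal (japC n ε) := by
  rw [japC, ENNReal.ofReal_toReal]
  exact (finite_integral_one_add_norm (by rw [finrank_Rn]; linarith)).ne

theorem integrable_jap' {ε : ℝ} (hε : 0 < ε) :
    Integrable (fun x : Rn n => (1 + ‖x‖) ^ (-((n:ℝ) + ε))) :=
  integrable_one_add_norm (by rw [finrank_Rn]; linarith)

theorem japC_nonneg (ε : ℝ) : 0 ≤ japC n ε := ENNReal.toReal_nonneg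

theorem lint_pow_small {a R : ℝ} (ha : 0 < a) (hR : 0 < R) :
    ∫⁻ t in Ioc 0 R, ENNReal.ofReal ((t / R) ^ a / t) = ENNReal.ofReal (1 / a) := by
  have h1 : IntervalIntegrable (fun t : ℝ => t ^ (a - 1)) volume 0 R :=
    intervalIntegral.intervalIntegrable_rpow' (by linarith)
  have h2 : IntegrableOn (fun t : ℝ => R ^ (-a) * t ^ (a - 1)) (Ioc 0 R) :=
    ((intervalIntegrable_iff_integrableOn_Ioc_of_le hR.le).1 h1).const_mul _
  have h3 : ∀ t ∈ Ioc (0:ℝ) R, (t / R) ^ a / t = R ^ (-a) * t ^ (a - 1) := by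
    intro t ht
    rw [Real.div_rpow ht.1.le hR.le, Real.rpow_sub_one ht.1.ne', Real.rpow_neg hR.le]
    field_simp
  rw [setLIntegral_congr_fun measurableSet_Ioc (fun t ht => by rw [h3 t ht])]
  rw [← ofReal_integral_eq_lintegral_ofReal h2]
  · rw [integral_const_mul, ← intervalIntegral.integral_of_le hR.le, integral_rpow (Or.inl (by linarith))]
    congr 1
    rw [Real.zero_rpow (by linarith), Real.rpow_neg hR.le]
    have : R ^ a ≠ 0 := (Real.rpow_pos_of_pos hR a).ne'
    simp only [sub_add_cancel, sub_zero]
    field_simp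
  · filter_upwards [ae_restrict_mem measurableSet_Ioc] with t ht
    exact mul_nonneg (Real.rpow_nonneg hR.le _) (Real.rpow_nonneg ht.1.le _)

theorem lint_pow_large {a R : ℝ} (ha : 0 < a) (hR : 0 < R) :
    ∫⁻ t in Ioi R, ENNReal.ofReal ((R / t) ^ a / t) = ENNReal.ofReal (1 / a) := by
  have h2 : IntegrableOn (fun t : ℝ => R ^ a * t ^ (-a - 1)) (Ioi R) :=
    (integrableOn_Ioi_rpow_of_lt (by linarith) hR).const_mul _
  have h3 : ∀ t ∈ Ioi R, (R / t) ^ a / t = R ^ a * t ^ (-a - 1) := by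
    intro t ht
    have ht0 : 0 < t := hR.trans ht
    rw [Real.div_rpow hR.le ht0.le, Real.rpow_sub_one ht0.ne', Real.rpow_neg ht0.le]
    field_simp
  rw [setLIntegral_congr_fun measurableSet_Ioi (fun t ht => by rw [h3 t ht])]
  rw [← ofReal_integral_eq_lintegral_ofReal h2]
  · rw [integral_const_mul, integral_Ioi_rpow_of_lt (by linarith) hR]
    congr 1
    have : R ^ a ≠ 0 := (Real.rpow_pos_of_pos hR a).ne'
    simp only [sub_add_cancel]
    rw [Real.rpow_neg hR.le]
    field_simp
  · filter_upwards [ae_restrict_mem measurableSet_Ioi] with t ht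
    exact mul_nonneg (Real.rpow_nonneg hR.le _) (Real.rpow_nonneg (hR.trans ht).le _)

/-- Volume of the unit ball. -/
def vB (n : ℕ) : ℝ := (volume (ball (0 : Rn n) 1)).toReal

theorem vB_pos : 0 < vB n := by
  unfold vB
  exact ENNReal.toReal_pos (measure_ball_pos _ _ one_pos).ne' measure_ball_lt_top.ne

theorem volume_ball_eq (c : Rn n) {r : ℝ} (hr : 0 < r) :
    volume (ball c r) = ENNReal.ofReal (vB n * r ^ n) := by
  rw [Measure.addHaar_ball_of_pos _ _ hr, finrank_Rn, vB, ENNReal.ofReal_mul ENNReal.toReal_nonneg,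
    ENNReal.ofReal_toReal measure_ball_lt_top.ne, mul_comm]

theorem volume_ball_toReal (c : Rn n) {r : ℝ} (hr : 0 < r) :
    (volume (ball c r)).toReal = vB n * r ^ n := by
  rw [volume_ball_eq c hr, ENNReal.toReal_ofReal]
  have := vB_pos (n := n)
  positivity

/-- `L¹` modulus of continuity of the kernel. -/
theorem psi_modulus (hn : 1 ≤ n) {C₁ C₂ δ γ : ℝ} (hC₁ : 0 < C₁) (hC₂ : 0 < C₂) (hδ : 0 < δ)
    (hγ : 0 < γ) {ψ : Rn n → ℝ} (hψ : PsiKernel n C₁ C₂ δ γ ψ) {ε : ℝ} (hε : 0 < ε)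
    (hε1 : ε ≤ 1) (hεγ : ε ≤ γ) :
    ∃ C : ℝ, 0 ≤ C ∧ ∀ h : Rn n, ∫⁻ x, ENNReal.ofReal |ψ (x + h) - ψ x| ≤
      ENNReal.ofReal (C * ‖h‖ ^ ε) := by
  obtain ⟨h1, h2, h3, h4⟩ := hψ
  set N : ℝ := (∫⁻ x, ENNReal.ofReal |ψ x|).toReal with hN
  have hNe : ∫⁻ x, ENNReal.ofReal |ψ x| = ENNReal.ofReal N := by
    rw [hN, ENNReal.ofReal_toReal]
    have := h1.2
    rw [hasFiniteIntegral_iff_norm] at this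
    exact this.ne
  have hN0 : 0 ≤ N := ENNReal.toReal_nonneg
  have hv := vB_pos (n := n)
  have hJ := japC_nonneg (n := n) (δ + γ)
  refine ⟨2 * N + (C₂ * japC n (δ + γ) + 2 * C₁ * (vB n * 3 ^ n)), by positivity, fun h => ?_⟩
  rcases eq_or_ne h 0 with rfl | hh0
  · simp
  have hh : 0 < ‖h‖ := norm_pos_iff.2 hh0
  rcases le_or_gt ‖h‖ 1 with hle | hgt
  · -- small shift
    have hpt : ∀ x, ENNReal.ofReal |ψ (x + h) - ψ x| ≤
        ENNReal.ofReal (C₂ * ‖h‖ ^ γ) * ENNReal.ofReal ((1 + ‖x‖) ^ (-((n:ℝ) + (δ + γ)))) +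
        (ball (0 : Rn n) (3 * ‖h‖)).indicator (fun _ => ENNReal.ofReal (2 * C₁)) x := by
      intro x
      rcases le_or_gt (2 * ‖h‖) ‖x‖ with hx | hx
      · refine le_trans ?_ le_self_add
        rw [← ENNReal.ofReal_mul (by positivity)]
        refine ENNReal.ofReal_le_ofReal ?_
        have := h4 x h hx
        rwa [add_assoc] at this
      · refine le_trans ?_ le_add_self
        rw [indicator_of_mem (by rw [mem_ball_zero_iff]; linarith)]
        refine ENNReal.ofReal_le_ofReal ?_
        have hb : ∀ u : Rn n, |ψ u| ≤ C₁ := by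
          intro u
          refine (h3 u).trans ?_
          have : (1 + ‖u‖) ^ (-((n:ℝ) + δ)) ≤ 1 :=
            Real.rpow_le_one_of_one_le_of_nonpos (by linarith [norm_nonneg u])
              (by have : (0:ℝ) ≤ n := n.cast_nonneg
                  linarith)
          nlinarith
        calc |ψ (x + h) - ψ x| ≤ |ψ (x + h)| + |ψ x| := abs_sub _ _
          _ ≤ 2 * C₁ := by linarith [hb (x + h), hb x]
    have hmeas : Measurable (fun x : Rn n => ENNReal.ofReal (C₂ * ‖h‖ ^ γ) *
        ENNReal.ofReal ((1 + ‖x‖) ^ (-((n:ℝ) + (δ + γ))))) := by fun_prop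
    refine (lintegral_mono hpt).trans ?_
    rw [lintegral_add_left hmeas, lintegral_const_mul _ (by fun_prop), lintegral_jap (by linarith),
      lintegral_indicator measurableSet_ball, setLIntegral_const,
      volume_ball_eq _ (by positivity), ← ENNReal.ofReal_mul (by positivity),
      ← ENNReal.ofReal_mul (by positivity), ← ENNReal.ofReal_add (by positivity) (by positivity)]
    refine ENNReal.ofReal_le_ofReal ?_
    have e1 : ‖h‖ ^ γ ≤ ‖h‖ ^ ε := Real.rpow_le_rpow_of_exponent_ge hh hle hεγ
    have e2 : ‖h‖ ^ n ≤ ‖h‖ ^ ε := by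
      rw [← Real.rpow_natCast]
      refine Real.rpow_le_rpow_of_exponent_ge hh hle (hε1.trans ?_)
      exact_mod_cast hn
    have e3 : 0 ≤ ‖h‖ ^ ε := by positivity
    calc C₂ * ‖h‖ ^ γ * japC n (δ + γ) + 2 * C₁ * (vB n * (3 * ‖h‖) ^ n)
        = (C₂ * japC n (δ + γ)) * ‖h‖ ^ γ + (2 * C₁ * (vB n * 3 ^ n)) * ‖h‖ ^ n := by
          rw [mul_pow]; ring
      _ ≤ (C₂ * japC n (δ + γ)) * ‖h‖ ^ ε + (2 * C₁ * (vB n * 3 ^ n)) * ‖h‖ ^ ε := by gcongr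
      _ ≤ _ := by nlinarith [mul_nonneg hN0 e3]
  · have hpt : ∀ x, ENNReal.ofReal |ψ (x + h) - ψ x| ≤
        ENNReal.ofReal |ψ (x + h)| + ENNReal.ofReal |ψ x| := by
      intro x
      rw [← ENNReal.ofReal_add (by positivity) (by positivity)]
      exact ENNReal.ofReal_le_ofReal (abs_sub _ _)
    have hae : AEMeasurable (fun x => ENNReal.ofReal |ψ x|) volume :=
      h1.1.norm.aemeasurable.ennreal_ofReal
    refine (lintegral_mono hpt).trans ?_
    rw [lintegral_add_right' _ hae, lintegral_add_right_eq_self (fun x => ENNReal.ofReal |ψ x|) h, hNe,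
      ← ENNReal.ofReal_add hN0 hN0]
    refine ENNReal.ofReal_le_ofReal ?_
    have e1 : 1 ≤ ‖h‖ ^ ε := Real.one_le_rpow hgt.le hε.le
    have e2 : 0 ≤ (C₂ * japC n (δ + γ) + 2 * C₁ * (vB n * 3 ^ n)) * ‖h‖ ^ ε := by positivity
    nlinarith

open scoped FourierTransform RealInnerProductSpace in
/-- Decay of the Fourier transform at infinity. -/
theorem psi_fourier_decay {ψ : Rn n → ℝ} (h1 : Integrable ψ) {C ε : ℝ} (hC : 0 ≤ C)
    (hmod : ∀ h : Rn n, ∫⁻ x, ENNReal.ofReal |ψ (x + h) - ψ x| ≤ ENNReal.ofReal (C * ‖h‖ ^ ε))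
    (hε : 0 < ε) (ξ : Rn n) (hξ : ξ ≠ 0) :
    ‖𝓕 (fun x => (ψ x : ℂ)) ξ‖ ≤ C * (1 / ‖ξ‖) ^ ε := by
  have h1C : Integrable (fun x => (ψ x : ℂ)) := h1.ofReal
  rw [Real.fourier_eq, fourierIntegral_eq_half_sub_half_period_translate hξ h1C]
  set k : Rn n := (1 / (2 * ‖ξ‖ ^ 2) : ℝ) • ξ
  have hξ' : 0 < ‖ξ‖ := norm_pos_iff.2 hξ
  have hk : ‖k‖ ≤ 1 / ‖ξ‖ := by
    rw [norm_smul, Real.norm_of_nonneg (by positivity)]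
    rw [show 1 / (2 * ‖ξ‖ ^ 2) * ‖ξ‖ = (1 / 2) * (1 / ‖ξ‖) by field_simp]
    have : 0 < 1 / ‖ξ‖ := by positivity
    linarith
  have hb : ‖∫ v : Rn n, Real.fourierChar (-⟪v, ξ⟫) • ((ψ v : ℂ) - (ψ (v + k) : ℂ))‖ ≤ C * ‖k‖ ^ ε := by
    have := norm_integral_le_lintegral_norm (μ := volume)
      (fun v : Rn n => Real.fourierChar (-⟪v, ξ⟫) • ((ψ v : ℂ) - (ψ (v + k) : ℂ)))
    refine this.trans ?_
    refine ENNReal.toReal_le_of_le_ofReal (by positivity) (le_trans (le_of_eq ?_) (hmod k))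
    congr 1
    ext v
    rw [Circle.norm_smul, ← Complex.ofReal_sub, Complex.norm_real, Real.norm_eq_abs, abs_sub_comm]
  have h2 : C * ‖k‖ ^ ε ≤ C * (1 / ‖ξ‖) ^ ε := by gcongr
  have h3 : ‖(1 / (2:ℂ))‖ = 1 / 2 := by norm_num
  have h4 := norm_smul (1 / (2:ℂ))
    (∫ v : Rn n, Real.fourierChar (-⟪v, ξ⟫) • ((ψ v : ℂ) - (ψ (v + k) : ℂ)))
  rw [h3] at h4
  refine h4.le.trans ?_
  have h0 := norm_nonneg (∫ v : Rn n, Real.fourierChar (-⟪v, ξ⟫) • ((ψ v : ℂ) - (ψ (v + k) : ℂ)))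
  linarith

open scoped FourierTransform RealInnerProductSpace in
/-- Vanishing of the Fourier transform at zero. -/
theorem psi_fourier_small {C₁ C₂ δ γ : ℝ} (hC₁ : 0 < C₁) (hδ : 0 < δ)
    {ψ : Rn n → ℝ} (hψ : PsiKernel n C₁ C₂ δ γ ψ) {ε : ℝ} (hε : 0 < ε)
    (hε1 : ε ≤ 1) (hεδ : ε ≤ δ / 2) (ξ : Rn n) :
    ‖𝓕 (fun x => (ψ x : ℂ)) ξ‖ ≤ (C₁ * (2 * Real.pi) * 2 * japC n (δ / 2)) * ‖ξ‖ ^ ε := by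
  obtain ⟨h1, h2, h3, h4⟩ := hψ
  have h1C : Integrable (fun x => (ψ x : ℂ)) := h1.ofReal
  have h0 : ∫ v : Rn n, (ψ v : ℂ) = 0 := by
    have := integral_ofReal (𝕜 := ℂ) (f := ψ) (μ := volume)
    rw [h2] at this
    simpa using this
  have e1 : 𝓕 (fun x => (ψ x : ℂ)) ξ =
      ∫ v : Rn n, ((Real.fourierChar (-⟪v, ξ⟫) : ℂ) - 1) * (ψ v : ℂ) := by
    have : ∀ v : Rn n, ((Real.fourierChar (-⟪v, ξ⟫) : ℂ) - 1) * (ψ v : ℂ) =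
      Real.fourierChar (-⟪v, ξ⟫) • (ψ v : ℂ) - (ψ v : ℂ) := by
      intro v; rw [Circle.smul_def, smul_eq_mul]; ring
    simp_rw [this]
    rw [integral_sub ((Real.fourierIntegral_convergent_iff ξ).2 h1C) h1C, h0, Real.fourier_eq]
    simp
  rw [e1]
  have hpi := Real.pi_gt_three
  have hJ := japC_nonneg (n := n) (δ / 2)
  refine (norm_integral_le_lintegral_norm _).trans ?_
  refine ENNReal.toReal_le_of_le_ofReal (by positivity) ?_
  have hpt : ∀ v : Rn n, ENNReal.ofReal ‖((Real.fourierChar (-⟪v, ξ⟫) : ℂ) - 1) * (ψ v : ℂ)‖ ≤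
      ENNReal.ofReal (C₁ * (2 * Real.pi) * 2 * ‖ξ‖ ^ ε) *
        ENNReal.ofReal ((1 + ‖v‖) ^ (-((n:ℝ) + δ / 2))) := by
    intro v
    rw [← ENNReal.ofReal_mul (by positivity)]
    refine ENNReal.ofReal_le_ofReal ?_
    rw [norm_mul, Complex.norm_real, Real.norm_eq_abs]
    have a1 : ‖(Real.fourierChar (-⟪v, ξ⟫) : ℂ) - 1‖ ≤ 2 * (2 * Real.pi) * (‖v‖ * ‖ξ‖) ^ ε := by
      rcases le_or_gt (‖v‖ * ‖ξ‖) 1 with hs | hs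
      · have b1 : ‖(Real.fourierChar (-⟪v, ξ⟫) : ℂ) - 1‖ ≤ 2 * Real.pi * (‖v‖ * ‖ξ‖) := by
          rw [Real.fourierChar_apply]
          have := Real.norm_exp_I_mul_ofReal_sub_one_le (x := 2 * Real.pi * (-⟪v, ξ⟫))
          rw [mul_comm Complex.I] at this
          refine this.trans ?_
          rw [Real.norm_eq_abs, abs_mul, abs_neg, abs_of_pos (by positivity)]
          gcongr
          exact abs_real_inner_le_norm v ξ
        have b2 : ‖v‖ * ‖ξ‖ ≤ (‖v‖ * ‖ξ‖) ^ ε := by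
          rcases eq_or_lt_of_le (show 0 ≤ ‖v‖ * ‖ξ‖ by positivity) with h | h
          · rw [← h, Real.zero_rpow hε.ne']
          · calc ‖v‖ * ‖ξ‖ = (‖v‖ * ‖ξ‖) ^ (1:ℝ) := (Real.rpow_one _).symm
              _ ≤ _ := Real.rpow_le_rpow_of_exponent_ge h hs hε1
        have b3 : 2 * Real.pi * (‖v‖ * ‖ξ‖) ≤ 2 * Real.pi * (‖v‖ * ‖ξ‖) ^ ε := by gcongr
        have b4 : 0 ≤ 2 * Real.pi * (‖v‖ * ‖ξ‖) ^ ε := by positivity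
        linarith
      · have b1 : ‖(Real.fourierChar (-⟪v, ξ⟫) : ℂ) - 1‖ ≤ 2 := by
          refine (norm_sub_le _ _).trans ?_
          rw [Circle.norm_coe, norm_one]
          norm_num
        have b2 : 1 ≤ (‖v‖ * ‖ξ‖) ^ ε := Real.one_le_rpow hs.le hε.le
        nlinarith
    have a2 := h3 v
    have a3 : ‖v‖ ^ ε * (1 + ‖v‖) ^ (-((n:ℝ) + δ)) ≤ (1 + ‖v‖) ^ (-((n:ℝ) + δ / 2)) := by
      have hp : 0 < 1 + ‖v‖ := by positivity
      calc ‖v‖ ^ ε * (1 + ‖v‖) ^ (-((n:ℝ) + δ)) ≤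
          (1 + ‖v‖) ^ (δ / 2) * (1 + ‖v‖) ^ (-((n:ℝ) + δ)) := by
            gcongr
            refine (Real.rpow_le_rpow (norm_nonneg _) (le_add_of_nonneg_left zero_le_one) hε.le).trans ?_
            exact Real.rpow_le_rpow_of_exponent_le (by linarith [norm_nonneg v]) hεδ
        _ = _ := by rw [← Real.rpow_add hp]; congr 1; ring
    calc _ ≤ (2 * (2 * Real.pi) * (‖v‖ * ‖ξ‖) ^ ε) * (C₁ * (1 + ‖v‖) ^ (-((n:ℝ) + δ))) := by gcongr
      _ = C₁ * (2 * Real.pi) * 2 * ‖ξ‖ ^ ε * (‖v‖ ^ ε * (1 + ‖v‖) ^ (-((n:ℝ) + δ))) := by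
        rw [Real.mul_rpow (norm_nonneg _) (norm_nonneg _)]; ring
      _ ≤ _ := by gcongr
  refine (lintegral_mono hpt).trans ?_
  rw [lintegral_const_mul _ (by fun_prop), lintegral_jap (by linarith),
    ← ENNReal.ofReal_mul (by positivity)]
  refine ENNReal.ofReal_le_ofReal (le_of_eq ?_)
  ring

theorem memLp_two_of_bdd {u : Rn n → ℂ} (h1 : Integrable u) {M : ℝ} (hM : ∀ x, ‖u x‖ ≤ M) :
    MemLp u 2 := by
  rw [memLp_two_iff_integrable_sq_norm h1.1]
  refine (h1.norm.const_mul M).mono' (h1.1.norm.pow 2) ?_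
  filter_upwards with x
  rw [Real.norm_of_nonneg (by positivity), sq]
  gcongr
  exact hM x

theorem psit_integrable {ψ : Rn n → ℝ} (h1 : Integrable ψ) {t : ℝ} (ht : 0 < t) :
    Integrable (fun x => (t ^ n)⁻¹ * ψ (t⁻¹ • x)) :=
  (h1.comp_smul (inv_ne_zero ht.ne')).const_mul _

open scoped FourierTransform RealInnerProductSpace in
theorem fourier_psit {ψ : Rn n → ℝ} {t : ℝ} (ht : 0 < t) (ξ : Rn n) :
    𝓕 (fun x => (((t ^ n)⁻¹ * ψ (t⁻¹ • x) : ℝ) : ℂ)) ξ = 𝓕 (fun x => (ψ x : ℂ)) (t • ξ) := by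
  rw [Real.fourier_eq, Real.fourier_eq]
  have := Measure.integral_comp_smul (volume : Measure (Rn n))
    (fun v => Real.fourierChar (-⟪v, t • ξ⟫) • (ψ v : ℂ)) t⁻¹
  rw [finrank_Rn, inv_pow, inv_inv, abs_of_pos (by positivity)] at this
  have e : ∀ v : Rn n, Real.fourierChar (-⟪v, ξ⟫) • (((t ^ n)⁻¹ * ψ (t⁻¹ • v) : ℝ) : ℂ) =
      (t ^ n)⁻¹ • (Real.fourierChar (-⟪t⁻¹ • v, t • ξ⟫) • (ψ (t⁻¹ • v) : ℂ)) := by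
    intro v
    rw [inner_smul_left, inner_smul_right]
    have : (starRingEnd ℝ) t⁻¹ * (t * ⟪v, ξ⟫) = ⟪v, ξ⟫ := by
      simp; field_simp
    rw [this, Circle.smul_def, Circle.smul_def, Complex.ofReal_mul, smul_eq_mul, smul_eq_mul,
      Complex.real_smul]
    ring
  simp_rw [e]
  rw [integral_smul, this, smul_smul, inv_mul_cancel₀ (by positivity), one_smul]

open scoped FourierTransform Convolution in
theorem cvl_L2_fourier {ψ g : Rn n → ℝ} (h1 : Integrable ψ) (hg : Integrable g) {M : ℝ}
    (hM : ∀ x, |g x| ≤ M) {t : ℝ} (ht : 0 < t) :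
    ∫⁻ y, ENNReal.ofReal ((cvl ψ t g y) ^ 2) =
      ∫⁻ ξ, ENNReal.ofReal (‖𝓕 (fun x => (ψ x : ℂ)) (t • ξ)‖ ^ 2) *
        ‖𝓕 (fun x => (g x : ℂ)) ξ‖ₑ ^ 2 := by
  set gC : Rn n → ℂ := fun x => (g x : ℂ) with hgC
  set pC : Rn n → ℂ := fun x => (((t ^ n)⁻¹ * ψ (t⁻¹ • x) : ℝ) : ℂ) with hpC
  have igC : Integrable gC := hg.ofReal
  have ipr := psit_integrable h1 ht
  have ipC : Integrable pC := ipr.ofReal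
  set u : Rn n → ℂ := gC ⋆[ContinuousLinearMap.mul ℂ ℂ] pC with hu
  have hcv : ∀ y, u y = (cvl ψ t g y : ℂ) := by
    intro y
    rw [hu, convolution_def, cvl, ← integral_complex_ofReal]
    congr 1
    ext z
    simp [hgC, hpC]
    ring
  have hui : Integrable u := igC.integrable_convolution _ ipC
  have hub : ∀ y, ‖u y‖ ≤ M * ∫ x, |(t ^ n)⁻¹ * ψ (t⁻¹ • x)| := by
    intro y
    rw [hu, convolution_def]
    have e := integral_sub_left_eq_self (fun x => |(t ^ n)⁻¹ * ψ (t⁻¹ • x)|) volume y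
    rw [← e, ← integral_const_mul]
    refine norm_integral_le_of_norm_le ((ipr.norm.comp_sub_left y).const_mul M) ?_
    filter_upwards with z
    rw [ContinuousLinearMap.mul_apply', norm_mul]
    simp only [hgC, hpC, Complex.norm_real, Real.norm_eq_abs]
    gcongr
    exact hM z
  have hum := memLp_two_of_bdd hui hub
  have hpl := plancherel_lintegral u hui hum
  have e1 : ∀ y, ENNReal.ofReal ((cvl ψ t g y) ^ 2) = ‖u y‖ₑ ^ 2 := by
    intro y
    rw [hcv, ← ofReal_norm, ← ENNReal.ofReal_pow (norm_nonneg _), Complex.norm_real,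
      Real.norm_eq_abs, sq_abs]
  simp_rw [e1]
  rw [← hpl]
  congr 1
  ext ξ
  rw [hu, Real.fourier_mul_convolution_eq igC ipC, enorm_mul, mul_pow, mul_comm, hpC,
    fourier_psit ht, ← ofReal_norm (𝓕 (fun x => (ψ x : ℂ)) (t • ξ)),
    ENNReal.ofReal_pow (norm_nonneg _)]

open scoped FourierTransform in
theorem fourier_t_integral {F : Rn n → ℂ} {A B ε : ℝ} (hA : 0 ≤ A) (hB : 0 ≤ B) (hε : 0 < ε)
    (h1 : ∀ ξ, ‖F ξ‖ ≤ A * ‖ξ‖ ^ ε) (h2 : ∀ ξ, ξ ≠ 0 → ‖F ξ‖ ≤ B * (1 / ‖ξ‖) ^ ε) (ξ : Rn n) :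
    ∫⁻ t in Ioi (0:ℝ), ENNReal.ofReal (‖F (t • ξ)‖ ^ 2 / t) ≤
      ENNReal.ofReal ((A ^ 2 + B ^ 2) / (2 * ε)) := by
  rcases eq_or_ne ξ 0 with rfl | hξ
  · have h0 : F 0 = 0 := by
      have := h1 0
      rw [norm_zero, Real.zero_rpow hε.ne', mul_zero] at this
      exact norm_le_zero_iff.1 this
    simp [h0]
  have hξ' : 0 < ‖ξ‖ := norm_pos_iff.2 hξ
  set R : ℝ := 1 / ‖ξ‖ with hR
  have hR0 : 0 < R := by positivity
  rw [← Ioc_union_Ioi_eq_Ioi hR0.le]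
  refine (lintegral_union_le _ _ _).trans ?_
  have e1 : ∫⁻ t in Ioc 0 R, ENNReal.ofReal (‖F (t • ξ)‖ ^ 2 / t) ≤
      ENNReal.ofReal (A ^ 2 * (1 / (2 * ε))) := by
    rw [ENNReal.ofReal_mul (by positivity), ← lint_pow_small (by positivity : 0 < 2 * ε) hR0,
      ← lintegral_const_mul _ (by fun_prop)]
    refine setLIntegral_mono (by fun_prop) ?_
    intro t ht
    have ht0 : 0 < t := ht.1
    rw [← ENNReal.ofReal_mul (by positivity)]
    refine ENNReal.ofReal_le_ofReal ?_
    rw [← mul_div_assoc]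
    gcongr
    have hh := h1 (t • ξ)
    rw [norm_smul, Real.norm_of_nonneg ht0.le] at hh
    have : t * ‖ξ‖ = t / R := by rw [hR]; field_simp
    rw [this] at hh
    calc ‖F (t • ξ)‖ ^ 2 ≤ (A * (t / R) ^ ε) ^ 2 := by gcongr
      _ = A ^ 2 * (t / R) ^ (2 * ε) := by
        rw [mul_pow, mul_comm 2 ε, Real.rpow_mul (by positivity)]; norm_num
  have e2 : ∫⁻ t in Ioi R, ENNReal.ofReal (‖F (t • ξ)‖ ^ 2 / t) ≤
      ENNReal.ofReal (B ^ 2 * (1 / (2 * ε))) := by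
    rw [ENNReal.ofReal_mul (by positivity), ← lint_pow_large (by positivity : 0 < 2 * ε) hR0,
      ← lintegral_const_mul _ (by fun_prop)]
    refine setLIntegral_mono (by fun_prop) ?_
    intro t ht
    have ht0 : 0 < t := hR0.trans ht
    rw [← ENNReal.ofReal_mul (by positivity)]
    refine ENNReal.ofReal_le_ofReal ?_
    rw [← mul_div_assoc]
    gcongr
    have hh := h2 (t • ξ) (smul_ne_zero ht0.ne' hξ)
    rw [norm_smul, Real.norm_of_nonneg ht0.le] at hh
    have : 1 / (t * ‖ξ‖) = R / t := by rw [hR]; field_simp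
    rw [this] at hh
    calc ‖F (t • ξ)‖ ^ 2 ≤ (B * (R / t) ^ ε) ^ 2 := by gcongr
      _ = B ^ 2 * (R / t) ^ (2 * ε) := by
        rw [mul_pow, mul_comm 2 ε, Real.rpow_mul (by positivity)]; norm_num
  refine (add_le_add e1 e2).trans ?_
  rw [← ENNReal.ofReal_add (by positivity) (by positivity)]
  refine ENNReal.ofReal_le_ofReal (le_of_eq ?_)
  ring

open scoped FourierTransform in
/-- The unweighted `L²` bound for the vertical square function. -/
theorem sq_fun_L2 (hn : 1 ≤ n) {C₁ C₂ δ γ : ℝ} (hC₁ : 0 < C₁) (hC₂ : 0 < C₂) (hδ : 0 < δ)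
    (hγ : 0 < γ) {ψ : Rn n → ℝ} (hψ : PsiKernel n C₁ C₂ δ γ ψ) :
    ∃ C : ℝ, 0 ≤ C ∧ ∀ (g : Rn n → ℝ) (M : ℝ), Integrable g → (∀ x, |g x| ≤ M) →
      ∫⁻ t in Ioi (0:ℝ), ∫⁻ y, ENNReal.ofReal ((cvl ψ t g y) ^ 2 / t) ≤
        ENNReal.ofReal C * ∫⁻ y, ENNReal.ofReal (g y ^ 2) := by
  set ε := min (min 1 γ) (δ / 2) with hε
  have hε0 : 0 < ε := by simp only [hε, lt_min_iff]; exact ⟨⟨one_pos, hγ⟩, by linarith⟩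
  have hε1 : ε ≤ 1 := (min_le_left _ _).trans (min_le_left _ _)
  have hεγ : ε ≤ γ := (min_le_left _ _).trans (min_le_right _ _)
  have hεδ : ε ≤ δ / 2 := min_le_right _ _
  obtain ⟨B, hB, hmod⟩ := psi_modulus hn hC₁ hC₂ hδ hγ hψ hε0 hε1 hεγ
  have hA : 0 ≤ (C₁ * (2 * Real.pi) * 2 * japC n (δ / 2)) := by
    have hJ := japC_nonneg (n := n) (δ / 2)
    have hpi := Real.pi_pos
    positivity
  set A := (C₁ * (2 * Real.pi) * 2 * japC n (δ / 2))
  have h1 := psi_fourier_small hC₁ hδ hψ hε0 hε1 hεδ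
  have h2 := psi_fourier_decay hψ.1 hB hmod hε0
  have hcont : Continuous (𝓕 (fun x => (ψ x : ℂ))) :=
    VectorFourier.fourierIntegral_continuous Real.continuous_fourierChar
      (by exact continuous_inner) hψ.1.ofReal
  refine ⟨(A ^ 2 + B ^ 2) / (2 * ε), by positivity, fun g M hg hM => ?_⟩
  set F := 𝓕 (fun x => (ψ x : ℂ)) with hF
  have hcontg : Continuous (𝓕 (fun x => (g x : ℂ))) :=
    VectorFourier.fourierIntegral_continuous Real.continuous_fourierChar
      (by exact continuous_inner) hg.ofReal
  set G := 𝓕 (fun x => (g x : ℂ)) with hG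
  have e1 : ∀ t ∈ Ioi (0:ℝ), ∫⁻ y, ENNReal.ofReal ((cvl ψ t g y) ^ 2 / t) =
      ∫⁻ ξ, ENNReal.ofReal (‖F (t • ξ)‖ ^ 2 / t) * ‖G ξ‖ₑ ^ 2 := by
    intro t ht
    have ht0 : (0:ℝ) < t := ht
    have hm : Measurable (fun ξ : Rn n => ENNReal.ofReal (‖F (t • ξ)‖ ^ 2) * ‖G ξ‖ₑ ^ 2) := by
      have : Continuous (fun ξ => ‖F (t • ξ)‖ ^ 2) := by fun_prop
      exact this.measurable.ennreal_ofReal.mul (hcontg.enorm.measurable.pow_const 2)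
    have a1 : ∀ y, ENNReal.ofReal ((cvl ψ t g y) ^ 2 / t) =
        ENNReal.ofReal t⁻¹ * ENNReal.ofReal ((cvl ψ t g y) ^ 2) := by
      intro y; rw [← ENNReal.ofReal_mul (by positivity)]; congr 1; field_simp
    have a2 : ∀ ξ, ENNReal.ofReal (‖F (t • ξ)‖ ^ 2 / t) * ‖G ξ‖ₑ ^ 2 =
        ENNReal.ofReal t⁻¹ * (ENNReal.ofReal (‖F (t • ξ)‖ ^ 2) * ‖G ξ‖ₑ ^ 2) := by
      intro y; rw [← mul_assoc, ← ENNReal.ofReal_mul (by positivity)]; congr 2; field_simp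
    simp_rw [a1, a2]
    rw [lintegral_const_mul' _ _ ENNReal.ofReal_ne_top, lintegral_const_mul _ hm,
      cvl_L2_fourier hψ.1 hg hM ht0]
  rw [setLIntegral_congr_fun measurableSet_Ioi e1]
  have hmeas : Measurable (fun p : ℝ × Rn n =>
      ENNReal.ofReal (‖F (p.1 • p.2)‖ ^ 2 / p.1) * ‖G p.2‖ₑ ^ 2) := by
    have c1 : Continuous (fun p : ℝ × Rn n => ‖F (p.1 • p.2)‖ ^ 2) := by fun_prop
    have c2 : Continuous (fun p : ℝ × Rn n => ‖G p.2‖ₑ) := by fun_prop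
    exact (c1.measurable.div measurable_fst).ennreal_ofReal.mul (c2.measurable.pow_const 2)
  rw [lintegral_lintegral_swap hmeas.aemeasurable]
  have hgM : MemLp (fun x => (g x : ℂ)) 2 := memLp_two_of_bdd hg.ofReal (M := M) (by
    intro x; rw [Complex.norm_real]; exact hM x)
  have e3 : ∫⁻ y, ENNReal.ofReal (g y ^ 2) = ∫⁻ ξ, ‖G ξ‖ₑ ^ 2 := by
    have hgC : Integrable (fun x => (g x : ℂ)) := hg.ofReal
    have hpl := plancherel_lintegral (fun x => (g x : ℂ)) hgC hgM
    refine Eq.trans ?_ hpl.symm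
    congr 1
    ext y
    rw [← ofReal_norm, ← ENNReal.ofReal_pow (norm_nonneg _), Complex.norm_real,
      Real.norm_eq_abs, sq_abs]
  rw [e3, ← lintegral_const_mul _ (hcontg.enorm.measurable.pow_const 2)]
  refine lintegral_mono fun ξ => ?_
  have hm2 : Measurable (fun t : ℝ => ENNReal.ofReal (‖F (t • ξ)‖ ^ 2 / t)) := by
    have c1 : Continuous (fun t : ℝ => ‖F (t • ξ)‖ ^ 2) := by fun_prop
    exact (c1.measurable.div measurable_id).ennreal_ofReal
  rw [lintegral_mul_const _ hm2]
  gcongr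
  exact fourier_t_integral hA hB hε0 h1 h2 ξ

/-- Working form of the `A₁` condition. -/
structure A1P (ω : Rn n → ℝ) (CA : ℝ) : Prop where
  one_le : 1 ≤ CA
  nonneg : ∀ x, 0 ≤ ω x
  loc : LocallyIntegrable ω volume
  pos : ∀ (c : Rn n) (r : ℝ), 0 < r → 0 < wInt ω (ball c r)
  ae : ∀ (c : Rn n) (r : ℝ), 0 < r → ∀ᵐ x ∂(volume.restrict (ball c r)),
    wInt ω (ball c r) ≤ CA * (vB n * r ^ n) * ω x

theorem integrableOn_ball {f : Rn n → ℝ} (hf : LocallyIntegrable f volume) (c : Rn n) (r : ℝ) :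
    IntegrableOn f (ball c r) :=
  (hf.integrableOn_isCompact (isCompact_closedBall c r)).mono_set ball_subset_closedBall

theorem exists_A1P {ω : Rn n → ℝ} (hω : IsWeight ω) (hA1 : IsA1ball ω) : ∃ CA, A1P ω CA := by
  obtain ⟨h0, hloc, hpos⟩ := hω
  obtain ⟨C, hC, hb⟩ := hA1
  have hballpos : ∀ (c : Rn n) (r : ℝ), 0 < r → 0 < wInt ω (ball c r) := by
    intro c r hr
    unfold wInt
    rw [setIntegral_pos_iff_support_of_nonneg_ae (ae_of_all _ h0) (integrableOn_ball hloc c r)]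
    have : volume (ball c r) ≤ volume (Function.support ω ∩ ball c r) := by
      apply measure_mono_ae
      filter_upwards [hpos] with x hx hxb
      exact ⟨hx.ne', hxb⟩
    exact lt_of_lt_of_le (measure_ball_pos _ _ hr) this
  refine ⟨max 1 C, le_max_left _ _, h0, hloc, hballpos, ?_⟩
  intro c r hr
  have hv : 0 < vB n * r ^ n := mul_pos vB_pos (pow_pos hr n)
  have h1 := hb c r hr
  have hne : (ae (volume.restrict (ball c r))).NeBot := by
    rw [ae_neBot, Ne, Measure.restrict_eq_zero]
    exact (measure_ball_pos _ _ hr).ne'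
  have hco : Filter.IsCoboundedUnder (· ≥ ·) (ae (volume.restrict (ball c r))) ω := by
    refine ⟨avg ω (ball c r), fun a ha => ?_⟩
    rw [Filter.eventually_map] at ha
    have hai : a * (vB n * r ^ n) ≤ ∫ x in ball c r, ω x := by
      have := integral_mono_ae (μ := volume.restrict (ball c r)) (f := fun _ => a) (g := ω)
        (integrableOn_const (measure_ball_lt_top.ne) ) (integrableOn_ball hloc c r) ha
      rw [setIntegral_const, Measure.real, volume_ball_toReal c hr, smul_eq_mul] at this
      linarith
    unfold avg
    rw [volume_ball_toReal c hr, ge_iff_le, inv_mul_eq_div, le_div_iff₀ hv]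
    exact hai
  have hbd : Filter.IsBoundedUnder (· ≥ ·) (ae (volume.restrict (ball c r))) ω :=
    Filter.isBoundedUnder_of ⟨0, fun x => h0 x⟩
  have h2 := ae_essInf_le (μ := volume.restrict (ball c r)) (f := ω) hbd
  filter_upwards [h2] with x hx
  have : avg ω (ball c r) ≤ max 1 C * ω x := by
    refine h1.trans ((mul_le_mul_of_nonneg_left hx hC.le).trans ?_)
    exact mul_le_mul_of_nonneg_right (le_max_right _ _) (h0 x)
  unfold avg at this
  rw [volume_ball_toReal c hr, inv_mul_eq_div, div_le_iff₀ hv] at this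
  unfold wInt
  linarith

/-- The weighted measure. -/
def wm (ω : Rn n → ℝ) : Measure (Rn n) := volume.withDensity (fun x => ENNReal.ofReal (ω x))

theorem wm_apply (ω : Rn n → ℝ) {E : Set (Rn n)} (hE : MeasurableSet E) :
    wm ω E = ∫⁻ x in E, ENNReal.ofReal (ω x) := withDensity_apply _ hE

theorem wm_ball {ω : Rn n → ℝ} {CA : ℝ} (h : A1P ω CA) (c : Rn n) (r : ℝ) :
    wm ω (ball c r) = ENNReal.ofReal (wInt ω (ball c r)) := by
  rw [wm_apply _ measurableSet_ball, wInt,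
    ofReal_integral_eq_lintegral_ofReal (integrableOn_ball h.loc c r) (ae_of_all _ h.nonneg)]

theorem A1P.lower {ω : Rn n → ℝ} {CA : ℝ} (h : A1P ω CA) {c : Rn n} {r : ℝ} (hr : 0 < r)
    {E : Set (Rn n)} (hE : MeasurableSet E) (hEB : E ⊆ ball c r) :
    volume E * ENNReal.ofReal (wInt ω (ball c r)) ≤
      ENNReal.ofReal (CA * (vB n * r ^ n)) * wm ω E := by
  rw [wm_apply _ hE, ← lintegral_const_mul' _ _ ENNReal.ofReal_ne_top, mul_comm,
    ← setLIntegral_const]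
  refine lintegral_mono_ae ?_
  have h1 := ae_mono (Measure.restrict_mono hEB le_rfl) (h.ae c r hr)
  filter_upwards [h1] with x hx
  have : 0 ≤ CA * (vB n * r ^ n) := by
    have := vB_pos (n := n); have := h.one_le; positivity
  rw [← ENNReal.ofReal_mul this]
  exact ENNReal.ofReal_le_ofReal hx

theorem A1P.mono {ω : Rn n → ℝ} {CA : ℝ} (h : A1P ω CA) {c c' : Rn n} {r r' : ℝ}
    (hB : ball c r ⊆ ball c' r') : wInt ω (ball c r) ≤ wInt ω (ball c' r') :=
  setIntegral_mono_set (integrableOn_ball h.loc c' r') (ae_of_all _ h.nonneg)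
    hB.eventuallyLE

theorem A1P.dbl {ω : Rn n → ℝ} {CA : ℝ} (h : A1P ω CA) {c c' : Rn n} {r r' : ℝ}
    (hr : 0 < r) (hr' : 0 < r') (hB : ball c r ⊆ ball c' r') :
    wInt ω (ball c' r') ≤ CA * (r' / r) ^ n * wInt ω (ball c r) := by
  have h1 := h.lower hr' measurableSet_ball hB
  have hv := vB_pos (n := n)
  have hC := h.one_le
  rw [volume_ball_eq c hr, wm_ball h, ← ENNReal.ofReal_mul (by positivity),
    ← ENNReal.ofReal_mul (by positivity), ENNReal.ofReal_le_ofReal_iff (by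
      have := h.pos c r hr; positivity)] at h1
  have h2 : r ^ n * wInt ω (ball c' r') ≤ CA * r' ^ n * wInt ω (ball c r) := by
    refine le_of_mul_le_mul_left ?_ hv
    calc _ = vB n * r ^ n * wInt ω (ball c' r') := by ring
      _ ≤ _ := h1
      _ = _ := by ring
  rw [div_pow]
  have hrn : 0 < r ^ n := by positivity
  calc wInt ω (ball c' r') = (r ^ n * wInt ω (ball c' r')) / r ^ n := by field_simp
    _ ≤ (CA * r' ^ n * wInt ω (ball c r)) / r ^ n := by gcongr
    _ = _ := by ring

/-- Working form of the BMO condition. -/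
structure BM (ω f : Rn n → ℝ) (K : ℝ) : Prop where
  pos : 0 < K
  loc : LocallyIntegrable f volume
  osc : ∀ (c : Rn n) (r : ℝ), 0 < r →
    ∫⁻ x in ball c r, ENNReal.ofReal |f x - avg f (ball c r)| ≤
      ENNReal.ofReal (K * wInt ω (ball c r))

theorem BM.of_norm {ω f : Rn n → ℝ} {CA K : ℝ} (h : A1P ω CA) (hf : LocallyIntegrable f volume)
    (hK : 0 < K) (hfK : bmoNorm ω f ≤ ENNReal.ofReal K) : BM ω f K := by
  refine ⟨hK, hf, fun c r hr => ?_⟩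
  have h1 : ENNReal.ofReal (bmoAvg ω f (ball c r)) ≤ ENNReal.ofReal K := by
    refine le_trans ?_ hfK
    unfold bmoNorm
    exact le_iSup_of_le c (le_iSup_of_le r (le_iSup_of_le hr le_rfl))
  rw [ENNReal.ofReal_le_ofReal_iff hK.le] at h1
  unfold bmoAvg at h1
  have hw := h.pos c r hr
  rw [inv_mul_eq_div, div_le_iff₀ hw] at h1
  rw [← ofReal_integral_eq_lintegral_ofReal]
  · exact ENNReal.ofReal_le_ofReal h1
  · exact ((integrableOn_ball hf c r).sub (integrableOn_const measure_ball_lt_top.ne)).abs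
  · exact ae_of_all _ fun _ => abs_nonneg _

theorem avg_sub_le {f : Rn n → ℝ} {E : Set (Rn n)} (hf : IntegrableOn f E)
    (h0 : volume E ≠ 0) (hE : volume E ≠ ∞) (a : ℝ) :
    ENNReal.ofReal |avg f E - a| * volume E ≤ ∫⁻ x in E, ENNReal.ofReal |f x - a| := by
  have hpos : 0 < (volume E).toReal := ENNReal.toReal_pos h0 hE
  have hfint : Integrable (fun x => f x - a) (volume.restrict E) := hf.sub (integrableOn_const hE)
  have h1 : (avg f E - a) * (volume E).toReal = ∫ x in E, (f x - a) := by
    rw [integral_sub hf (integrableOn_const hE), setIntegral_const, avg, Measure.real, smul_eq_mul]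
    field_simp
  rw [← ofReal_integral_eq_lintegral_ofReal hfint.abs (ae_of_all _ fun _ => abs_nonneg _)]
  have e : ENNReal.ofReal |avg f E - a| * volume E =
      ENNReal.ofReal (|avg f E - a| * (volume E).toReal) := by
    rw [ENNReal.ofReal_mul (abs_nonneg _), ENNReal.ofReal_toReal hE]
  rw [e]
  apply ENNReal.ofReal_le_ofReal
  rw [← abs_of_pos hpos, ← abs_mul, h1]
  exact abs_integral_le_integral_abs

theorem lint_abs_sub_le {f : Rn n → ℝ} {E : Set (Rn n)} (a b : ℝ) :
    ∫⁻ x in E, ENNReal.ofReal |f x - a| ≤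
      (∫⁻ x in E, ENNReal.ofReal |f x - b|) + ENNReal.ofReal |b - a| * volume E := by
  rw [← setLIntegral_const, ← lintegral_add_right _ measurable_const]
  refine lintegral_mono fun x => ?_
  simp only
  rw [← ENNReal.ofReal_add (abs_nonneg _) (abs_nonneg _)]
  apply ENNReal.ofReal_le_ofReal
  exact abs_sub_le _ _ _

/-- Dyadic dilates. -/
theorem BM.dyadic {ω f : Rn n → ℝ} {CA K : ℝ} (h : A1P ω CA) (hf : BM ω f K)
    (y : Rn n) {r : ℝ} (hr : 0 < r) (k : ℕ) :
    ∫⁻ z in ball y (2 ^ k * r), ENNReal.ofReal |f z - avg f (ball y r)| ≤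
      ENNReal.ofReal (CA * 2 ^ n * K * wInt ω (ball y r) * ((k + 1) * 2 ^ (k * n))) := by
  have hv := vB_pos (n := n)
  have hC := h.one_le
  have hK := hf.pos
  have hw := h.pos y r hr
  have hdbl : ∀ k : ℕ, wInt ω (ball y (2 ^ k * r)) ≤ CA * 2 ^ (k * n) * wInt ω (ball y r) := by
    intro k
    have := h.dbl hr (r' := 2 ^ k * r) (by positivity) (ball_subset_ball (x := y) (by
      have : (1:ℝ) ≤ 2 ^ k := one_le_pow₀ (by norm_num)
      nlinarith))
    rw [mul_div_cancel_right₀ _ hr.ne', ← pow_mul] at this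
    exact this
  have hstep : ∀ k : ℕ, |avg f (ball y (2 ^ k * r)) - avg f (ball y (2 ^ (k + 1) * r))| ≤
      CA * 2 ^ n * K * wInt ω (ball y r) / (vB n * r ^ n) := by
    intro k
    have h1 := avg_sub_le (integrableOn_ball hf.loc y (2 ^ k * r))
      (measure_ball_pos volume y (by positivity : 0 < 2 ^ k * r)).ne' measure_ball_lt_top.ne
      (avg f (ball y (2 ^ (k + 1) * r)))
    have h2 := h1.trans ((lintegral_mono_set (ball_subset_ball (x := y) (by
      rw [pow_succ]; have : (0:ℝ) < 2 ^ k * r := by positivity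
      linarith : 2 ^ k * r ≤ 2 ^ (k + 1) * r))).trans (hf.osc y (2 ^ (k + 1) * r) (by positivity)))
    rw [volume_ball_eq y (by positivity), ← ENNReal.ofReal_mul (abs_nonneg _),
      ENNReal.ofReal_le_ofReal_iff (by
        have := h.pos y (2 ^ (k + 1) * r) (by positivity); positivity)] at h2
    have h3 := h2.trans (mul_le_mul_of_nonneg_left (hdbl (k + 1)) hK.le)
    rw [le_div_iff₀ (by positivity)]
    refine le_of_mul_le_mul_left ?_ (by positivity : (0:ℝ) < 2 ^ (k * n))
    calc _ = _ := by rw [mul_pow, ← pow_mul]; ring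
      _ ≤ _ := h3
      _ = _ := by rw [add_mul, one_mul, pow_add]; ring
  have hsum : ∀ k : ℕ, |avg f (ball y (2 ^ k * r)) - avg f (ball y r)| ≤
      k * (CA * 2 ^ n * K * wInt ω (ball y r) / (vB n * r ^ n)) := by
    intro k
    induction k with
    | zero => simp
    | succ k ih =>
      have := abs_sub_le (avg f (ball y (2 ^ (k + 1) * r))) (avg f (ball y (2 ^ k * r)))
        (avg f (ball y r))
      have h2 := hstep k
      rw [abs_sub_comm] at h2
      push_cast
      linarith
  refine (lint_abs_sub_le _ (avg f (ball y (2 ^ k * r)))).trans ?_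
  refine (add_le_add (hf.osc y _ (by positivity)) le_rfl).trans ?_
  have hwk := h.pos y (2 ^ k * r) (by positivity)
  rw [volume_ball_eq y (by positivity), ← ENNReal.ofReal_mul (abs_nonneg _),
    ← ENNReal.ofReal_add (by positivity) (by positivity)]
  apply ENNReal.ofReal_le_ofReal
  calc _ ≤ K * (CA * 2 ^ (k * n) * wInt ω (ball y r)) +
        k * (CA * 2 ^ n * K * wInt ω (ball y r) / (vB n * r ^ n)) * (vB n * (2 ^ k * r) ^ n) := by
        gcongr
        · exact hdbl k
        · exact hsum k
    _ = CA * K * wInt ω (ball y r) * 2 ^ (k * n) * (1 + k * 2 ^ n) := by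
        rw [mul_pow, ← pow_mul]; field_simp
    _ ≤ CA * K * wInt ω (ball y r) * 2 ^ (k * n) * (2 ^ n + k * 2 ^ n) := by
        gcongr
        exact one_le_pow₀ (by norm_num)
    _ = _ := by ring

/-- constant in the tail estimate -/
def tailC (n : ℕ) (CA δ : ℝ) : ℝ :=
  2 ^ ((n:ℝ) + δ) * (CA * 2 ^ n * ∑' k : ℕ, ((k:ℝ) + 1) * (2 ^ (-δ)) ^ k)

theorem summable_tail {δ : ℝ} (hδ : 0 < δ) :
    Summable (fun k : ℕ => ((k:ℝ) + 1) * ((2:ℝ) ^ (-δ)) ^ k) := by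
  have h1 : ‖(2:ℝ) ^ (-δ)‖ < 1 := by
    rw [Real.norm_of_nonneg (by positivity)]
    exact Real.rpow_lt_one_of_one_lt_of_neg (by norm_num) (by linarith)
  have a := summable_pow_mul_geometric_of_norm_lt_one 1 h1
  have b := summable_geometric_of_norm_lt_one h1
  refine (a.add b).congr fun k => ?_
  ring

theorem tailC_nonneg {CA δ : ℝ} (hC : 1 ≤ CA) : 0 ≤ tailC n CA δ := by
  unfold tailC
  have : 0 ≤ ∑' k : ℕ, ((k:ℝ) + 1) * ((2:ℝ) ^ (-δ)) ^ k := tsum_nonneg fun k => by positivity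
  positivity

theorem BM.tail {ω f : Rn n → ℝ} {CA K δ : ℝ} (h : A1P ω CA) (hf : BM ω f K) (hδ : 0 < δ)
    (y : Rn n) {r : ℝ} (hr : 0 < r) :
    ∫⁻ z, ENNReal.ofReal |f z - avg f (ball y r)| *
        ENNReal.ofReal ((1 + ‖z - y‖ / r) ^ (-((n:ℝ) + δ))) ≤
      ENNReal.ofReal (tailC n CA δ * K * wInt ω (ball y r)) := by
  have hC := h.one_le
  have hK := hf.pos
  have hw := h.pos y r hr
  set F := avg f (ball y r)
  have hnd : 0 < (n:ℝ) + δ := by positivity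
  have hker : ∀ z : Rn n, ENNReal.ofReal ((1 + ‖z - y‖ / r) ^ (-((n:ℝ) + δ))) ≤
      ∑' k : ℕ, (ball y (2 ^ k * r)).indicator
        (fun _ => ENNReal.ofReal (2 ^ ((n:ℝ) + δ) * (2 ^ (-((n:ℝ) + δ))) ^ k)) z := by
    intro z
    obtain ⟨N, hN⟩ := pow_unbounded_of_one_lt (‖z - y‖ / r) (by norm_num : (1:ℝ) < 2)
    have hex : ∃ k : ℕ, ‖z - y‖ / r < 2 ^ k := ⟨N, hN⟩
    classical
    set k := Nat.find hex with hk
    have hk1 : ‖z - y‖ / r < 2 ^ k := Nat.find_spec hex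
    have hk2 : 2 ^ k / 2 ≤ 1 + ‖z - y‖ / r := by
      rcases Nat.eq_zero_or_pos k with h0 | h0
      · rw [h0]
        have : 0 ≤ ‖z - y‖ / r := by positivity
        norm_num; linarith
      · have := Nat.find_min hex (m := k - 1) (by omega)
        rw [not_lt] at this
        have h2 : (2:ℝ) ^ k = 2 ^ (k - 1) * 2 := by rw [← pow_succ]; congr 1; omega
        rw [h2]; linarith
    refine le_trans ?_ (ENNReal.le_tsum k)
    rw [indicator_of_mem (by
      rw [mem_ball, dist_eq_norm]; rwa [div_lt_iff₀ hr] at hk1)]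
    apply ENNReal.ofReal_le_ofReal
    calc (1 + ‖z - y‖ / r) ^ (-((n:ℝ) + δ)) ≤ (2 ^ k / 2) ^ (-((n:ℝ) + δ)) :=
          Real.rpow_le_rpow_of_nonpos (by positivity) hk2 (by linarith)
      _ = _ := by
        rw [Real.div_rpow (by positivity) (by norm_num), Real.rpow_neg (by norm_num : (0:ℝ) ≤ 2),
          div_inv_eq_mul, mul_comm, ← Real.rpow_neg (by norm_num), ← Real.rpow_natCast,
          ← Real.rpow_natCast, ← Real.rpow_mul (by norm_num), ← Real.rpow_mul (by norm_num),
          mul_comm (k:ℝ)]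
  have hfm : AEMeasurable (fun z => ENNReal.ofReal |f z - F|) volume := by
    have := hf.loc.aestronglyMeasurable.aemeasurable
    exact ((this.sub_const F).abs).ennreal_ofReal
  calc _ ≤ ∫⁻ z, ∑' k : ℕ, ENNReal.ofReal |f z - F| * (ball y (2 ^ k * r)).indicator
        (fun _ => ENNReal.ofReal (2 ^ ((n:ℝ) + δ) * (2 ^ (-((n:ℝ) + δ))) ^ k)) z := by
        refine lintegral_mono fun z => ?_
        rw [ENNReal.tsum_mul_left]
        exact mul_le_mul_right (hker z) _
    _ = ∑' k : ℕ, ∫⁻ z, ENNReal.ofReal |f z - F| * (ball y (2 ^ k * r)).indicator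
        (fun _ => ENNReal.ofReal (2 ^ ((n:ℝ) + δ) * (2 ^ (-((n:ℝ) + δ))) ^ k)) z := by
        refine lintegral_tsum fun k => ?_
        exact hfm.mul ((measurable_const.indicator measurableSet_ball).aemeasurable)
    _ ≤ ∑' k : ℕ, ENNReal.ofReal (2 ^ ((n:ℝ) + δ) * (CA * 2 ^ n) * K * wInt ω (ball y r) *
          (((k:ℝ) + 1) * (2 ^ (-δ)) ^ k)) := by
        refine ENNReal.tsum_le_tsum fun k => ?_
        have e : ∀ z, ENNReal.ofReal |f z - F| * (ball y (2 ^ k * r)).indicator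
          (fun _ => ENNReal.ofReal (2 ^ ((n:ℝ) + δ) * (2 ^ (-((n:ℝ) + δ))) ^ k)) z =
          (ball y (2 ^ k * r)).indicator (fun z => ENNReal.ofReal |f z - F| *
            ENNReal.ofReal (2 ^ ((n:ℝ) + δ) * (2 ^ (-((n:ℝ) + δ))) ^ k)) z := by
          intro z
          by_cases hz : z ∈ ball y (2 ^ k * r)
          · simp only [indicator_of_mem hz]
          · simp only [indicator_of_notMem hz, mul_zero]
        simp_rw [e]
        rw [lintegral_indicator measurableSet_ball, lintegral_mul_const' _ _ ENNReal.ofReal_ne_top]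
        refine (mul_le_mul_left (hf.dyadic h y hr k) _).trans ?_
        rw [← ENNReal.ofReal_mul (by positivity)]
        apply ENNReal.ofReal_le_ofReal
        apply le_of_eq
        have e2 : ((2:ℝ) ^ (-((n:ℝ) + δ))) ^ k * 2 ^ (k * n) = (2 ^ (-δ)) ^ k := by
          rw [mul_comm k n, pow_mul (2:ℝ), ← mul_pow, ← Real.rpow_natCast 2 n,
            ← Real.rpow_add (by norm_num)]
          congr 2; ring
        rw [← e2]; ring
    _ = _ := by
        rw [← ENNReal.ofReal_tsum_of_nonneg]
        · rw [tsum_mul_left, tailC]; congr 1; ring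
        · intro k; positivity
        · exact (summable_tail hδ).mul_left _

theorem qmp_scale {t : ℝ} (ht : 0 < t) (y : Rn n) :
    Measure.QuasiMeasurePreserving (fun z : Rn n => t⁻¹ • (y - z)) volume volume := by
  refine ⟨by fun_prop, ?_⟩
  refine Measure.AbsolutelyContinuous.mk fun s hs h0 => ?_
  rw [Measure.map_apply (by fun_prop) hs]
  have h := lintegral_scale_sub' (s.indicator 1) ht y
  rw [lintegral_indicator_one hs, h0, mul_zero] at h
  have e : (fun z : Rn n => s.indicator (1 : Rn n → ℝ≥0∞) (t⁻¹ • (y - z))) =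
      ((fun z : Rn n => t⁻¹ • (y - z)) ⁻¹' s).indicator 1 := by
    ext z; rfl
  rw [e, lintegral_indicator_one] at h
  · exact h
  · exact (by fun_prop : Measurable fun z : Rn n => t⁻¹ • (y - z)) hs

theorem cvl_measurable {ψ f : Rn n → ℝ} (hψ : AEStronglyMeasurable ψ volume)
    (hf : AEStronglyMeasurable f volume) :
    ∃ G : ℝ × Rn n → ℝ, Measurable G ∧ ∀ t, 0 < t → ∀ y, cvl ψ t f y = G (t, y) := by
  have hψm := hψ.stronglyMeasurable_mk.measurable
  have hfm := hf.stronglyMeasurable_mk.measurable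
  refine ⟨fun p => ∫ z, (p.1 ^ n)⁻¹ * hψ.mk ψ (p.1⁻¹ • (p.2 - z)) * hf.mk f z, ?_, ?_⟩
  · have hm : Measurable (fun q : (ℝ × Rn n) × Rn n =>
        (q.1.1 ^ n)⁻¹ * hψ.mk ψ (q.1.1⁻¹ • (q.1.2 - q.2)) * hf.mk f q.2) := by
      refine Measurable.mul (Measurable.mul (by fun_prop) ?_) (hfm.comp measurable_snd)
      exact hψm.comp (by fun_prop)
    exact (hm.stronglyMeasurable.integral_prod_right).measurable
  · intro t ht y
    unfold cvl
    refine integral_congr_ae ?_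
    have h1 := (qmp_scale ht y).ae_eq hψ.ae_eq_mk
    filter_upwards [h1, hf.ae_eq_mk] with z h1 h2
    simp only [Function.comp] at h1
    simp only [h1, h2]

theorem psi_ker {C₁ C₂ δ γ : ℝ} {ψ : Rn n → ℝ} (hψ : PsiKernel n C₁ C₂ δ γ ψ) {t : ℝ}
    (ht : 0 < t) (y z : Rn n) :
    |ψ (t⁻¹ • (y - z))| ≤ C₁ * (1 + ‖z - y‖ / t) ^ (-((n:ℝ) + δ)) := by
  have := hψ.2.2.1 (t⁻¹ • (y - z))
  rw [norm_smul, Real.norm_of_nonneg (by positivity), norm_sub_rev, inv_mul_eq_div] at this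
  exact this

theorem cvl_le_lint (ψ g : Rn n → ℝ) {t : ℝ} (ht : 0 < t) (y : Rn n) :
    ENNReal.ofReal |cvl ψ t g y| ≤
      ENNReal.ofReal ((t ^ n)⁻¹) *
        ∫⁻ z, ENNReal.ofReal |g z| * ENNReal.ofReal |ψ (t⁻¹ • (y - z))| := by
  unfold cvl
  rw [← Real.norm_eq_abs, ofReal_norm]
  refine (enorm_integral_le_lintegral_enorm _).trans (le_of_eq ?_)
  rw [← lintegral_const_mul' _ _ ENNReal.ofReal_ne_top]
  congr 1; ext z
  rw [← ofReal_norm, ← ENNReal.ofReal_mul (abs_nonneg _), ← ENNReal.ofReal_mul (by positivity)]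
  congr 1
  rw [norm_mul, norm_mul, Real.norm_of_nonneg (by positivity), Real.norm_eq_abs, Real.norm_eq_abs]
  ring

theorem cvl_le_jap {C₁ C₂ δ γ : ℝ} (hC₁ : 0 < C₁) {ψ : Rn n → ℝ} (hψ : PsiKernel n C₁ C₂ δ γ ψ)
    (g : Rn n → ℝ) {t : ℝ} (ht : 0 < t) (y : Rn n) :
    ENNReal.ofReal |cvl ψ t g y| ≤
      ENNReal.ofReal (C₁ * (t ^ n)⁻¹) *
        ∫⁻ z, ENNReal.ofReal |g z| * ENNReal.ofReal ((1 + ‖z - y‖ / t) ^ (-((n:ℝ) + δ))) := by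
  refine (cvl_le_lint ψ g ht y).trans ?_
  rw [mul_comm C₁, ENNReal.ofReal_mul (by positivity), mul_assoc,
    ← lintegral_const_mul' (ENNReal.ofReal C₁) _ ENNReal.ofReal_ne_top]
  refine mul_le_mul_right (lintegral_mono fun z => ?_) _
  simp only
  rw [mul_left_comm, ← ENNReal.ofReal_mul hC₁.le]
  exact mul_le_mul_right (ENNReal.ofReal_le_ofReal (psi_ker hψ ht y z)) _

theorem BM.ae_meas {ω f : Rn n → ℝ} {K : ℝ} (hf : BM ω f K) : AEStronglyMeasurable f volume :=
  hf.loc.aestronglyMeasurable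

/-- the integrand defining `cvl ψ t (f - a)`. -/
theorem cvl_integrand {C₁ C₂ δ γ : ℝ} (hC₁ : 0 < C₁) (hδ : 0 < δ) {ψ : Rn n → ℝ}
    (hψ : PsiKernel n C₁ C₂ δ γ ψ) {ω f : Rn n → ℝ} {CA K : ℝ} (h : A1P ω CA) (hf : BM ω f K)
    {t : ℝ} (ht : 0 < t) (y : Rn n) (a : ℝ) :
    Integrable (fun z => (t ^ n)⁻¹ * ψ (t⁻¹ • (y - z)) * (f z - a)) := by
  have hk : Integrable (fun z => (t ^ n)⁻¹ * ψ (t⁻¹ • (y - z))) := by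
    have := (psit_integrable hψ.1 ht).comp_sub_left y
    exact this
  have h1 : Integrable (fun z => (t ^ n)⁻¹ * ψ (t⁻¹ • (y - z)) * (f z - avg f (ball y t))) := by
    refine ⟨hk.1.mul (hf.ae_meas.sub aestronglyMeasurable_const), ?_⟩
    rw [hasFiniteIntegral_iff_norm]
    have h2 := hf.tail h hδ y ht
    calc _ ≤ ∫⁻ z, ENNReal.ofReal ((t ^ n)⁻¹ * C₁) * (ENNReal.ofReal |f z - avg f (ball y t)| *
          ENNReal.ofReal ((1 + ‖z - y‖ / t) ^ (-((n:ℝ) + δ)))) := by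
          refine lintegral_mono fun z => ?_
          rw [← ENNReal.ofReal_mul (abs_nonneg _), ← ENNReal.ofReal_mul (by positivity)]
          apply ENNReal.ofReal_le_ofReal
          rw [norm_mul, norm_mul, Real.norm_of_nonneg (by positivity), Real.norm_eq_abs,
            Real.norm_eq_abs]
          have := psi_ker hψ ht y z
          calc _ ≤ (t ^ n)⁻¹ * (C₁ * (1 + ‖z - y‖ / t) ^ (-((n:ℝ) + δ))) *
              |f z - avg f (ball y t)| := by gcongr
            _ = _ := by ring
      _ = ENNReal.ofReal ((t ^ n)⁻¹ * C₁) * ∫⁻ z, (ENNReal.ofReal |f z - avg f (ball y t)| *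
          ENNReal.ofReal ((1 + ‖z - y‖ / t) ^ (-((n:ℝ) + δ)))) :=
          lintegral_const_mul' _ _ ENNReal.ofReal_ne_top
      _ < ∞ := ENNReal.mul_lt_top ENNReal.ofReal_lt_top (h2.trans_lt ENNReal.ofReal_lt_top)
  have h2 := h1.add (hk.mul_const (avg f (ball y t) - a))
  refine h2.congr (ae_of_all _ fun z => ?_)
  simp only [Pi.add_apply]; ring

theorem cvl_const {C₁ C₂ δ γ : ℝ} {ψ : Rn n → ℝ}
    (hψ : PsiKernel n C₁ C₂ δ γ ψ) {t : ℝ} (ht : 0 < t) (y : Rn n) :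
    ∫ z, (t ^ n)⁻¹ * ψ (t⁻¹ • (y - z)) = 0 := by
  rw [integral_const_mul]
  have e1 := integral_sub_left_eq_self (fun z => ψ (t⁻¹ • z)) (volume : Measure (Rn n)) y
  rw [e1, Measure.integral_comp_smul, hψ.2.1]
  simp

theorem cvl_sub_const {C₁ C₂ δ γ : ℝ} (hC₁ : 0 < C₁) (hδ : 0 < δ) {ψ : Rn n → ℝ}
    (hψ : PsiKernel n C₁ C₂ δ γ ψ) {ω f : Rn n → ℝ} {CA K : ℝ} (h : A1P ω CA) (hf : BM ω f K)
    {t : ℝ} (ht : 0 < t) (y : Rn n) (a : ℝ) :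
    cvl ψ t f y = cvl ψ t (fun z => f z - a) y := by
  have h0 := cvl_integrand hC₁ hδ hψ h hf ht y a
  have hk : Integrable (fun z => (t ^ n)⁻¹ * ψ (t⁻¹ • (y - z))) :=
    (psit_integrable hψ.1 ht).comp_sub_left y
  unfold cvl
  calc _ = ∫ z, ((t ^ n)⁻¹ * ψ (t⁻¹ • (y - z)) * (f z - a) + (t ^ n)⁻¹ * ψ (t⁻¹ • (y - z)) * a) := by
        congr 1; ext z; ring
    _ = _ := by
        rw [integral_add h0 (hk.mul_const a), integral_mul_const, cvl_const hψ ht y]; simp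

theorem cvl_bound {C₁ C₂ δ γ : ℝ} (hC₁ : 0 < C₁) (hδ : 0 < δ) {ψ : Rn n → ℝ}
    (hψ : PsiKernel n C₁ C₂ δ γ ψ) {ω f : Rn n → ℝ} {CA K : ℝ} (h : A1P ω CA) (hf : BM ω f K)
    {t : ℝ} (ht : 0 < t) (y : Rn n) :
    |cvl ψ t f y| ≤ C₁ * tailC n CA δ * K * (wInt ω (ball y t) / t ^ n) := by
  have hC := h.one_le
  have hK := hf.pos
  have hw := h.pos y t ht
  have hT := tailC_nonneg (n := n) (δ := δ) hC
  rw [cvl_sub_const hC₁ hδ hψ h hf ht y (avg f (ball y t))]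
  have h1 := cvl_le_jap hC₁ hψ (fun z => f z - avg f (ball y t)) ht y
  have h2 := h1.trans (mul_le_mul_right (hf.tail h hδ y ht) _)
  rw [← ENNReal.ofReal_mul (by positivity), ENNReal.ofReal_le_ofReal_iff (by positivity)] at h2
  refine h2.trans (le_of_eq ?_)
  field_simp

theorem jap_far {δ t ℓ : ℝ} (hδ : 0 < δ) (ht : 0 < t) (hℓ : 0 < ℓ) {u : ℝ} (hu : ℓ ≤ u) :
    (1 + u / t) ^ (-((n:ℝ) + δ)) ≤ (t / ℓ) ^ (δ / 2) * (1 + u / t) ^ (-((n:ℝ) + δ / 2)) := by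
  have hu0 : 0 < u := hℓ.trans_le hu
  have e : -((n:ℝ) + δ) = -(δ / 2) + -((n:ℝ) + δ / 2) := by ring
  rw [e, Real.rpow_add (by positivity)]
  gcongr
  rw [Real.rpow_neg (by positivity), ← Real.inv_rpow (by positivity)]
  apply Real.rpow_le_rpow (by positivity) _ (by linarith)
  rw [inv_le_comm₀ (by positivity) (by positivity), inv_div]
  have : ℓ / t ≤ u / t := by gcongr
  linarith

theorem atom_small {C₁ C₂ δ γ : ℝ} (hC₁ : 0 < C₁) (hδ : 0 < δ) {ψ : Rn n → ℝ}
    (hψ : PsiKernel n C₁ C₂ δ γ ψ) {b : Rn n → ℝ} (hb : AEStronglyMeasurable b volume)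
    {N E : Set (Rn n)} (hN : ∀ z, z ∉ N → b z = 0) {ℓ : ℝ} (hℓ : 0 < ℓ) (hEm : MeasurableSet E)
    (hE : ∀ y ∈ E, ∀ z ∈ N, ℓ ≤ ‖y - z‖) {t : ℝ} (ht : 0 < t) :
    ∫⁻ y in E, ENNReal.ofReal |cvl ψ t b y| ≤
      ENNReal.ofReal (C₁ * japC n (δ / 2) * (t / ℓ) ^ (δ / 2)) * ∫⁻ z, ENNReal.ofReal |b z| := by
  have hJ := japC_nonneg (n := n) (δ / 2)
  have hpt : ∀ y ∈ E, ENNReal.ofReal |cvl ψ t b y| ≤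
      ENNReal.ofReal (C₁ * (t ^ n)⁻¹ * (t / ℓ) ^ (δ / 2)) *
        ∫⁻ z, ENNReal.ofReal |b z| * ENNReal.ofReal ((1 + ‖t⁻¹ • (y - z)‖) ^ (-((n:ℝ) + δ / 2))) := by
    intro y hy
    refine (cvl_le_jap hC₁ hψ b ht y).trans ?_
    have hp : 0 ≤ C₁ * (t ^ n)⁻¹ := by positivity
    rw [ENNReal.ofReal_mul hp, mul_assoc,
      ← lintegral_const_mul' (ENNReal.ofReal ((t / ℓ) ^ (δ / 2))) _ ENNReal.ofReal_ne_top]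
    refine mul_le_mul_right (lintegral_mono fun z => ?_) _
    by_cases hz : z ∈ N
    · simp only
      rw [mul_left_comm, ← ENNReal.ofReal_mul (p := (t / ℓ) ^ (δ / 2)) (by positivity)]
      refine mul_le_mul_right (ENNReal.ofReal_le_ofReal ?_) _
      have h1 := hE y hy z hz
      have := jap_far (n := n) hδ ht hℓ h1
      rw [norm_smul, Real.norm_of_nonneg (by positivity), inv_mul_eq_div]
      rwa [norm_sub_rev z y]
    · simp [hN z hz]
  have hbm : AEMeasurable (fun z => ENNReal.ofReal |b z|) volume :=
    hb.aemeasurable.abs.ennreal_ofReal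
  have hm : AEMeasurable (Function.uncurry fun (y z : Rn n) => ENNReal.ofReal |b z| *
      ENNReal.ofReal ((1 + ‖t⁻¹ • (y - z)‖) ^ (-((n:ℝ) + δ / 2)))) (volume.prod volume) := by
    have h1 : AEMeasurable (fun p : Rn n × Rn n => ENNReal.ofReal |b p.2|) (volume.prod volume) :=
      hbm.comp_snd
    refine h1.mul (Measurable.aemeasurable ?_)
    fun_prop
  calc _ ≤ ∫⁻ y in E, ENNReal.ofReal (C₁ * (t ^ n)⁻¹ * (t / ℓ) ^ (δ / 2)) *
        ∫⁻ z, ENNReal.ofReal |b z| * ENNReal.ofReal ((1 + ‖t⁻¹ • (y - z)‖) ^ (-((n:ℝ) + δ / 2))) :=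
        setLIntegral_mono' hEm hpt
    _ ≤ ∫⁻ y, ENNReal.ofReal (C₁ * (t ^ n)⁻¹ * (t / ℓ) ^ (δ / 2)) *
        ∫⁻ z, ENNReal.ofReal |b z| * ENNReal.ofReal ((1 + ‖t⁻¹ • (y - z)‖) ^ (-((n:ℝ) + δ / 2))) :=
        setLIntegral_le_lintegral _ _
    _ = ENNReal.ofReal (C₁ * (t ^ n)⁻¹ * (t / ℓ) ^ (δ / 2)) * ∫⁻ z, ENNReal.ofReal |b z| *
        (ENNReal.ofReal (t ^ n) * ENNReal.ofReal (japC n (δ / 2))) := by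
        rw [lintegral_const_mul' _ _ ENNReal.ofReal_ne_top, lintegral_lintegral_swap hm]
        congr 2; ext z
        rw [lintegral_const_mul' _ _ ENNReal.ofReal_ne_top]
        have := lintegral_scale_sub (n := n)
          (fun x => ENNReal.ofReal ((1 + ‖x‖) ^ (-((n:ℝ) + δ / 2)))) ht z
        rw [this, lintegral_jap (by linarith)]
    _ = _ := by
        rw [← ENNReal.ofReal_mul (by positivity), lintegral_mul_const' _ _ ENNReal.ofReal_ne_top,
          mul_comm (∫⁻ z, ENNReal.ofReal |b z|), ← mul_assoc, ← ENNReal.ofReal_mul (by positivity)]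
        congr 2
        field_simp

theorem atom_large_aux {ε B : ℝ} {ψ : Rn n → ℝ} (hψ : Measurable ψ) (hε : 0 < ε) (hB : 0 ≤ B)
    (hmod : ∀ h : Rn n, ∫⁻ x, ENNReal.ofReal |ψ (x + h) - ψ x| ≤ ENNReal.ofReal (B * ‖h‖ ^ ε))
    {b : Rn n → ℝ} (hb : Integrable b) (hb0 : ∫ z, b z = 0)
    {c : Rn n} {ρ : ℝ} (hN : ∀ z, ρ < ‖z - c‖ → b z = 0) {t : ℝ} (ht : 0 < t) :
    ∫⁻ y, ENNReal.ofReal |cvl ψ t b y| ≤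
      ENNReal.ofReal (B * (ρ / t) ^ ε) * ∫⁻ z, ENNReal.ofReal |b z| := by
  have hpt : ∀ y, ENNReal.ofReal |cvl ψ t b y| ≤ ENNReal.ofReal ((t ^ n)⁻¹) *
      ∫⁻ z, ENNReal.ofReal |b z| * ENNReal.ofReal |ψ (t⁻¹ • (y - z)) - ψ (t⁻¹ • (y - c))| := by
    intro y
    by_cases hi : Integrable (fun z => (t ^ n)⁻¹ * ψ (t⁻¹ • (y - z)) * b z)
    · have e : cvl ψ t b y =
          ∫ z, (t ^ n)⁻¹ * (ψ (t⁻¹ • (y - z)) - ψ (t⁻¹ • (y - c))) * b z := by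
        have : ∀ z, (t ^ n)⁻¹ * (ψ (t⁻¹ • (y - z)) - ψ (t⁻¹ • (y - c))) * b z =
            (t ^ n)⁻¹ * ψ (t⁻¹ • (y - z)) * b z - ((t ^ n)⁻¹ * ψ (t⁻¹ • (y - c))) * b z := by
          intro z; ring
        simp_rw [this]
        rw [integral_sub hi (hb.const_mul _), integral_const_mul, hb0, mul_zero, sub_zero]; rfl
      rw [e, ← Real.norm_eq_abs, ofReal_norm]
      refine (enorm_integral_le_lintegral_enorm _).trans (le_of_eq ?_)
      rw [← lintegral_const_mul' _ _ ENNReal.ofReal_ne_top]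
      congr 1; ext z
      rw [← ofReal_norm, ← ENNReal.ofReal_mul (abs_nonneg _), ← ENNReal.ofReal_mul (by positivity)]
      congr 1
      rw [norm_mul, norm_mul, Real.norm_of_nonneg (by positivity), Real.norm_eq_abs,
        Real.norm_eq_abs]
      ring
    · have : cvl ψ t b y = 0 := integral_undef hi
      simp [this]
  have hbm : AEMeasurable (fun z => ENNReal.ofReal |b z|) volume :=
    hb.1.aemeasurable.abs.ennreal_ofReal
  have hm : AEMeasurable (Function.uncurry fun (y z : Rn n) => ENNReal.ofReal |b z| *
      ENNReal.ofReal |ψ (t⁻¹ • (y - z)) - ψ (t⁻¹ • (y - c))|) (volume.prod volume) := by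
    have h1 : AEMeasurable (fun p : Rn n × Rn n => ENNReal.ofReal |b p.2|) (volume.prod volume) :=
      hbm.comp_snd
    refine h1.mul (Measurable.aemeasurable ?_)
    have a1 : Measurable (fun p : Rn n × Rn n => ψ (t⁻¹ • (p.1 - p.2))) := hψ.comp (by fun_prop)
    have a2 : Measurable (fun p : Rn n × Rn n => ψ (t⁻¹ • (p.1 - c))) := hψ.comp (by fun_prop)
    exact ((a1.sub a2).abs).ennreal_ofReal
  calc _ ≤ ∫⁻ y, ENNReal.ofReal ((t ^ n)⁻¹) *
      ∫⁻ z, ENNReal.ofReal |b z| * ENNReal.ofReal |ψ (t⁻¹ • (y - z)) - ψ (t⁻¹ • (y - c))| :=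
        lintegral_mono hpt
    _ = ENNReal.ofReal ((t ^ n)⁻¹) * ∫⁻ z, ENNReal.ofReal |b z| *
        ∫⁻ y, ENNReal.ofReal |ψ (t⁻¹ • (y - z)) - ψ (t⁻¹ • (y - c))| := by
        rw [lintegral_const_mul' _ _ ENNReal.ofReal_ne_top, lintegral_lintegral_swap hm]
        congr 2; ext z
        rw [lintegral_const_mul' _ _ ENNReal.ofReal_ne_top]
    _ ≤ ENNReal.ofReal ((t ^ n)⁻¹) * ∫⁻ z, ENNReal.ofReal |b z| *
        (ENNReal.ofReal (t ^ n) * ENNReal.ofReal (B * (ρ / t) ^ ε)) := by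
        refine mul_le_mul_right (lintegral_mono fun z => ?_) _
        by_cases hz : ρ < ‖z - c‖
        · simp [hN z hz]
        · refine mul_le_mul_right ?_ _
          rw [not_lt] at hz
          have h1 := lintegral_scale_sub (n := n)
            (fun x => ENNReal.ofReal |ψ (x + t⁻¹ • (c - z)) - ψ x|) ht c
          have e : ∀ y, t⁻¹ • (y - c) + t⁻¹ • (c - z) = t⁻¹ • (y - z) := by
            intro y; rw [← smul_add]; congr 1; abel
          simp_rw [e] at h1
          rw [h1]
          refine mul_le_mul_right ((hmod _).trans (ENNReal.ofReal_le_ofReal ?_)) _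
          rw [norm_smul, Real.norm_of_nonneg (by positivity), inv_mul_eq_div, norm_sub_rev]
          gcongr
    _ = _ := by
        rw [lintegral_mul_const' _ _ (ENNReal.mul_ne_top ENNReal.ofReal_ne_top ENNReal.ofReal_ne_top),
          mul_comm (∫⁻ z, ENNReal.ofReal |b z|), ← mul_assoc, ← mul_assoc,
          ← ENNReal.ofReal_mul (by positivity), inv_mul_cancel₀ (by positivity)]
        simp

theorem cvl_congr_psi {ψ ψ' b : Rn n → ℝ} (h : ψ =ᵐ[volume] ψ') {t : ℝ} (ht : 0 < t) (y : Rn n) :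
    cvl ψ t b y = cvl ψ' t b y := by
  unfold cvl
  refine integral_congr_ae ?_
  have h1 := (qmp_scale ht y).ae_eq h
  filter_upwards [h1] with z h1
  simp only [Function.comp] at h1
  simp only [h1]

theorem atom_large {ε B : ℝ} {ψ : Rn n → ℝ} (hψ : AEStronglyMeasurable ψ volume)
    (hε : 0 < ε) (hB : 0 ≤ B)
    (hmod : ∀ h : Rn n, ∫⁻ x, ENNReal.ofReal |ψ (x + h) - ψ x| ≤ ENNReal.ofReal (B * ‖h‖ ^ ε))
    {b : Rn n → ℝ} (hb : Integrable b) (hb0 : ∫ z, b z = 0)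
    {c : Rn n} {ρ : ℝ} (hN : ∀ z, ρ < ‖z - c‖ → b z = 0) {t : ℝ} (ht : 0 < t) :
    ∫⁻ y, ENNReal.ofReal |cvl ψ t b y| ≤
      ENNReal.ofReal (B * (ρ / t) ^ ε) * ∫⁻ z, ENNReal.ofReal |b z| := by
  have hae := hψ.ae_eq_mk
  simp_rw [cvl_congr_psi (b := b) hae ht]
  refine atom_large_aux hψ.stronglyMeasurable_mk.measurable hε hB ?_ hb hb0 hN ht
  intro h
  refine le_trans (le_of_eq ?_) (hmod h)
  refine lintegral_congr_ae ?_
  have h2 := (measurePreserving_add_right volume h).quasiMeasurePreserving.ae_eq hae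
  filter_upwards [hae, h2] with x h1 h2
  simp only [Function.comp] at h2
  rw [h1, h2]

/-- The atomic estimate (Lemma 4). -/
theorem atom_est (hn : 1 ≤ n) {C₁ C₂ δ γ : ℝ} (hC₁ : 0 < C₁) (hC₂ : 0 < C₂) (hδ : 0 < δ)
    (hγ : 0 < γ) {ψ : Rn n → ℝ} (hψ : PsiKernel n C₁ C₂ δ γ ψ) {κ : ℝ} (hκ : 0 < κ) :
    ∃ C : ℝ, 0 ≤ C ∧ ∀ (b : Rn n → ℝ) (N E : Set (Rn n)) (c : Rn n) (ℓ : ℝ),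
      Integrable b → ∫ z, b z = 0 → 0 < ℓ → (∀ z, z ∉ N → b z = 0) →
      N ⊆ closedBall c (κ * ℓ) → MeasurableSet E → (∀ y ∈ E, ∀ z ∈ N, ℓ ≤ ‖y - z‖) →
      ∫⁻ t in Ioi (0:ℝ), ∫⁻ y in {y | ℓ < t ∨ y ∈ E}, ENNReal.ofReal (|cvl ψ t b y| / t) ≤
        ENNReal.ofReal C * ∫⁻ z, ENNReal.ofReal |b z| := by
  set ε := min 1 γ with hε
  have hε0 : 0 < ε := by simp only [hε, lt_min_iff]; exact ⟨one_pos, hγ⟩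
  obtain ⟨B, hB, hmod⟩ := psi_modulus hn hC₁ hC₂ hδ hγ hψ hε0 (min_le_left _ _) (min_le_right _ _)
  have hJ := japC_nonneg (n := n) (δ / 2)
  refine ⟨C₁ * japC n (δ / 2) * (1 / (δ / 2)) + B * κ ^ ε * (1 / ε), by positivity, ?_⟩
  intro b N E c ℓ hb hb0 hℓ hN hNc hEm hE
  set nb := ∫⁻ z, ENNReal.ofReal |b z|
  have hdiv : ∀ {t : ℝ}, 0 < t → ∀ (s : Set (Rn n)), ∫⁻ y in s, ENNReal.ofReal (|cvl ψ t b y| / t) =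
      ENNReal.ofReal t⁻¹ * ∫⁻ y in s, ENNReal.ofReal |cvl ψ t b y| := by
    intro t ht s
    rw [← lintegral_const_mul' _ _ ENNReal.ofReal_ne_top]
    congr 1; ext y
    rw [← ENNReal.ofReal_mul (by positivity)]; congr 1; field_simp
  rw [← Ioc_union_Ioi_eq_Ioi hℓ.le, lintegral_union measurableSet_Ioi
    (by rw [Set.disjoint_left]; intro x hx hx'; exact absurd hx.2 (not_le.2 hx')),
    ENNReal.ofReal_add (by positivity) (by positivity), add_mul]
  gcongr ?_ + ?_
  · calc _ ≤ ∫⁻ t in Ioc 0 ℓ, ENNReal.ofReal (C₁ * japC n (δ / 2)) *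
          ENNReal.ofReal ((t / ℓ) ^ (δ / 2) / t) * nb := by
          refine setLIntegral_mono' measurableSet_Ioc fun t ht => ?_
          have e : {y | ℓ < t ∨ y ∈ E} = E := by
            ext y; simp [not_lt.2 ht.2]
          have ht0 : 0 < t := ht.1
          rw [e, hdiv ht.1]
          refine (mul_le_mul_right (atom_small hC₁ hδ hψ hb.1 hN hℓ hEm hE ht.1) _).trans
            (le_of_eq ?_)
          rw [← mul_assoc, ← ENNReal.ofReal_mul (by positivity), ← ENNReal.ofReal_mul (by positivity)]
          congr 2
          field_simp
      _ = _ := by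
          rw [lintegral_mul_const, lintegral_const_mul' _ _ ENNReal.ofReal_ne_top,
            lint_pow_small (by linarith) hℓ, ← ENNReal.ofReal_mul (by positivity)]
          fun_prop
  · have hN' : ∀ z, κ * ℓ < ‖z - c‖ → b z = 0 := by
      intro z hz
      apply hN
      intro hz2
      have := hNc hz2
      rw [mem_closedBall, dist_eq_norm] at this
      linarith
    calc _ ≤ ∫⁻ t in Ioi ℓ, ENNReal.ofReal (B * κ ^ ε) *
          ENNReal.ofReal ((ℓ / t) ^ ε / t) * nb := by
          refine setLIntegral_mono' measurableSet_Ioi fun t ht => ?_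
          have ht0 : 0 < t := hℓ.trans ht
          rw [hdiv ht0]
          refine (mul_le_mul_right ((setLIntegral_le_lintegral _ _).trans
            (atom_large hψ.1.1 hε0 hB hmod hb hb0 hN' ht0)) _).trans (le_of_eq ?_)
          rw [← mul_assoc, ← ENNReal.ofReal_mul (by positivity), ← ENNReal.ofReal_mul (by positivity)]
          congr 2
          rw [mul_div_assoc, Real.mul_rpow hκ.le (by positivity)]
          field_simp
      _ = _ := by
          rw [lintegral_mul_const, lintegral_const_mul' _ _ ENNReal.ofReal_ne_top,
            lint_pow_large hε0 hℓ, ← ENNReal.ofReal_mul (by positivity)]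
          fun_prop

/-- Half-open cube with lower corner `a` and side `L`. -/
def Qc (a : Rn n) (L : ℝ) : Set (Rn n) := {y | ∀ i, a i ≤ y i ∧ y i < a i + L}

theorem Qc_eq_preimage (a : Rn n) (L : ℝ) :
    Qc a L = (MeasurableEquiv.toLp 2 (Fin n → ℝ)).symm ⁻¹' (Set.pi univ fun i => Ico (a i) (a i + L)) := by
  ext y
  simp [Qc]

theorem Qc_meas (a : Rn n) (L : ℝ) : MeasurableSet (Qc a L) := by
  rw [Qc_eq_preimage]
  exact (MeasurableEquiv.measurable _) (MeasurableSet.univ_pi fun i => measurableSet_Ico)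

theorem volume_Qc (a : Rn n) {L : ℝ} (hL : 0 ≤ L) : volume (Qc a L) = ENNReal.ofReal (L ^ n) := by
  rw [Qc_eq_preimage, (EuclideanSpace.volume_preserving_symm_measurableEquiv_toLp (Fin n)).measure_preimage
    (MeasurableSet.univ_pi fun i => measurableSet_Ico).nullMeasurableSet, Real.volume_pi_Ico]
  simp [ENNReal.ofReal_pow hL]

theorem norm_le_of_coord {x : Rn n} {M : ℝ} (hM : 0 ≤ M) (h : ∀ i, |x i| ≤ M) :
    ‖x‖ ≤ n * M := by
  rw [EuclideanSpace.norm_eq]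
  apply Real.sqrt_le_iff.2
  refine ⟨by positivity, ?_⟩
  calc ∑ i, ‖x i‖ ^ 2 ≤ ∑ i : Fin n, M ^ 2 := by
        refine Finset.sum_le_sum fun i _ => ?_
        rw [Real.norm_eq_abs]
        have := h i
        gcongr
    _ = n * M ^ 2 := by simp
    _ ≤ (n * M) ^ 2 := by
        rcases Nat.eq_zero_or_pos n with h0 | h0
        · subst h0; simp
        · have : (1:ℝ) ≤ n := by exact_mod_cast h0
          rw [mul_pow]; gcongr; nlinarith

theorem coord_le_norm (x : Rn n) (i : Fin n) : |x i| ≤ ‖x‖ := by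
  have := PiLp.norm_apply_le x i
  rwa [Real.norm_eq_abs] at this

/-- Dyadic index of a point at relative level `d`. -/
def ix (a : Rn n) (L : ℝ) (d : ℕ) (y : Rn n) : Fin n → ℤ := fun i => ⌊(y i - a i) / (L / 2 ^ d)⌋

/-- Dyadic cube. -/
def cb (a : Rn n) (L : ℝ) (d : ℕ) (z : Fin n → ℤ) : Set (Rn n) := {y | ix a L d y = z}

/-- Lower corner of a dyadic cube. -/
def crn (a : Rn n) (L : ℝ) (d : ℕ) (z : Fin n → ℤ) : Rn n :=
  WithLp.toLp 2 (fun i => a i + (L / 2 ^ d) * z i)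

theorem crn_apply (a : Rn n) (L : ℝ) (d : ℕ) (z : Fin n → ℤ) (i : Fin n) :
    crn a L d z i = a i + (L / 2 ^ d) * z i := rfl

theorem cb_eq (a : Rn n) {L : ℝ} (hL : 0 < L) (d : ℕ) (z : Fin n → ℤ) :
    cb a L d z = Qc (crn a L d z) (L / 2 ^ d) := by
  have hl : 0 < L / 2 ^ d := by positivity
  ext y
  simp only [cb, Qc, ix, mem_setOf_eq, funext_iff, Int.floor_eq_iff, crn_apply]
  refine forall_congr' fun i => ?_
  rw [le_div_iff₀ hl, div_lt_iff₀ hl]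
  constructor
  · rintro ⟨h1, h2⟩; constructor <;> nlinarith
  · rintro ⟨h1, h2⟩; constructor <;> nlinarith

theorem cb_meas (a : Rn n) {L : ℝ} (hL : 0 < L) (d : ℕ) (z : Fin n → ℤ) :
    MeasurableSet (cb a L d z) := by rw [cb_eq a hL]; exact Qc_meas _ _

theorem volume_cb (a : Rn n) {L : ℝ} (hL : 0 < L) (d : ℕ) (z : Fin n → ℤ) :
    volume (cb a L d z) = ENNReal.ofReal ((L / 2 ^ d) ^ n) := by
  rw [cb_eq a hL]; exact volume_Qc _ (by positivity)

theorem crn_mem (a : Rn n) {L : ℝ} (hL : 0 < L) (d : ℕ) (z : Fin n → ℤ) :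
    crn a L d z ∈ cb a L d z := by
  rw [cb_eq a hL]
  intro i
  have : 0 < L / 2 ^ d := by positivity
  exact ⟨le_rfl, by linarith⟩

theorem ix_parent (a : Rn n) {L : ℝ} (hL : 0 < L) (d k : ℕ) (y : Rn n) (i : Fin n) :
    ix a L d y i = ix a L (d + k) y i / 2 ^ k := by
  unfold ix
  have := Int.floor_div_natCast ((y i - a i) / (L / 2 ^ (d + k))) (2 ^ k)
  push_cast at this
  rw [← this]
  congr 1
  rw [pow_add]
  field_simp

theorem ix_nested (a : Rn n) {L : ℝ} (hL : 0 < L) {d d' : ℕ} (hd : d ≤ d') {y y' : Rn n}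
    (h : ix a L d' y = ix a L d' y') : ix a L d y = ix a L d y' := by
  obtain ⟨k, rfl⟩ := Nat.exists_eq_add_of_le hd
  ext i
  rw [ix_parent a hL d k, ix_parent a hL d k y', h]

theorem cb_zero (a : Rn n) {L : ℝ} (hL : 0 < L) : cb a L 0 0 = Qc a L := by
  rw [cb_eq a hL]
  simp [Qc, crn_apply]

/-- Closed neighbourhood relation of indices. -/
def near (z z' : Fin n → ℤ) : Prop := ∀ i, |z i - z' i| ≤ 1

theorem near_refl (z : Fin n → ℤ) : near z z := fun i => by simp

theorem far_dist (a : Rn n) {L : ℝ} (hL : 0 < L) {d : ℕ} {y y' : Rn n}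
    (h : ¬ near (ix a L d y) (ix a L d y')) : L / 2 ^ d ≤ ‖y - y'‖ := by
  have hl : 0 < L / 2 ^ d := by positivity
  unfold near at h
  push Not at h
  obtain ⟨i, hi⟩ := h
  refine le_trans ?_ (coord_le_norm (y - y') i)
  have e : (y - y') i = ((y i - a i) / (L / 2 ^ d) - (y' i - a i) / (L / 2 ^ d)) * (L / 2 ^ d) := by
    rw [PiLp.sub_apply]; field_simp; ring
  rw [e, abs_mul, abs_of_pos hl]
  refine le_mul_of_one_le_left hl.le ?_
  unfold ix at hi
  set u := (y i - a i) / (L / 2 ^ d)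
  set v := (y' i - a i) / (L / 2 ^ d)
  have a1 := Int.floor_le u
  have a2 := Int.lt_floor_add_one u
  have a3 := Int.floor_le v
  have a4 := Int.lt_floor_add_one v
  rcases le_total 0 (⌊u⌋ - ⌊v⌋) with h0 | h0
  · rw [abs_of_nonneg h0] at hi
    have : (2:ℤ) ≤ ⌊u⌋ - ⌊v⌋ := by omega
    have : (2:ℝ) ≤ (⌊u⌋:ℝ) - ⌊v⌋ := by exact_mod_cast this
    exact le_trans (by linarith) (le_abs_self _)
  · rw [abs_of_nonpos h0] at hi
    have : (2:ℤ) ≤ ⌊v⌋ - ⌊u⌋ := by omega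
    have : (2:ℝ) ≤ (⌊v⌋:ℝ) - ⌊u⌋ := by exact_mod_cast this
    exact le_trans (by linarith) (neg_le_abs _)

/-- The tripled cube. -/
def N3 (a : Rn n) (L : ℝ) (d : ℕ) (z : Fin n → ℤ) : Set (Rn n) := {y | near (ix a L d y) z}

theorem N3_eq (a : Rn n) {L : ℝ} (hL : 0 < L) (d : ℕ) (z : Fin n → ℤ) :
    N3 a L d z = Qc (crn a L d (fun i => z i - 1)) (3 * (L / 2 ^ d)) := by
  have hl : 0 < L / 2 ^ d := by positivity
  ext y
  simp only [N3, near, Qc, ix, mem_setOf_eq, crn_apply, abs_le]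
  refine forall_congr' fun i => ?_
  have e1 : -1 ≤ ⌊(y i - a i) / (L / 2 ^ d)⌋ - z i ↔ z i - 1 ≤ ⌊(y i - a i) / (L / 2 ^ d)⌋ := by
    constructor <;> intro h <;> linarith
  have e2 : ⌊(y i - a i) / (L / 2 ^ d)⌋ - z i ≤ 1 ↔ ⌊(y i - a i) / (L / 2 ^ d)⌋ < z i + 2 := by
    omega
  rw [e1, e2, Int.le_floor, Int.floor_lt, le_div_iff₀ hl, div_lt_iff₀ hl]
  push_cast
  constructor
  · rintro ⟨h1, h2⟩; constructor <;> nlinarith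
  · rintro ⟨h1, h2⟩; constructor <;> nlinarith

theorem N3_meas (a : Rn n) {L : ℝ} (hL : 0 < L) (d : ℕ) (z : Fin n → ℤ) :
    MeasurableSet (N3 a L d z) := by rw [N3_eq a hL]; exact Qc_meas _ _

theorem volume_N3 (a : Rn n) {L : ℝ} (hL : 0 < L) (d : ℕ) (z : Fin n → ℤ) :
    volume (N3 a L d z) = ENNReal.ofReal (3 ^ n) * volume (cb a L d z) := by
  rw [N3_eq a hL, volume_cb a hL, volume_Qc _ (by positivity), ← ENNReal.ofReal_mul (by positivity),
    mul_pow]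

theorem cb_subset_closedBall (a : Rn n) {L : ℝ} (hL : 0 < L) (d : ℕ) (z : Fin n → ℤ) :
    cb a L d z ⊆ closedBall (crn a L d z) (n * (L / 2 ^ d)) := by
  have hl : 0 < L / 2 ^ d := by positivity
  rw [cb_eq a hL]
  intro y hy
  rw [mem_closedBall, dist_eq_norm]
  refine norm_le_of_coord hl.le fun i => ?_
  have := hy i
  rw [PiLp.sub_apply, abs_le]; constructor <;> linarith

theorem N3_subset_ball (hn : 1 ≤ n) (a : Rn n) {L : ℝ} (hL : 0 < L) :
    N3 a L 0 0 ⊆ ball a (4 * n * L) := by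
  have hn' : (1:ℝ) ≤ n := by exact_mod_cast hn
  rw [N3_eq a hL]
  intro y hy
  rw [mem_ball, dist_eq_norm]
  have : ‖y - a‖ ≤ n * (2 * L) := by
    refine norm_le_of_coord (by positivity) fun i => ?_
    have := hy i
    simp only [crn_apply] at this
    norm_num at this
    rw [PiLp.sub_apply, abs_le]; constructor <;> linarith
  nlinarith

/-- First (coarsest) cubes for a predicate. -/
def First (a : Rn n) (L : ℝ) (R : ℕ → (Fin n → ℤ) → Prop) (d : ℕ) (z : Fin n → ℤ) : Prop :=
  R d z ∧ ∀ x ∈ cb a L d z, ∀ d' < d, ¬ R d' (ix a L d' x)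

theorem First.disj {a : Rn n} {L : ℝ} {R : ℕ → (Fin n → ℤ) → Prop} {d d' : ℕ} {z z' : Fin n → ℤ}
    (h : First a L R d z) (h' : First a L R d' z') {x : Rn n} (hx : x ∈ cb a L d z)
    (hx' : x ∈ cb a L d' z') : (d, z) = (d', z') := by
  have e : d = d' := by
    by_contra hne
    rcases lt_or_gt_of_ne hne with hlt | hlt
    · apply h'.2 x hx' d hlt
      have : ix a L d x = z := hx
      rw [this]; exact h.1
    · apply h.2 x hx d' hlt
      have : ix a L d' x = z' := hx'
      rw [this]; exact h'.1
  subst e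
  have h1 : ix a L d x = z := hx
  have h2 : ix a L d x = z' := hx'
  rw [← h1, ← h2]

theorem First.exists {a : Rn n} {L : ℝ} (hL : 0 < L) {R : ℕ → (Fin n → ℤ) → Prop} {d : ℕ}
    {x : Rn n} (h : R d (ix a L d x)) :
    ∃ d' ≤ d, First a L R d' (ix a L d' x) := by
  classical
  have hex : ∃ d, R d (ix a L d x) := ⟨d, h⟩
  refine ⟨Nat.find hex, Nat.find_min' hex h, Nat.find_spec hex, ?_⟩
  intro x' hx' d'' hd''
  have : ix a L d'' x' = ix a L d'' x := ix_nested a hL hd''.le hx'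
  rw [this]
  exact Nat.find_min hex hd''

theorem wball_measurable {ω : Rn n → ℝ} (hω : AEStronglyMeasurable ω volume) :
    ∃ G : ℝ × Rn n → ℝ, Measurable G ∧ ∀ t y, wInt ω (ball y t) = G (t, y) := by
  have hm := hω.stronglyMeasurable_mk.measurable
  refine ⟨fun p => ∫ z, {q : (ℝ × Rn n) × Rn n | dist q.2 q.1.2 < q.1.1}.indicator
    (fun q => hω.mk ω q.2) (p, z), ?_, ?_⟩
  · have : Measurable ({q : (ℝ × Rn n) × Rn n | dist q.2 q.1.2 < q.1.1}.indicator
        (fun q => hω.mk ω q.2)) := by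
      refine (hm.comp measurable_snd).indicator ?_
      exact measurableSet_lt (by fun_prop) (by fun_prop)
    exact (this.stronglyMeasurable.integral_prod_right').measurable
  · intro t y
    unfold wInt
    rw [← integral_indicator measurableSet_ball]
    refine integral_congr_ae ?_
    filter_upwards [hω.ae_eq_mk] with z hz
    by_cases h : z ∈ ball y t
    · rw [indicator_of_mem h, indicator_of_mem (by exact h), hz]
    · rw [indicator_of_notMem h, indicator_of_notMem (by exact h)]

/-- The Carleson density. -/
def Dd (ψ ω f : Rn n → ℝ) (t : ℝ) (y : Rn n) : ℝ≥0∞ :=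
  ENNReal.ofReal ((cvl ψ t f y) ^ 2 / (wInt ω (ball y t) / t ^ n * t))

theorem Dd_measurable {ψ ω f : Rn n → ℝ} (hψ : AEStronglyMeasurable ψ volume)
    (hω : AEStronglyMeasurable ω volume) (hf : AEStronglyMeasurable f volume) :
    ∃ G : ℝ × Rn n → ℝ≥0∞, Measurable G ∧ ∀ t, 0 < t → ∀ y, Dd ψ ω f t y = G (t, y) := by
  obtain ⟨G1, h1, e1⟩ := cvl_measurable hψ hf
  obtain ⟨G2, h2, e2⟩ := wball_measurable hω
  refine ⟨fun p => ENNReal.ofReal ((G1 p) ^ 2 / (G2 p / p.1 ^ n * p.1)), ?_, ?_⟩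
  · exact ((h1.pow_const 2).div ((h2.div (measurable_fst.pow_const n)).mul
      measurable_fst)).ennreal_ofReal
  · intro t ht y
    rw [Dd, e1 t ht y, e2 t y]

theorem in3_finite (hn : 1 ≤ n) (a : Rn n) {L : ℝ} (hL : 0 < L) (d : ℕ) :
    {z : Fin n → ℤ | cb a L d z ⊆ N3 a L 0 0}.Finite := by
  refine Set.Finite.subset (Set.Finite.pi' (fun _ : Fin n => Set.finite_Icc (-(4 * n * 2 ^ d : ℤ)) (4 * n * 2 ^ d))) ?_
  intro z hz i
  have h1 := N3_subset_ball hn a hL (hz (crn_mem a hL d z))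
  rw [mem_ball, dist_eq_norm] at h1
  have h2 := (coord_le_norm (crn a L d z - a) i).trans h1.le
  rw [PiLp.sub_apply, crn_apply, add_sub_cancel_left, abs_mul, abs_of_pos (by positivity)] at h2
  have h3 : |(z i : ℝ)| ≤ 4 * n * 2 ^ d := by
    have hl : 0 < L / 2 ^ d := by positivity
    refine le_of_mul_le_mul_left ?_ hl
    calc _ ≤ _ := h2
      _ = _ := by field_simp
  rw [abs_le] at h3
  constructor
  · have : (-(4 * n * 2 ^ d : ℤ) : ℝ) ≤ z i := by push_cast; exact h3.1
    exact_mod_cast this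
  · have : (z i : ℝ) ≤ ((4 * n * 2 ^ d : ℤ) : ℝ) := by push_cast; exact h3.2
    exact_mod_cast this

theorem cb_in3 (a : Rn n) {L : ℝ} (hL : 0 < L) (d : ℕ) {x : Rn n} (hx : x ∈ N3 a L 0 0) :
    cb a L d (ix a L d x) ⊆ N3 a L 0 0 := by
  intro y hy
  have : ix a L 0 y = ix a L 0 x := ix_nested a hL (Nat.zero_le d) hy
  show near (ix a L 0 y) 0
  rw [this]; exact hx

/-- Calderon–Zygmund stopping cubes. -/
theorem cz (hn : 1 ≤ n) (a : Rn n) {L : ℝ} (hL : 0 < L) (m : ℕ) (φ : Rn n → ℝ≥0∞) (s : ℝ≥0∞)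
    (h0 : ∀ z, cb a L 0 z ⊆ N3 a L 0 0 → ∫⁻ x in cb a L 0 z, φ x ≤ s * volume (cb a L 0 z)) :
    ∃ J : Finset (ℕ × (Fin n → ℤ)),
      (∀ p ∈ J, p.1 ≤ m ∧ cb a L p.1 p.2 ⊆ N3 a L 0 0) ∧
      (∀ p ∈ J, ∀ q ∈ J, ∀ x, x ∈ cb a L p.1 p.2 → x ∈ cb a L q.1 q.2 → p = q) ∧
      (∀ x ∈ N3 a L 0 0, ∃ p ∈ J, x ∈ cb a L p.1 p.2) ∧
      (∀ p ∈ J, ∫⁻ x in cb a L p.1 p.2, φ x ≤ ENNReal.ofReal (2 ^ n) * s * volume (cb a L p.1 p.2)) ∧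
      (∀ p ∈ J, p.1 < m → s * volume (cb a L p.1 p.2) ≤ ∫⁻ x in cb a L p.1 p.2, φ x) ∧
      (∀ p ∈ J, p.1 < m → 1 ≤ p.1) := by
  classical
  set bad : ℕ → (Fin n → ℤ) → Prop := fun d z => s * volume (cb a L d z) < ∫⁻ x in cb a L d z, φ x
    with hbad
  set R : ℕ → (Fin n → ℤ) → Prop := fun d z => d = m ∨ bad d z with hR
  have hfin : {p : ℕ × (Fin n → ℤ) | p.1 ≤ m ∧ cb a L p.1 p.2 ⊆ N3 a L 0 0 ∧
      First a L R p.1 p.2}.Finite := by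
    have : (⋃ d ∈ Finset.range (m + 1), (fun z => (d, z)) ''
        {z : Fin n → ℤ | cb a L d z ⊆ N3 a L 0 0}).Finite :=
      Set.Finite.biUnion (Finset.finite_toSet _) fun d _ => (in3_finite hn a hL d).image _
    refine this.subset ?_
    rintro ⟨d, z⟩ ⟨h1, h2, -⟩
    simp only [mem_iUnion]
    exact ⟨d, Finset.mem_range.2 (by simp only at h1; omega), z, h2, rfl⟩
  refine ⟨hfin.toFinset, ?_, ?_, ?_, ?_, ?_, ?_⟩
  · intro p hp
    rw [Set.Finite.mem_toFinset] at hp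
    exact ⟨hp.1, hp.2.1⟩
  · intro p hp q hq x hx hx'
    rw [Set.Finite.mem_toFinset] at hp hq
    exact First.disj hp.2.2 hq.2.2 hx hx'
  · intro x hx
    obtain ⟨d, hd, hF⟩ := First.exists (a := a) hL (R := R) (d := m) (x := x) (Or.inl rfl)
    refine ⟨(d, ix a L d x), ?_, rfl⟩
    rw [Set.Finite.mem_toFinset]
    exact ⟨hd, cb_in3 a hL d hx, hF⟩
  · intro p hp
    rw [Set.Finite.mem_toFinset] at hp
    obtain ⟨hpm, hp3, hpF⟩ := hp
    obtain ⟨d, z⟩ := p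
    simp only at hpm hp3 hpF ⊢
    rcases Nat.eq_zero_or_pos d with hd | hd
    · subst hd
      refine (h0 z hp3).trans ?_
      rw [mul_assoc]
      refine le_mul_of_one_le_left (by positivity) ?_
      rw [← ENNReal.ofReal_one]
      exact ENNReal.ofReal_le_ofReal (one_le_pow₀ (by norm_num))
    · obtain ⟨e, rfl⟩ : ∃ e, d = e + 1 := ⟨d - 1, by omega⟩
      have hx := crn_mem a hL (e + 1) z
      set x := crn a L (e + 1) z
      have h1 := hpF.2 x hx e (by omega)
      have h2 : ∫⁻ x in cb a L e (ix a L e x), φ x ≤ s * volume (cb a L e (ix a L e x)) := by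
        by_contra hc
        exact h1 (Or.inr (not_le.1 hc))
      have hsub : cb a L (e + 1) z ⊆ cb a L e (ix a L e x) := by
        intro y hy
        have e1 : ix a L (e + 1) y = ix a L (e + 1) x := by
          have a1 : ix a L (e + 1) y = z := hy
          have a2 : ix a L (e + 1) x = z := hx
          rw [a1, a2]
        exact ix_nested a hL (Nat.le_succ e) e1
      refine (lintegral_mono_set hsub).trans (h2.trans (le_of_eq ?_))
      rw [volume_cb a hL, volume_cb a hL, mul_comm (ENNReal.ofReal (2 ^ n)), mul_assoc,
        ← ENNReal.ofReal_mul (by positivity)]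
      congr 2
      rw [← mul_pow, pow_succ]
      congr 1
      field_simp
  · intro p hp hpm
    rw [Set.Finite.mem_toFinset] at hp
    rcases hp.2.2.1 with h | h
    · omega
    · exact h.le
  · intro p hp hpm
    rw [Set.Finite.mem_toFinset] at hp
    rcases hp.2.2.1 with h | h
    · omega
    · by_contra hc
      have hc0 : p.1 = 0 := by omega
      have hp3 := hp.2.1
      rw [hc0] at h hp3
      exact absurd (h0 _ hp3) (not_le.2 h)

theorem near_Q_in3 (a : Rn n) {L : ℝ} (hL : 0 < L) (d : ℕ) {x : Rn n} (hx : x ∈ Qc a L) :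
    cb a L d (ix a L d x) ⊆ Qc a L := by
  intro y hy
  have h1 : ix a L 0 y = ix a L 0 x := ix_nested a hL (Nat.zero_le d) hy
  rw [← cb_zero a hL] at hx ⊢
  have h2 : ix a L 0 x = 0 := hx
  show ix a L 0 y = 0
  rw [h1, h2]

theorem Qc_subset_N3 (a : Rn n) {L : ℝ} (hL : 0 < L) : Qc a L ⊆ N3 a L 0 0 := by
  rw [← cb_zero a hL]
  intro y hy
  have h2 : ix a L 0 y = 0 := hy
  show near (ix a L 0 y) 0
  rw [h2]; exact near_refl _

/-- The family of removed Carleson boxes. -/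
theorem removed (hn : 1 ≤ n) (a : Rn n) {L : ℝ} (hL : 0 < L) (m : ℕ)
    (J : Finset (ℕ × (Fin n → ℤ))) (hJ : ∀ p ∈ J, p.1 < m → 1 ≤ p.1) :
    ∃ P : Finset (ℕ × (Fin n → ℤ)),
      (∀ p ∈ P, 1 ≤ p.1 ∧ p.1 < m ∧ cb a L p.1 p.2 ⊆ Qc a L) ∧
      (∀ p ∈ P, ∀ q ∈ P, ∀ x, x ∈ cb a L p.1 p.2 → x ∈ cb a L q.1 q.2 → p = q) ∧
      (∀ p ∈ P, ∃ j ∈ J, j.1 < m ∧ cb a L p.1 p.2 ⊆ N3 a L j.1 j.2) ∧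
      (∀ y ∈ Qc a L, ∀ t : ℝ, ∀ j ∈ J, j.1 < m → t ≤ L / 2 ^ j.1 → y ∈ N3 a L j.1 j.2 →
        ∃ p ∈ P, y ∈ cb a L p.1 p.2 ∧ t ≤ L / 2 ^ p.1) := by
  classical
  set R : ℕ → (Fin n → ℤ) → Prop := fun d z => d < m ∧ ∃ z', near z z' ∧ (d, z') ∈ J with hR
  have hfin : {p : ℕ × (Fin n → ℤ) | p.1 < m ∧ cb a L p.1 p.2 ⊆ Qc a L ∧
      First a L R p.1 p.2}.Finite := by
    have : (⋃ d ∈ Finset.range m, (fun z => (d, z)) ''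
        {z : Fin n → ℤ | cb a L d z ⊆ N3 a L 0 0}).Finite :=
      Set.Finite.biUnion (Finset.finite_toSet _) fun d _ => (in3_finite hn a hL d).image _
    refine this.subset ?_
    rintro ⟨d, z⟩ ⟨h1, h2, -⟩
    simp only [mem_iUnion]
    exact ⟨d, Finset.mem_range.2 h1, z, h2.trans (Qc_subset_N3 a hL), rfl⟩
  refine ⟨hfin.toFinset, ?_, ?_, ?_, ?_⟩
  · intro p hp
    rw [Set.Finite.mem_toFinset] at hp
    refine ⟨?_, hp.1, hp.2.1⟩
    obtain ⟨hm, z', -, hz'⟩ := hp.2.2.1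
    exact hJ (p.1, z') hz' hm
  · intro p hp q hq x hx hx'
    rw [Set.Finite.mem_toFinset] at hp hq
    exact First.disj hp.2.2 hq.2.2 hx hx'
  · intro p hp
    rw [Set.Finite.mem_toFinset] at hp
    obtain ⟨hm, z', hn', hz'⟩ := hp.2.2.1
    refine ⟨_, hz', hm, ?_⟩
    intro y hy
    have h2 : ix a L p.1 y = p.2 := hy
    show near (ix a L p.1 y) z'
    rw [h2]; exact hn'
  · intro y hy t j hj hjm ht hyj
    have hRj : R j.1 (ix a L j.1 y) := ⟨hjm, j.2, hyj, hj⟩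
    obtain ⟨d, hd, hF⟩ := First.exists (a := a) hL (R := R) hRj
    refine ⟨(d, ix a L d y), ?_, rfl, ht.trans ?_⟩
    · rw [Set.Finite.mem_toFinset]
      exact ⟨by simp only; omega, near_Q_in3 a hL d hy, hF⟩
    · simp only
      gcongr
      norm_num

theorem cvl_integrand_L1 {C₁ C₂ δ γ : ℝ} (hC₁ : 0 < C₁) (hδ : 0 < δ) {ψ : Rn n → ℝ}
    (hψ : PsiKernel n C₁ C₂ δ γ ψ) {u : Rn n → ℝ} (hu : Integrable u) {t : ℝ} (ht : 0 < t)
    (y : Rn n) : Integrable (fun z => (t ^ n)⁻¹ * ψ (t⁻¹ • (y - z)) * u z) := by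
  have hk : Integrable (fun z => (t ^ n)⁻¹ * ψ (t⁻¹ • (y - z))) :=
    (psit_integrable hψ.1 ht).comp_sub_left y
  refine hu.bdd_mul (c := (t ^ n)⁻¹ * C₁) hk.1 (ae_of_all _ fun z => ?_)
  rw [norm_mul, Real.norm_of_nonneg (by positivity), Real.norm_eq_abs]
  have h1 := psi_ker hψ ht y z
  have h2 : (1 + ‖z - y‖ / t) ^ (-((n:ℝ) + δ)) ≤ 1 :=
    Real.rpow_le_one_of_one_le_of_nonpos (by
      have : 0 ≤ ‖z - y‖ / t := by positivity
      linarith) (by have : (0:ℝ) ≤ n := by positivity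
                    linarith)
  have h3 : |ψ (t⁻¹ • (y - z))| ≤ C₁ := h1.trans (by nlinarith)
  gcongr

theorem cvl_decomp {C₁ C₂ δ γ : ℝ} (hC₁ : 0 < C₁) (hδ : 0 < δ) {ψ : Rn n → ℝ}
    (hψ : PsiKernel n C₁ C₂ δ γ ψ) {ω f : Rn n → ℝ} {CA K : ℝ} (h : A1P ω CA) (hf : BM ω f K)
    {ι : Type*} (J : Finset ι) {F : ℝ} {g hh : Rn n → ℝ} {b : ι → Rn n → ℝ}
    (hg : Integrable g) (hb : ∀ p ∈ J, Integrable (b p))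
    (hdec : ∀ x, f x - F = g x + (∑ p ∈ J, b p x) + hh x)
    {t : ℝ} (ht : 0 < t) (y : Rn n) :
    cvl ψ t f y = cvl ψ t g y + (∑ p ∈ J, cvl ψ t (b p) y) + cvl ψ t hh y := by
  have i0 := cvl_integrand hC₁ hδ hψ h hf ht y F
  have ig := cvl_integrand_L1 hC₁ hδ hψ hg ht y
  have ib : ∀ p ∈ J, _ := fun p hp => cvl_integrand_L1 hC₁ hδ hψ (hb p hp) ht y
  have isum := integrable_finset_sum J ib
  have ih : Integrable (fun z => (t ^ n)⁻¹ * ψ (t⁻¹ • (y - z)) * hh z) := by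
    refine ((i0.sub ig).sub isum).congr (ae_of_all _ fun z => ?_)
    simp only [Pi.sub_apply]
    rw [hdec z, ← Finset.mul_sum]; ring
  rw [cvl_sub_const hC₁ hδ hψ h hf ht y F]
  unfold cvl
  have igs : Integrable (fun z => (t ^ n)⁻¹ * ψ (t⁻¹ • (y - z)) * g z
      + ∑ p ∈ J, (t ^ n)⁻¹ * ψ (t⁻¹ • (y - z)) * b p z) := ig.add isum
  rw [← integral_finset_sum J ib, ← integral_add ig isum, ← integral_add igs ih]
  congr 1; ext z
  simp only
  rw [hdec z, ← Finset.mul_sum]; ring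

/-- average weight of the big ball, normalised -/
def lam (ω : Rn n → ℝ) (a : Rn n) (L : ℝ) : ℝ := wInt ω (ball a (4 * n * L)) / L ^ n

theorem lam_pos (hn : 1 ≤ n) {ω : Rn n → ℝ} {CA : ℝ} (h : A1P ω CA) (a : Rn n) {L : ℝ}
    (hL : 0 < L) : 0 < lam ω a L := by
  have hn' : (1:ℝ) ≤ n := by exact_mod_cast hn
  exact div_pos (h.pos a _ (by positivity)) (by positivity)

theorem Qc_norm_le {a : Rn n} {L : ℝ} (hL : 0 < L) {y : Rn n} (hy : y ∈ Qc a L) :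
    ‖y - a‖ ≤ n * L := by
  refine norm_le_of_coord hL.le fun i => ?_
  have := hy i
  rw [PiLp.sub_apply, abs_le]; constructor <;> linarith

theorem lam_le (hn : 1 ≤ n) {ω : Rn n → ℝ} {CA : ℝ} (h : A1P ω CA) {a : Rn n} {L : ℝ}
    (hL : 0 < L) {y : Rn n} (hy : y ∈ Qc a L) {t : ℝ} (ht : 0 < t) (htL : t ≤ L) :
    lam ω a L ≤ CA * (4 * n) ^ n * (wInt ω (ball y t) / t ^ n) := by
  have hn' : (1:ℝ) ≤ n := by exact_mod_cast hn
  have hsub : ball y t ⊆ ball a (4 * n * L) := by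
    refine ball_subset_ball' ?_
    rw [dist_eq_norm]
    have := Qc_norm_le hL hy
    nlinarith
  have h1 := h.dbl ht (by positivity) hsub
  unfold lam
  rw [div_le_iff₀ (by positivity)]
  refine h1.trans (le_of_eq ?_)
  rw [div_pow, mul_pow]
  field_simp

theorem tail_H (hn : 1 ≤ n) {C₁ C₂ δ γ : ℝ} (hC₁ : 0 < C₁) (hδ : 0 < δ) {ψ : Rn n → ℝ}
    (hψ : PsiKernel n C₁ C₂ δ γ ψ) {ω f : Rn n → ℝ} {CA K : ℝ} (h : A1P ω CA) (hf : BM ω f K)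
    {a : Rn n} {L : ℝ} (hL : 0 < L) {hh : Rn n → ℝ}
    (hh0 : ∀ z ∈ N3 a L 0 0, hh z = 0)
    (hh1 : ∀ z, |hh z| ≤ |f z - avg f (ball a (4 * n * L))|)
    {y : Rn n} (hy : y ∈ Qc a L) {t : ℝ} (ht : 0 < t) :
    |cvl ψ t hh y| ≤ C₁ * 3 ^ ((n:ℝ) + δ) * tailC n CA δ * K * lam ω a L * (t / L) ^ δ := by
  have hn' : (1:ℝ) ≤ n := by exact_mod_cast hn
  have hC := h.one_le
  have hK := hf.pos
  have hR : (0:ℝ) < 4 * n * L := by positivity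
  have hw := h.pos a _ hR
  have hT := tailC_nonneg (n := n) (δ := δ) hC
  have hla := lam_pos hn h a hL
  have h1 := cvl_le_jap hC₁ hψ hh ht y
  set F := avg f (ball a (4 * n * L)) with hF
  have hnd : 0 < (n:ℝ) + δ := by positivity
  have h2 : ∫⁻ z, ENNReal.ofReal |hh z| * ENNReal.ofReal ((1 + ‖z - y‖ / t) ^ (-((n:ℝ) + δ))) ≤
      ENNReal.ofReal ((3 * t / L) ^ ((n:ℝ) + δ)) *
        ∫⁻ z, ENNReal.ofReal |f z - F| *
          ENNReal.ofReal ((1 + ‖z - a‖ / (4 * n * L)) ^ (-((n:ℝ) + δ))) := by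
    rw [← lintegral_const_mul' _ _ ENNReal.ofReal_ne_top]
    refine lintegral_mono fun z => ?_
    by_cases hz : z ∈ N3 a L 0 0
    · simp [hh0 z hz]
    · simp only
      rw [mul_left_comm, ← ENNReal.ofReal_mul (p := (3 * t / L) ^ ((n:ℝ) + δ)) (by positivity)]
      refine mul_le_mul' (ENNReal.ofReal_le_ofReal (hh1 z)) (ENNReal.ofReal_le_ofReal ?_)
      have hyz : ix a L 0 y = 0 := by
        rw [← cb_zero a hL] at hy; exact hy
      have hfar : L ≤ ‖z - y‖ := by
        have := far_dist a hL (d := 0) (y := z) (y' := y) (by rw [hyz]; exact hz)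
        simpa using this
      have hya := Qc_norm_le hL hy
      have e1 : ‖z - a‖ ≤ ‖z - y‖ + n * L := by
        calc ‖z - a‖ = ‖(z - y) + (y - a)‖ := by congr 1; abel
          _ ≤ _ := (norm_add_le _ _).trans (by linarith)
      have e2 : 1 + ‖z - a‖ / (4 * n * L) ≤ 3 * (‖z - y‖ / L) := by
        have a1 : ‖z - a‖ / (4 * n * L) ≤ ‖z - y‖ / L + 1 := by
          rw [div_le_iff₀ hR]
          have : (‖z - y‖ / L + 1) * (4 * n * L) = 4 * n * ‖z - y‖ + 4 * n * L := by field_simp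
          rw [this]
          have : ‖z - y‖ ≤ 4 * n * ‖z - y‖ := by
            nlinarith [norm_nonneg (z - y)]
          nlinarith
        have a2 : 1 ≤ ‖z - y‖ / L := by rw [le_div_iff₀ hL]; linarith
        linarith
      have e3 : (1 + ‖z - a‖ / (4 * n * L)) / (3 * t / L) ≤ 1 + ‖z - y‖ / t := by
        rw [div_le_iff₀ (by positivity)]
        refine e2.trans ?_
        have : (1 + ‖z - y‖ / t) * (3 * t / L) = 3 * t / L + 3 * (‖z - y‖ / L) := by field_simp
        rw [this]
        have : 0 < 3 * t / L := by positivity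
        linarith
      calc _ ≤ ((1 + ‖z - a‖ / (4 * n * L)) / (3 * t / L)) ^ (-((n:ℝ) + δ)) :=
            Real.rpow_le_rpow_of_nonpos (by positivity) e3 (by linarith)
        _ = _ := by
            rw [Real.div_rpow (by positivity) (by positivity),
              Real.rpow_neg (by positivity : (0:ℝ) ≤ 3 * t / L), div_inv_eq_mul, mul_comm]
  have h3 := h1.trans (mul_le_mul_right (h2.trans (mul_le_mul_right (hf.tail h hδ a hR) _)) _)
  rw [← ENNReal.ofReal_mul (by positivity), ← ENNReal.ofReal_mul (by positivity),
    ENNReal.ofReal_le_ofReal_iff (by positivity)] at h3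
  refine h3.trans (le_of_eq ?_)
  have e4 : (3 * t / L) ^ ((n:ℝ) + δ) = 3 ^ ((n:ℝ) + δ) * ((t / L) ^ n * (t / L) ^ δ) := by
    rw [mul_div_assoc, Real.mul_rpow (by norm_num) (by positivity),
      Real.rpow_add (by positivity : 0 < t / L), Real.rpow_natCast]
  rw [e4, lam, div_pow]
  field_simp

/-- pointwise splitting -/
theorem pt_split {u G B H W t K la c1 c2 : ℝ} (hW : 0 < W) (ht : 0 < t)
    (hla : 0 < la) (hu : u = G + B + H) (h1 : la ≤ c1 * W) (h2 : |u| ≤ c2 * K * W) :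
    u ^ 2 / (W * t) ≤ 2 * c1 / la * (G ^ 2 / t) + 2 * c1 / la * (H ^ 2 / t) +
      2 * (c2 * K) * (|B| / t) := by
  have e1 : u ^ 2 ≤ 2 * G ^ 2 + 2 * H ^ 2 + 2 * (|u| * |B|) := by
    have : u * B ≤ |u| * |B| := by rw [← abs_mul]; exact le_abs_self _
    have hu2 : u ^ 2 = u * (G + H) + u * B := by rw [hu]; ring
    nlinarith [sq_nonneg (u - (G + H)), sq_nonneg (G - H)]
  have e2 : 1 / W ≤ c1 / la := by
    rw [div_le_div_iff₀ hW hla]; linarith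
  have e3 : |u| / W ≤ c2 * K := by rw [div_le_iff₀ hW]; exact h2
  calc u ^ 2 / (W * t) ≤ (2 * G ^ 2 + 2 * H ^ 2 + 2 * (|u| * |B|)) / (W * t) := by gcongr
    _ = (1 / W) * (2 * (G ^ 2 / t)) + (1 / W) * (2 * (H ^ 2 / t)) + (|u| / W) * (2 * (|B| / t)) := by
        field_simp
    _ ≤ (c1 / la) * (2 * (G ^ 2 / t)) + (c1 / la) * (2 * (H ^ 2 / t)) + (c2 * K) * (2 * (|B| / t)) := by
        gcongr
    _ = _ := by ring

theorem lint_disj_sum (a : Rn n) {L : ℝ} (hL : 0 < L) (J : Finset (ℕ × (Fin n → ℤ)))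
    (hd : ∀ p ∈ J, ∀ q ∈ J, ∀ x, x ∈ cb a L p.1 p.2 → x ∈ cb a L q.1 q.2 → p = q)
    (μ : Measure (Rn n)) (φ : Rn n → ℝ≥0∞) {S : Set (Rn n)}
    (hS : ∀ p ∈ J, cb a L p.1 p.2 ⊆ S) :
    ∑ p ∈ J, ∫⁻ x in cb a L p.1 p.2, φ x ∂μ ≤ ∫⁻ x in S, φ x ∂μ := by
  rw [← lintegral_biUnion_finset (s := J) (t := fun p => cb a L p.1 p.2)]
  · exact lintegral_mono_set (iUnion₂_subset hS)
  · intro p hp q hq hpq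
    rw [Function.onFun, Set.disjoint_left]
    intro x hx hx'
    exact hpq (hd p hp q hq x hx hx')
  · intro p _; exact cb_meas a hL _ _

theorem sum_ind_eq (a : Rn n) {L : ℝ} (J : Finset (ℕ × (Fin n → ℤ)))
    (hd : ∀ p ∈ J, ∀ q ∈ J, ∀ x, x ∈ cb a L p.1 p.2 → x ∈ cb a L q.1 q.2 → p = q)
    (u : ℕ × (Fin n → ℤ) → Rn n → ℝ) {p} (hp : p ∈ J) {x : Rn n} (hx : x ∈ cb a L p.1 p.2) :
    ∑ q ∈ J, (cb a L q.1 q.2).indicator (u q) x = u p x := by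
  rw [Finset.sum_eq_single p]
  · rw [indicator_of_mem hx]
  · intro q hq hqp
    rw [indicator_of_notMem]
    intro hx'
    exact hqp (hd q hq p hp x hx' hx)
  · intro h; exact absurd hp h

theorem cz_decomp (hn : 1 ≤ n) {ω f : Rn n → ℝ} {CA K : ℝ} (h : A1P ω CA) (hf : BM ω f K)
    (a : Rn n) {L : ℝ} (hL : 0 < L) (m : ℕ) :
    ∃ (J P : Finset (ℕ × (Fin n → ℤ))) (g hh : Rn n → ℝ) (b : ℕ × (Fin n → ℤ) → Rn n → ℝ),
      (∀ p ∈ J, p.1 ≤ m) ∧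
      (∀ p ∈ P, 1 ≤ p.1 ∧ p.1 < m ∧ cb a L p.1 p.2 ⊆ Qc a L) ∧
      (∀ p ∈ P, ∀ q ∈ P, ∀ x, x ∈ cb a L p.1 p.2 → x ∈ cb a L q.1 q.2 → p = q) ∧
      volume (⋃ p ∈ P, cb a L p.1 p.2) ≤ ENNReal.ofReal (L ^ n / 2) ∧
      (∀ y ∈ Qc a L, ∀ t : ℝ, ∀ j ∈ J, j.1 < m → t ≤ L / 2 ^ j.1 → y ∈ N3 a L j.1 j.2 →
        ∃ p ∈ P, y ∈ cb a L p.1 p.2 ∧ t ≤ L / 2 ^ p.1) ∧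
      Integrable g ∧ (∀ x, |g x| ≤ 2 ^ n * (2 * 3 ^ n * K * lam ω a L)) ∧
      ∫⁻ x, ENNReal.ofReal (g x ^ 2) ≤
        ENNReal.ofReal ((2 ^ n * (2 * 3 ^ n * K * lam ω a L)) ^ 2 * (3 ^ n * L ^ n)) ∧
      (∀ p ∈ J, Integrable (b p) ∧ ∫ x, b p x = 0 ∧ ∀ z, z ∉ cb a L p.1 p.2 → b p z = 0) ∧
      ∑ p ∈ J, ∫⁻ x, ENNReal.ofReal |b p x| ≤ ENNReal.ofReal (2 * K * (lam ω a L * L ^ n)) ∧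
      (∀ z ∈ N3 a L 0 0, hh z = 0) ∧
      (∀ z, |hh z| ≤ |f z - avg f (ball a (4 * n * L))|) ∧
      (∀ x, f x - avg f (ball a (4 * n * L)) = g x + (∑ p ∈ J, b p x) + hh x) := by
  classical
  have hn' : (1:ℝ) ≤ n := by exact_mod_cast hn
  have hK := hf.pos
  have hla := lam_pos hn h a hL
  have hR : (0:ℝ) < 4 * n * L := by positivity
  set F := avg f (ball a (4 * n * L)) with hF
  set la := lam ω a L with hlam
  have hlaeq : wInt ω (ball a (4 * n * L)) = la * L ^ n := by
    rw [hlam, lam]; field_simp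
  set φ : Rn n → ℝ≥0∞ := fun x => ENNReal.ofReal |f x - F| with hφ
  have hN : ∫⁻ x in N3 a L 0 0, φ x ≤ ENNReal.ofReal (K * (la * L ^ n)) := by
    refine (lintegral_mono_set (N3_subset_ball hn a hL)).trans ?_
    have := hf.osc a _ hR
    rwa [hlaeq] at this
  set sr : ℝ := 2 * 3 ^ n * K * la with hsr
  have hsr0 : 0 < sr := by positivity
  set s : ℝ≥0∞ := ENNReal.ofReal sr with hs
  have h0 : ∀ z, cb a L 0 z ⊆ N3 a L 0 0 → ∫⁻ x in cb a L 0 z, φ x ≤ s * volume (cb a L 0 z) := by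
    intro z hz
    refine (lintegral_mono_set hz).trans (hN.trans ?_)
    rw [volume_cb a hL, hs, ← ENNReal.ofReal_mul hsr0.le]
    apply ENNReal.ofReal_le_ofReal
    have h3 : (1:ℝ) ≤ 3 ^ n := one_le_pow₀ (by norm_num)
    have : 0 < K * (la * L ^ n) := by positivity
    simp only [pow_zero, div_one, hsr]
    nlinarith
  obtain ⟨J, j1, j2, j3, j4, j5, j6⟩ := cz hn a hL m φ s h0
  obtain ⟨P, p1, p2, p3, p4⟩ := removed hn a hL m J j6
  have hvol0 : ∀ p : ℕ × (Fin n → ℤ), volume (cb a L p.1 p.2) ≠ 0 := fun p => by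
    rw [volume_cb a hL]
    have : 0 < (L / 2 ^ p.1) ^ n := by positivity
    simpa using this
  have hvolT : ∀ p : ℕ × (Fin n → ℤ), volume (cb a L p.1 p.2) ≠ ∞ := fun p => by
    rw [volume_cb a hL]; exact ENNReal.ofReal_ne_top
  have hsum1 : ∑ p ∈ J, ∫⁻ x in cb a L p.1 p.2, φ x ≤ ENNReal.ofReal (K * (la * L ^ n)) :=
    (lint_disj_sum a hL J j2 volume φ fun p hp => (j1 p hp).2).trans hN
  have hfi : ∀ p ∈ J, IntegrableOn f (cb a L p.1 p.2) := fun p hp =>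
    (integrableOn_ball hf.loc a (4 * n * L)).mono_set ((j1 p hp).2.trans (N3_subset_ball hn a hL))
  set A : ℕ × (Fin n → ℤ) → ℝ := fun p => avg f (cb a L p.1 p.2) with hA
  have hAb : ∀ p ∈ J, |A p - F| ≤ 2 ^ n * sr := by
    intro p hp
    have e1 := (avg_sub_le (hfi p hp) (hvol0 p) (hvolT p) F).trans (j4 p hp)
    have e2 := (ENNReal.mul_le_mul_iff_left (hvol0 p) (hvolT p)).1 e1
    rw [hs, ← ENNReal.ofReal_mul (by positivity)] at e2
    exact (ENNReal.ofReal_le_ofReal_iff (by positivity)).1 e2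
  set gp : ℕ × (Fin n → ℤ) → Rn n → ℝ := fun p => (cb a L p.1 p.2).indicator fun _ => A p - F
    with hgp
  set g : Rn n → ℝ := fun x => ∑ p ∈ J, gp p x with hg
  set b : ℕ × (Fin n → ℤ) → Rn n → ℝ := fun p => (cb a L p.1 p.2).indicator fun x => f x - A p
    with hb
  set hh : Rn n → ℝ := (N3 a L 0 0)ᶜ.indicator fun x => f x - F with hhh
  have hg_in : ∀ p ∈ J, ∀ x ∈ cb a L p.1 p.2, g x = A p - F := fun p hp x hx =>
    sum_ind_eq a J j2 (fun p _ => A p - F) hp hx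
  have hg_out : ∀ x ∉ N3 a L 0 0, g x = 0 := fun x hx =>
    Finset.sum_eq_zero fun p hp => indicator_of_notMem (fun hx' => hx ((j1 p hp).2 hx')) _
  have hb_in : ∀ p ∈ J, ∀ x ∈ cb a L p.1 p.2, ∑ q ∈ J, b q x = f x - A p := fun p hp x hx =>
    sum_ind_eq a J j2 (fun p x => f x - A p) hp hx
  have hb_out : ∀ x ∉ N3 a L 0 0, ∑ q ∈ J, b q x = 0 := fun x hx =>
    Finset.sum_eq_zero fun p hp => indicator_of_notMem (fun hx' => hx ((j1 p hp).2 hx')) _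
  have hgM : ∀ x, |g x| ≤ 2 ^ n * sr := by
    intro x
    by_cases hx : x ∈ N3 a L 0 0
    · obtain ⟨p, hp, hxp⟩ := j3 x hx
      rw [hg_in p hp x hxp]; exact hAb p hp
    · rw [hg_out x hx, abs_zero]; positivity
  refine ⟨J, P, g, hh, b, fun p hp => (j1 p hp).1, p1, p2, ?_, p4, ?_, hgM, ?_, ?_, ?_, ?_, ?_, ?_⟩
  · -- volume of removed set
    set J' := J.filter fun j => j.1 < m with hJ'
    have e0 : (⋃ p ∈ P, cb a L p.1 p.2) ⊆ ⋃ j ∈ J', N3 a L j.1 j.2 := by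
      refine iUnion₂_subset fun p hp => ?_
      obtain ⟨j, hj, hjm, hsub⟩ := p3 p hp
      exact hsub.trans (subset_biUnion_of_mem (u := fun j : ℕ × (Fin n → ℤ) => N3 a L j.1 j.2)
        (Finset.mem_filter.2 ⟨hj, hjm⟩))
    have e1 : volume (⋃ p ∈ P, cb a L p.1 p.2) ≤
        ENNReal.ofReal (3 ^ n) * ∑ j ∈ J', volume (cb a L j.1 j.2) := by
      refine (measure_mono e0).trans ((measure_biUnion_finset_le _ _).trans ?_)
      rw [Finset.mul_sum]
      exact Finset.sum_le_sum fun j _ => (volume_N3 a hL _ _).le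
    have e2 : s * ∑ j ∈ J', volume (cb a L j.1 j.2) ≤ ENNReal.ofReal (K * (la * L ^ n)) := by
      rw [Finset.mul_sum]
      refine (Finset.sum_le_sum fun j hj => ?_).trans
        ((Finset.sum_le_sum_of_subset (Finset.filter_subset _ J)).trans hsum1)
      exact j5 j (Finset.mem_filter.1 hj).1 (Finset.mem_filter.1 hj).2
    have e3 : ∑ j ∈ J', volume (cb a L j.1 j.2) ≤ ENNReal.ofReal (K * (la * L ^ n) / sr) := by
      rw [ENNReal.ofReal_div_of_pos hsr0, ENNReal.le_div_iff_mul_le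
        (Or.inl (by simpa using hsr0)) (Or.inl ENNReal.ofReal_ne_top), mul_comm]
      exact e2
    refine e1.trans ((mul_le_mul_right e3 _).trans ?_)
    rw [← ENNReal.ofReal_mul (by positivity)]
    apply ENNReal.ofReal_le_ofReal
    rw [hsr]; apply le_of_eq; field_simp
  · exact integrable_finsetSum _ fun p _ =>
      (integrable_indicator_iff (cb_meas a hL _ _)).2 (integrableOn_const (hvolT p))
  · calc ∫⁻ x, ENNReal.ofReal (g x ^ 2)
        ≤ ∫⁻ x, (N3 a L 0 0).indicator (fun _ => ENNReal.ofReal ((2 ^ n * sr) ^ 2)) x := by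
          refine lintegral_mono fun x => ?_
          by_cases hx : x ∈ N3 a L 0 0
          · rw [indicator_of_mem hx]
            apply ENNReal.ofReal_le_ofReal
            rw [← sq_abs]; gcongr; exact hgM x
          · rw [hg_out x hx]; simp
      _ = _ := by
          rw [lintegral_indicator (N3_meas a hL _ _), setLIntegral_const, volume_N3 a hL,
            volume_cb a hL, ← ENNReal.ofReal_mul (by positivity),
            ← ENNReal.ofReal_mul (by positivity)]
          simp
  · intro p hp
    refine ⟨?_, ?_, fun z hz => indicator_of_notMem hz _⟩
    · exact (integrable_indicator_iff (cb_meas a hL _ _)).2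
        ((hfi p hp).sub (integrableOn_const (hvolT p)))
    · rw [integral_indicator (cb_meas a hL _ _), integral_sub (hfi p hp)
        (integrableOn_const (hvolT p)), setIntegral_const, hA]
      have : 0 < (volume (cb a L p.1 p.2)).toReal := ENNReal.toReal_pos (hvol0 p) (hvolT p)
      simp only [avg, Measure.real, smul_eq_mul]
      field_simp
      ring
  · have e1 : ∀ p ∈ J, ∫⁻ x, ENNReal.ofReal |b p x| ≤ 2 * ∫⁻ x in cb a L p.1 p.2, φ x := by
      intro p hp
      have : ∀ x, ENNReal.ofReal |b p x| =
          (cb a L p.1 p.2).indicator (fun x => ENNReal.ofReal |f x - A p|) x := by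
        intro x
        by_cases hx : x ∈ cb a L p.1 p.2
        · rw [indicator_of_mem hx, hb]; simp only; rw [indicator_of_mem hx]
        · rw [indicator_of_notMem hx, hb]; simp only; rw [indicator_of_notMem hx]; simp
      rw [lintegral_congr this, lintegral_indicator (cb_meas a hL _ _)]
      refine (lint_abs_sub_le (A p) F).trans ?_
      rw [abs_sub_comm, two_mul]
      exact add_le_add le_rfl (avg_sub_le (hfi p hp) (hvol0 p) (hvolT p) F)
    refine (Finset.sum_le_sum e1).trans ?_
    rw [← Finset.mul_sum, mul_assoc, ENNReal.ofReal_mul (by norm_num)]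
    simp only [ENNReal.ofReal_ofNat]
    gcongr
  · intro z hz
    exact indicator_of_notMem (by simpa using hz) _
  · intro z
    by_cases hz : z ∈ (N3 a L 0 0)ᶜ
    · rw [hhh, indicator_of_mem hz]
    · rw [hhh, indicator_of_notMem hz, abs_zero]; exact abs_nonneg _
  · intro x
    by_cases hx : x ∈ N3 a L 0 0
    · obtain ⟨p, hp, hxp⟩ := j3 x hx
      rw [hg_in p hp x hxp, hb_in p hp x hxp, hhh, indicator_of_notMem (by simpa using hx)]
      ring
    · rw [hg_out x hx, hb_out x hx, hhh, indicator_of_mem (by exact hx)]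
      ring

theorem ae_slice1 {ψ u : Rn n → ℝ} (hψ : AEStronglyMeasurable ψ volume)
    (hu : AEStronglyMeasurable u volume) {I : Set ℝ} (hI : MeasurableSet I) (hI0 : I ⊆ Ioi 0) :
    AEMeasurable (fun t => ∫⁻ y, ENNReal.ofReal ((cvl ψ t u y) ^ 2 / t)) (volume.restrict I) := by
  obtain ⟨G, hG, hGe⟩ := cvl_measurable hψ hu
  refine ⟨fun t => ∫⁻ y, ENNReal.ofReal ((G (t, y)) ^ 2 / t), ?_, ?_⟩
  · have : Measurable (fun q : ℝ × Rn n => ENNReal.ofReal ((G q) ^ 2 / q.1)) := by fun_prop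
    exact this.lintegral_prod_right'
  · filter_upwards [ae_restrict_mem hI] with t ht
    exact lintegral_congr fun y => by rw [hGe t (hI0 ht)]

theorem ae_slice2 {ψ u : Rn n → ℝ} (hψ : AEStronglyMeasurable ψ volume)
    (hu : AEStronglyMeasurable u volume) {I : Set ℝ} (hI : MeasurableSet I) (hI0 : I ⊆ Ioi 0)
    (ℓ : ℝ) {E : Set (Rn n)} (hE : MeasurableSet E) :
    AEMeasurable (fun t => ∫⁻ y in {y | ℓ < t ∨ y ∈ E}, ENNReal.ofReal (|cvl ψ t u y| / t))
      (volume.restrict I) := by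
  obtain ⟨G, hG, hGe⟩ := cvl_measurable hψ hu
  have hs : MeasurableSet {q : ℝ × Rn n | ℓ < q.1 ∨ q.2 ∈ E} :=
    (measurableSet_lt measurable_const measurable_fst).union (measurable_snd hE)
  refine ⟨fun t => ∫⁻ y, {q : ℝ × Rn n | ℓ < q.1 ∨ q.2 ∈ E}.indicator
    (fun q => ENNReal.ofReal (|G q| / q.1)) (t, y), ?_, ?_⟩
  · have : Measurable (fun q : ℝ × Rn n => ENNReal.ofReal (|G q| / q.1)) := by fun_prop
    exact (this.indicator hs).lintegral_prod_right'
  · filter_upwards [ae_restrict_mem hI] with t ht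
    rw [← lintegral_indicator (show MeasurableSet {y : Rn n | ℓ < t ∨ y ∈ E} from
      measurable_prodMk_left hs)]
    refine lintegral_congr fun y => ?_
    by_cases hy : ℓ < t ∨ y ∈ E
    · rw [indicator_of_mem (by exact hy), indicator_of_mem (by exact hy), hGe t (hI0 ht)]
    · rw [indicator_of_notMem (by exact hy), indicator_of_notMem (by exact hy)]

theorem meas_y {ψ u : Rn n → ℝ} (hψ : AEStronglyMeasurable ψ volume)
    (hu : AEStronglyMeasurable u volume) {t : ℝ} (ht : 0 < t) : Measurable (cvl ψ t u) := by
  obtain ⟨G, hG, hGe⟩ := cvl_measurable hψ hu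
  have : cvl ψ t u = fun y => G (t, y) := by ext y; exact hGe t ht y
  rw [this]; fun_prop

theorem one_step (hn : 1 ≤ n) {C₁ C₂ δ γ : ℝ} (hC₁ : 0 < C₁) (hC₂ : 0 < C₂) (hδ : 0 < δ)
    (hγ : 0 < γ) {ψ : Rn n → ℝ} (hψ : PsiKernel n C₁ C₂ δ γ ψ) {ω : Rn n → ℝ} {CA : ℝ}
    (h : A1P ω CA) :
    ∃ C0 : ℝ, 0 ≤ C0 ∧ ∀ (f : Rn n → ℝ) (K : ℝ), BM ω f K → ∀ (a : Rn n) (L : ℝ), 0 < L →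
      ∀ m : ℕ, ∃ P : Finset (ℕ × (Fin n → ℤ)),
      (∀ p ∈ P, 1 ≤ p.1 ∧ p.1 < m ∧ cb a L p.1 p.2 ⊆ Qc a L) ∧
      (∀ p ∈ P, ∀ q ∈ P, ∀ x, x ∈ cb a L p.1 p.2 → x ∈ cb a L q.1 q.2 → p = q) ∧
      volume (⋃ p ∈ P, cb a L p.1 p.2) ≤ ENNReal.ofReal (L ^ n / 2) ∧
      ∫⁻ t in Ioc (L / 2 ^ m) L,
        ∫⁻ y in {y | y ∈ Qc a L ∧ ¬ ∃ p ∈ P, y ∈ cb a L p.1 p.2 ∧ t ≤ L / 2 ^ p.1},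
          Dd ψ ω f t y ≤ ENNReal.ofReal (C0 * K ^ 2 * (lam ω a L * L ^ n)) := by
  classical
  have hn' : (1:ℝ) ≤ n := by exact_mod_cast hn
  have hCA := h.one_le
  have hT := tailC_nonneg (n := n) (δ := δ) hCA
  obtain ⟨CL, hCL, hL2⟩ := sq_fun_L2 hn hC₁ hC₂ hδ hγ hψ
  obtain ⟨CT, hCT, hAt⟩ := atom_est hn hC₁ hC₂ hδ hγ hψ (show (0:ℝ) < n by linarith)
  set c1 := CA * (4 * (n:ℝ)) ^ n with hc1
  set c2 := C₁ * tailC n CA δ with hc2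
  set c3 := C₁ * 3 ^ ((n:ℝ) + δ) * tailC n CA δ with hc3
  have hc1p : 0 ≤ c1 := by positivity
  have hc2p : 0 ≤ c2 := by positivity
  have hc3p : 0 ≤ c3 := by positivity
  refine ⟨2 * c1 * CL * ((2 ^ n * (2 * 3 ^ n)) ^ 2 * 3 ^ n) + 2 * c1 * c3 ^ 2 * (1 / (2 * δ))
    + 4 * c2 * CT, by positivity, ?_⟩
  intro f K hf a L hL m
  obtain ⟨J, P, g, hh, b, hJ, p1, p2, p3, p4, gi, gM, g2, hb, hbs, hh0, hh1, hdec⟩ :=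
    cz_decomp hn h hf a hL m
  refine ⟨P, p1, p2, p3, ?_⟩
  have hK := hf.pos
  have hla := lam_pos hn h a hL
  set la := lam ω a L with hlam
  have hψm := hψ.1.1
  set Ω : ℝ → Set (Rn n) := fun t =>
    {y | y ∈ Qc a L ∧ ¬ ∃ p ∈ P, y ∈ cb a L p.1 p.2 ∧ t ≤ L / 2 ^ p.1} with hΩ
  have hI0 : Ioc (L / 2 ^ m) L ⊆ Ioi 0 := fun t ht => lt_trans (by positivity) ht.1
  set V : ℕ × (Fin n → ℤ) → ℝ → Set (Rn n) := fun p t =>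
    {y | L / 2 ^ p.1 < t ∨ y ∈ (N3 a L p.1 p.2)ᶜ} with hV
  have hΩm : ∀ t, MeasurableSet (Ω t) := by
    intro t
    have : Ω t = Qc a L ∩ (⋃ p ∈ P.filter (fun p => t ≤ L / 2 ^ p.1), cb a L p.1 p.2)ᶜ := by
      ext y
      simp only [hΩ, mem_setOf_eq, mem_inter_iff, mem_compl_iff, mem_iUnion, Finset.mem_filter,
        exists_prop]
      refine and_congr_right fun _ => not_congr (exists_congr fun p => ?_)
      tauto
    rw [this]
    exact (Qc_meas _ _).inter (Finset.measurableSet_biUnion _ fun p _ => cb_meas a hL _ _).compl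
  have hΩV : ∀ t ∈ Ioc (L / 2 ^ m) L, ∀ p ∈ J, Ω t ⊆ V p t := by
    intro t ht p hp y hy
    by_contra hcon
    simp only [hV, mem_setOf_eq, not_or, not_lt, mem_compl_iff, not_not] at hcon
    rcases lt_or_eq_of_le (hJ p hp) with hlt | heq
    · exact hy.2 (p4 y hy.1 t p hp hlt hcon.1 hcon.2)
    · rw [heq] at hcon; exact absurd ht.1 (not_lt.2 hcon.1)
  set A1 : ℝ → ℝ≥0∞ := fun t => ∫⁻ y, ENNReal.ofReal ((cvl ψ t g y) ^ 2 / t) with hA1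
  set A3 : ℕ × (Fin n → ℤ) → ℝ → ℝ≥0∞ := fun p t =>
    ∫⁻ y in V p t, ENNReal.ofReal (|cvl ψ t (b p) y| / t) with hA3
  set q1 : ℝ≥0∞ := ENNReal.ofReal (2 * c1 / la) with hq1
  set q2 : ℝ≥0∞ := ENNReal.ofReal (2 * c1 / la * (c3 * K * la) ^ 2 * L ^ n) with hq2
  set q3 : ℝ≥0∞ := ENNReal.ofReal (2 * (c2 * K)) with hq3
  have hin : ∀ t ∈ Ioc (L / 2 ^ m) L, ∫⁻ y in Ω t, Dd ψ ω f t y ≤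
      q1 * A1 t + q2 * ENNReal.ofReal ((t / L) ^ (2 * δ) / t) + q3 * ∑ p ∈ J, A3 p t := by
    intro t ht
    have ht0 : 0 < t := hI0 ht
    have hpt : ∀ y ∈ Ω t, Dd ψ ω f t y ≤ q1 * ENNReal.ofReal ((cvl ψ t g y) ^ 2 / t) +
        ENNReal.ofReal (2 * c1 / la * (c3 * K * la) ^ 2) * ENNReal.ofReal ((t / L) ^ (2 * δ) / t) +
        q3 * ∑ p ∈ J, ENNReal.ofReal (|cvl ψ t (b p) y| / t) := by
      intro y hy
      have hH := tail_H hn hC₁ hδ hψ h hf hL hh0 hh1 hy.1 ht0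
      have hW : 0 < wInt ω (ball y t) / t ^ n := div_pos (h.pos y t ht0) (by positivity)
      have hs := pt_split hW ht0 hla (cvl_decomp hC₁ hδ hψ h hf J gi (fun p hp => (hb p hp).1)
        hdec ht0 y) (lam_le hn h hL hy.1 ht0 ht.2) (cvl_bound hC₁ hδ hψ h hf ht0 y)
      have hs2 : (cvl ψ t f y) ^ 2 / (wInt ω (ball y t) / t ^ n * t) ≤
          2 * c1 / la * ((cvl ψ t g y) ^ 2 / t) +
          2 * c1 / la * (c3 * K * la) ^ 2 * ((t / L) ^ (2 * δ) / t) +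
          2 * (c2 * K) * ∑ p ∈ J, (|cvl ψ t (b p) y| / t) := by
        refine hs.trans ?_
        have e1 : (cvl ψ t hh y) ^ 2 ≤ (c3 * K * la) ^ 2 * (t / L) ^ (2 * δ) := by
          have : (t / L) ^ (2 * δ) = ((t / L) ^ δ) ^ 2 := by
            rw [mul_comm, Real.rpow_mul (by positivity)]; norm_num
          rw [this, ← mul_pow, ← sq_abs]
          gcongr
        have e2 : |∑ p ∈ J, cvl ψ t (b p) y| / t ≤ ∑ p ∈ J, (|cvl ψ t (b p) y| / t) := by
          rw [← Finset.sum_div]; gcongr; exact Finset.abs_sum_le_sum_abs _ _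
        have e3 : 2 * c1 / la * ((cvl ψ t hh y) ^ 2 / t) ≤
            2 * c1 / la * (c3 * K * la) ^ 2 * ((t / L) ^ (2 * δ) / t) := by
          have e5 : (cvl ψ t hh y) ^ 2 / t ≤ (c3 * K * la) ^ 2 * ((t / L) ^ (2 * δ) / t) := by
            rw [← mul_div_assoc]
            exact div_le_div_of_nonneg_right e1 ht0.le
          rw [mul_assoc]
          exact mul_le_mul_of_nonneg_left e5 (by positivity)
        have e4 := mul_le_mul_of_nonneg_left e2 (show 0 ≤ 2 * (c2 * K) by positivity)
        linarith
      unfold Dd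
      refine (ENNReal.ofReal_le_ofReal hs2).trans ?_
      have hns : ∀ p ∈ J, 0 ≤ |cvl ψ t (b p) y| / t := fun p _ => by positivity
      have hns' := Finset.sum_nonneg hns
      rw [ENNReal.ofReal_add (by positivity) (by positivity), ENNReal.ofReal_add (by positivity)
        (by positivity), ENNReal.ofReal_mul (by positivity),
        ENNReal.ofReal_mul (p := 2 * c1 / la * (c3 * K * la) ^ 2) (by positivity),
        ENNReal.ofReal_mul (p := 2 * (c2 * K)) (by positivity), ENNReal.ofReal_sum_of_nonneg hns]
    have mg : Measurable (fun y => ENNReal.ofReal ((cvl ψ t g y) ^ 2 / t)) := by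
      have := meas_y hψm gi.1 ht0
      fun_prop
    have mb : ∀ p ∈ J, Measurable (fun y => ENNReal.ofReal (|cvl ψ t (b p) y| / t)) := by
      intro p hp
      have := meas_y hψm (hb p hp).1.1 ht0
      fun_prop
    calc ∫⁻ y in Ω t, Dd ψ ω f t y ≤ ∫⁻ y in Ω t, (q1 * ENNReal.ofReal ((cvl ψ t g y) ^ 2 / t) +
        ENNReal.ofReal (2 * c1 / la * (c3 * K * la) ^ 2) * ENNReal.ofReal ((t / L) ^ (2 * δ) / t) +
        q3 * ∑ p ∈ J, ENNReal.ofReal (|cvl ψ t (b p) y| / t)) := setLIntegral_mono' (hΩm t) hpt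
      _ = q1 * (∫⁻ y in Ω t, ENNReal.ofReal ((cvl ψ t g y) ^ 2 / t)) +
        ENNReal.ofReal (2 * c1 / la * (c3 * K * la) ^ 2) * ENNReal.ofReal ((t / L) ^ (2 * δ) / t) *
          volume (Ω t) +
        q3 * ∑ p ∈ J, ∫⁻ y in Ω t, ENNReal.ofReal (|cvl ψ t (b p) y| / t) := by
          rw [lintegral_add_left (by fun_prop), lintegral_add_left (by fun_prop),
            lintegral_const_mul _ mg, setLIntegral_const, lintegral_const_mul' _ _
            ENNReal.ofReal_ne_top, lintegral_finsetSum _ mb]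
      _ ≤ _ := by
          have e1 : volume (Ω t) ≤ ENNReal.ofReal (L ^ n) := by
            rw [← volume_Qc a hL.le]; exact measure_mono fun y hy => hy.1
          refine add_le_add (add_le_add ?_ ?_) ?_
          · exact mul_le_mul_right (setLIntegral_le_lintegral _ _) _
          · rw [hq2, ENNReal.ofReal_mul (q := L ^ n) (by positivity), mul_right_comm]
            gcongr
          · refine mul_le_mul_right (Finset.sum_le_sum fun p hp => ?_) _
            exact lintegral_mono_set (hΩV t ht p hp)
  have m1 : AEMeasurable A1 (volume.restrict (Ioc (L / 2 ^ m) L)) :=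
    ae_slice1 hψm gi.1 measurableSet_Ioc hI0
  have m3 : ∀ p ∈ J, AEMeasurable (A3 p) (volume.restrict (Ioc (L / 2 ^ m) L)) := fun p hp =>
    ae_slice2 hψm (hb p hp).1.1 measurableSet_Ioc hI0 _ (N3_meas a hL _ _).compl
  have i1 : ∫⁻ t in Ioc (L / 2 ^ m) L, A1 t ≤ ENNReal.ofReal (CL *
      ((2 ^ n * (2 * 3 ^ n * K * la)) ^ 2 * (3 ^ n * L ^ n))) := by
    refine (lintegral_mono_set hI0).trans ((hL2 g _ gi gM).trans ?_)
    rw [ENNReal.ofReal_mul hCL]; gcongr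
  have i2 : ∫⁻ t in Ioc (L / 2 ^ m) L, ENNReal.ofReal ((t / L) ^ (2 * δ) / t) ≤
      ENNReal.ofReal (1 / (2 * δ)) := by
    rw [← lint_pow_small (by positivity : 0 < 2 * δ) hL]
    exact lintegral_mono_set fun t ht => ⟨hI0 ht, ht.2⟩
  have i3 : ∑ p ∈ J, ∫⁻ t in Ioc (L / 2 ^ m) L, A3 p t ≤
      ENNReal.ofReal (CT * (2 * K * (la * L ^ n))) := by
    rw [ENNReal.ofReal_mul hCT]
    refine le_trans ?_ (mul_le_mul_right hbs _)
    rw [Finset.mul_sum]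
    refine Finset.sum_le_sum fun p hp => (lintegral_mono_set hI0).trans ?_
    refine hAt (b p) (cb a L p.1 p.2) _ (crn a L p.1 p.2) (L / 2 ^ p.1) (hb p hp).1 (hb p hp).2.1
      (by positivity) (hb p hp).2.2 (cb_subset_closedBall a hL _ _) (N3_meas a hL _ _).compl ?_
    intro y hy z hz
    have hz' : ix a L p.1 z = p.2 := hz
    exact far_dist a hL (by rw [hz']; exact hy)
  calc ∫⁻ t in Ioc (L / 2 ^ m) L, ∫⁻ y in Ω t, Dd ψ ω f t y
      ≤ ∫⁻ t in Ioc (L / 2 ^ m) L, (q1 * A1 t + q2 * ENNReal.ofReal ((t / L) ^ (2 * δ) / t)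
        + q3 * ∑ p ∈ J, A3 p t) := setLIntegral_mono' measurableSet_Ioc hin
    _ = q1 * (∫⁻ t in Ioc (L / 2 ^ m) L, A1 t) +
        q2 * (∫⁻ t in Ioc (L / 2 ^ m) L, ENNReal.ofReal ((t / L) ^ (2 * δ) / t)) +
        q3 * ∑ p ∈ J, ∫⁻ t in Ioc (L / 2 ^ m) L, A3 p t := by
        have mm : Measurable (fun t : ℝ => q2 * ENNReal.ofReal ((t / L) ^ (2 * δ) / t)) := by
          fun_prop
        have mm2 : AEMeasurable (fun t : ℝ => q1 * A1 t + q2 * ENNReal.ofReal ((t / L) ^ (2 * δ) / t))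
            (volume.restrict (Ioc (L / 2 ^ m) L)) := (m1.const_mul _).add mm.aemeasurable
        rw [lintegral_add_left' mm2,
          lintegral_add_left' (m1.const_mul _), lintegral_const_mul' _ _ ENNReal.ofReal_ne_top,
          lintegral_const_mul' _ _ ENNReal.ofReal_ne_top,
          lintegral_const_mul' _ _ ENNReal.ofReal_ne_top, lintegral_finsetSum' _ m3]
    _ ≤ _ := by
        refine (add_le_add (add_le_add (mul_le_mul_right i1 _) (mul_le_mul_right i2 _))
          (mul_le_mul_right i3 _)).trans (le_of_eq ?_)
        rw [hq1, hq2, hq3, ← ENNReal.ofReal_mul (by positivity),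
          ← ENNReal.ofReal_mul (by positivity), ← ENNReal.ofReal_mul (by positivity),
          ← ENNReal.ofReal_add (by positivity) (by positivity),
          ← ENNReal.ofReal_add (by positivity) (by positivity)]
        congr 1
        field_simp
        ring

theorem Dd_slice {ψ ω f : Rn n → ℝ} (hψ : AEStronglyMeasurable ψ volume)
    (hω : AEStronglyMeasurable ω volume) (hf : AEStronglyMeasurable f volume)
    {I : Set ℝ} (hI : MeasurableSet I) (hI0 : I ⊆ Ioi 0) (E : Set (Rn n)) :
    AEMeasurable (fun t => ∫⁻ y in E, Dd ψ ω f t y) (volume.restrict I) := by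
  obtain ⟨G, hG, hGe⟩ := Dd_measurable hψ hω hf
  refine ⟨fun t => ∫⁻ y in E, G (t, y), hG.lintegral_prod_right', ?_⟩
  filter_upwards [ae_restrict_mem hI] with t ht
  exact lintegral_congr fun y => by rw [hGe t (hI0 ht)]

theorem lam_good (hn : 1 ≤ n) {ω : Rn n → ℝ} {CA : ℝ} (h : A1P ω CA) (a : Rn n) {L : ℝ}
    (hL : 0 < L) {E : Set (Rn n)} (hE : MeasurableSet E) (hEQ : E ⊆ Qc a L)
    (hv : volume E ≤ ENNReal.ofReal (L ^ n / 2)) :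
    ENNReal.ofReal (lam ω a L * L ^ n) ≤
      ENNReal.ofReal (2 * (CA * (vB n * (4 * n) ^ n))) * wm ω (Qc a L \ E) := by
  have hn' : (1:ℝ) ≤ n := by exact_mod_cast hn
  have hla := lam_pos hn h a hL
  have hCA := h.one_le
  have hvB := vB_pos (n := n)
  have h1 := h.lower (c := a) (show 0 < 4 * n * L by positivity) ((Qc_meas a L).diff hE)
    (diff_subset.trans ((Qc_subset_N3 a hL).trans (N3_subset_ball hn a hL)))
  have h2 : ENNReal.ofReal (L ^ n / 2) ≤ volume (Qc a L \ E) := by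
    rw [measure_diff hEQ hE.nullMeasurableSet (hv.trans_lt ENNReal.ofReal_lt_top).ne,
      volume_Qc a hL.le]
    refine le_trans ?_ (tsub_le_tsub_left hv _)
    rw [← ENNReal.ofReal_sub _ (by positivity)]
    exact ENNReal.ofReal_le_ofReal (by linarith)
  have hw : wInt ω (ball a (4 * n * L)) = lam ω a L * L ^ n := by rw [lam]; field_simp
  rw [hw] at h1
  have h3 := (mul_le_mul_left h2 _).trans h1
  have hp : 0 < L ^ n / 2 := by positivity
  have h4 : ENNReal.ofReal (L ^ n / 2) * ENNReal.ofReal (lam ω a L * L ^ n) ≤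
      ENNReal.ofReal (L ^ n / 2) *
        (ENNReal.ofReal (2 * (CA * (vB n * (4 * n) ^ n))) * wm ω (Qc a L \ E)) := by
    refine h3.trans (le_of_eq ?_)
    rw [← mul_assoc (ENNReal.ofReal (L ^ n / 2)), ← ENNReal.ofReal_mul hp.le]
    congr 2
    rw [mul_pow (4 * (n:ℝ)) L]
    ring
  exact (ENNReal.mul_le_mul_iff_right (by simpa using hp) ENNReal.ofReal_ne_top).1 h4

theorem carleson (hn : 1 ≤ n) {C₁ C₂ δ γ : ℝ} (hC₁ : 0 < C₁) (hC₂ : 0 < C₂) (hδ : 0 < δ)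
    (hγ : 0 < γ) {ψ : Rn n → ℝ} (hψ : PsiKernel n C₁ C₂ δ γ ψ) {ω : Rn n → ℝ} {CA : ℝ}
    (h : A1P ω CA) :
    ∃ C : ℝ, 0 ≤ C ∧ ∀ (f : Rn n → ℝ) (K : ℝ), BM ω f K → ∀ (a : Rn n) (L : ℝ), 0 < L →
      ∫⁻ t in Ioc 0 L, ∫⁻ y in Qc a L, Dd ψ ω f t y ≤
        ENNReal.ofReal (C * K ^ 2) * wm ω (Qc a L) := by
  classical
  have hCA := h.one_le
  have hvB := vB_pos (n := n)
  obtain ⟨C0, hC0, hstep⟩ := one_step hn hC₁ hC₂ hδ hγ hψ h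
  refine ⟨C0 * (2 * (CA * (vB n * (4 * n) ^ n))), by positivity, ?_⟩
  intro f K hf
  have hK := hf.pos
  have hωm := h.loc.aestronglyMeasurable
  set C' := C0 * (2 * (CA * (vB n * (4 * n) ^ n))) with hC'
  have hC'0 : 0 ≤ C' := by positivity
  have key : ∀ m : ℕ, ∀ (a : Rn n) (L : ℝ), 0 < L →
      ∫⁻ t in Ioc (L / 2 ^ m) L, ∫⁻ y in Qc a L, Dd ψ ω f t y ≤
        ENNReal.ofReal (C' * K ^ 2) * wm ω (Qc a L) := by
    intro m
    induction m using Nat.strong_induction_on with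
    | _ m ih =>
    intro a L hL
    obtain ⟨P, p1, p2, p3, p4⟩ := hstep f K hf a L hL m
    have hI0 : Ioc (L / 2 ^ m) L ⊆ Ioi 0 := fun t ht => lt_trans (by positivity) ht.1
    set E := ⋃ p ∈ P, cb a L p.1 p.2 with hE
    have hEm : MeasurableSet E := Finset.measurableSet_biUnion _ fun p _ => cb_meas a hL _ _
    have hEQ : E ⊆ Qc a L := iUnion₂_subset fun p hp => (p1 p hp).2.2
    set Ω : ℝ → Set (Rn n) := fun t =>
      {y | y ∈ Qc a L ∧ ¬ ∃ p ∈ P, y ∈ cb a L p.1 p.2 ∧ t ≤ L / 2 ^ p.1} with hΩ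
    set T : ℕ × (Fin n → ℤ) → ℝ → ℝ≥0∞ := fun p =>
      (Iic (L / 2 ^ p.1)).indicator fun t => ∫⁻ y in cb a L p.1 p.2, Dd ψ ω f t y with hT
    have hpw : ∀ p ∈ P, ∀ q ∈ P, p ≠ q → Disjoint (cb a L p.1 p.2) (cb a L q.1 q.2) := by
      intro p hp q hq hpq
      rw [Set.disjoint_left]
      intro x hx hx'
      exact hpq (p2 p hp q hq x hx hx')
    have hpt : ∀ t, ∫⁻ y in Qc a L, Dd ψ ω f t y ≤
        (∫⁻ y in Ω t, Dd ψ ω f t y) + ∑ p ∈ P, T p t := by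
      intro t
      set P' := P.filter fun p => t ≤ L / 2 ^ p.1 with hP'
      have hsub : Qc a L ⊆ Ω t ∪ ⋃ p ∈ P', cb a L p.1 p.2 := by
        intro y hy
        by_cases hc : ∃ p ∈ P, y ∈ cb a L p.1 p.2 ∧ t ≤ L / 2 ^ p.1
        · obtain ⟨p, hp, hyp, htp⟩ := hc
          right
          exact mem_biUnion (Finset.mem_coe.2 (Finset.mem_filter.2 ⟨hp, htp⟩)) hyp
        · exact Or.inl ⟨hy, hc⟩
      refine (lintegral_mono_set hsub).trans ((lintegral_union_le _ _ _).trans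
        (add_le_add le_rfl ?_))
      rw [lintegral_biUnion_finset]
      · rw [hP', Finset.sum_filter]
        refine Finset.sum_le_sum fun p _ => le_of_eq ?_
        simp only [hT, indicator_apply, mem_Iic]
      · intro p hp q hq hpq
        exact hpw p (Finset.mem_filter.1 hp).1 q (Finset.mem_filter.1 hq).1 hpq
      · intro p _; exact cb_meas a hL _ _
    have hTm : ∀ p ∈ P, AEMeasurable (T p) (volume.restrict (Ioc (L / 2 ^ m) L)) := fun p _ =>
      (Dd_slice hψ.1.1 hωm hf.ae_meas measurableSet_Ioc hI0 _).indicator measurableSet_Iic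
    have hTi : ∀ p ∈ P, ∫⁻ t in Ioc (L / 2 ^ m) L, T p t ≤
        ENNReal.ofReal (C' * K ^ 2) * wm ω (cb a L p.1 p.2) := by
      intro p hp
      obtain ⟨q1, q2, -⟩ := p1 p hp
      have := ih (m - p.1) (by omega) (crn a L p.1 p.2) (L / 2 ^ p.1) (by positivity)
      rw [← cb_eq a hL] at this
      refine le_trans ?_ this
      simp only [hT]
      rw [lintegral_indicator measurableSet_Iic, Measure.restrict_restrict measurableSet_Iic]
      refine lintegral_mono_set ?_
      intro t ht
      have e : L / 2 ^ p.1 / 2 ^ (m - p.1) = L / 2 ^ m := by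
        rw [div_div, ← pow_add]; congr 2; omega
      rw [e]
      exact ⟨ht.2.1, ht.1⟩
    calc ∫⁻ t in Ioc (L / 2 ^ m) L, ∫⁻ y in Qc a L, Dd ψ ω f t y
        ≤ ∫⁻ t in Ioc (L / 2 ^ m) L, ((∫⁻ y in Ω t, Dd ψ ω f t y) + ∑ p ∈ P, T p t) :=
          lintegral_mono hpt
      _ = (∫⁻ t in Ioc (L / 2 ^ m) L, ∫⁻ y in Ω t, Dd ψ ω f t y) +
            ∑ p ∈ P, ∫⁻ t in Ioc (L / 2 ^ m) L, T p t := by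
          rw [lintegral_add_right' _ (Finset.aemeasurable_fun_sum _ hTm),
            lintegral_finsetSum' _ hTm]
      _ ≤ ENNReal.ofReal (C' * K ^ 2) * wm ω (Qc a L \ E) +
            ENNReal.ofReal (C' * K ^ 2) * wm ω E := by
          refine add_le_add (p4.trans ?_) ?_
          · rw [ENNReal.ofReal_mul (by positivity)]
            refine (mul_le_mul_right (lam_good hn h a hL hEm hEQ p3) _).trans (le_of_eq ?_)
            rw [← mul_assoc, ← ENNReal.ofReal_mul (by positivity)]
            congr 2
            rw [hC']; ring
          · rw [hE, measure_biUnion_finset (fun p hp q hq hpq => hpw p hp q hq hpq)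
              (fun p _ => cb_meas a hL _ _), Finset.mul_sum]
            exact Finset.sum_le_sum hTi
      _ = _ := by
          rw [← mul_add, add_comm, measure_add_diff hEm.nullMeasurableSet, union_eq_right.2 hEQ]
  intro a L hL
  have hU : Ioc 0 L = ⋃ m : ℕ, Ioc (L / 2 ^ m) L := by
    ext t
    simp only [mem_Ioc, mem_iUnion]
    constructor
    · rintro ⟨h0, h1⟩
      obtain ⟨m, hm⟩ := pow_unbounded_of_one_lt (L / t) (one_lt_two)
      refine ⟨m, ?_, h1⟩
      rw [div_lt_iff₀ h0] at hm
      rw [div_lt_iff₀ (by positivity)]; linarith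
    · rintro ⟨m, h0, h1⟩
      exact ⟨lt_trans (by positivity) h0, h1⟩
  have hmono : Monotone fun m : ℕ => Ioc (L / 2 ^ m) L := by
    intro m m' hm
    refine Ioc_subset_Ioc_left ?_
    gcongr
    norm_num
  set F : ℝ → ℝ≥0∞ := fun t => ∫⁻ y in Qc a L, Dd ψ ω f t y with hF
  have e := hmono.measure_iUnion (μ := volume.withDensity F)
  rw [← withDensity_apply F measurableSet_Ioc, hU, e]
  refine iSup_le fun m => ?_
  rw [withDensity_apply F measurableSet_Ioc]
  exact key m a L hL

/-- Truncated square of the area integral. -/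
def Sq (ψ f : Rn n → ℝ) (I : Set ℝ) (x : Rn n) : ℝ≥0∞ :=
  ∫⁻ t in I, ∫⁻ y in ball x t, ENNReal.ofReal ((cvl ψ t f y) ^ 2 / t ^ (n + 1))

theorem Sfun_eq (ψ f : Rn n → ℝ) (x : Rn n) : Sfun ψ f x = (Sq ψ f (Ioi 0) x) ^ (1/2 : ℝ) := by
  simp only [Sfun, Sdil, Sq, one_mul]

theorem Sq_joint {ψ f : Rn n → ℝ} (hψ : AEStronglyMeasurable ψ volume)
    (hf : AEStronglyMeasurable f volume) {I : Set ℝ} (hI : MeasurableSet I) (hI0 : I ⊆ Ioi 0) :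
    ∃ H : ℝ × Rn n → ℝ≥0∞, Measurable H ∧
      (∀ t, 0 < t → ∀ y, ENNReal.ofReal ((cvl ψ t f y) ^ 2 / t ^ (n + 1)) = H (t, y)) ∧
      ∀ x, Sq ψ f I x = ∫⁻ t in I, ∫⁻ y, {q : Rn n × ℝ × Rn n | dist q.2.2 q.1 < q.2.1}.indicator
        (fun q => H q.2) (x, t, y) := by
  obtain ⟨G, hG, hGe⟩ := cvl_measurable hψ hf
  refine ⟨fun q => ENNReal.ofReal ((G q) ^ 2 / q.1 ^ (n + 1)), by fun_prop, ?_, ?_⟩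
  · intro t ht y; rw [hGe t ht]
  · intro x
    refine setLIntegral_congr_fun hI fun t ht => ?_
    simp only
    rw [← lintegral_indicator measurableSet_ball]
    refine lintegral_congr fun y => ?_
    by_cases hy : y ∈ ball x t
    · rw [indicator_of_mem hy, indicator_of_mem (by exact hy), hGe t (hI0 ht)]
    · rw [indicator_of_notMem hy, indicator_of_notMem (by exact hy)]

theorem dist_set_meas : MeasurableSet {q : Rn n × ℝ × Rn n | dist q.2.2 q.1 < q.2.1} :=
  measurableSet_lt (by fun_prop) (by fun_prop)

theorem Sq_measurable {ψ f : Rn n → ℝ} (hψ : AEStronglyMeasurable ψ volume)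
    (hf : AEStronglyMeasurable f volume) {I : Set ℝ} (hI : MeasurableSet I) (hI0 : I ⊆ Ioi 0) :
    Measurable (Sq ψ f I) := by
  obtain ⟨H, hH, -, hS⟩ := Sq_joint hψ hf hI hI0
  rw [show Sq ψ f I = _ from funext hS]
  have m1 : Measurable ({q : Rn n × ℝ × Rn n | dist q.2.2 q.1 < q.2.1}.indicator
      (fun q => H q.2)) := (hH.comp measurable_snd).indicator dist_set_meas
  have m2 : Measurable (fun p : (Rn n × ℝ) × Rn n =>
      {q : Rn n × ℝ × Rn n | dist q.2.2 q.1 < q.2.1}.indicator (fun q => H q.2)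
        (p.1.1, p.1.2, p.2)) := m1.comp (by fun_prop)
  exact (m2.lintegral_prod_right').lintegral_prod_right'

theorem sqrt_young (A s : ℝ≥0∞) (h0 : s ≠ 0) (hT : s ≠ ∞) : A ^ (1/2 : ℝ) ≤ A * s⁻¹ + s := by
  set B := A ^ (1/2 : ℝ) with hB
  have hAB : A = B * B := by
    rw [hB, ← ENNReal.rpow_add_of_nonneg _ _ (by norm_num) (by norm_num)]; norm_num
  rcases le_total B s with h | h
  · exact h.trans le_add_self
  · refine le_trans ?_ le_self_add
    calc B = B * (s * s⁻¹) := by rw [ENNReal.mul_inv_cancel h0 hT, mul_one]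
      _ ≤ B * (B * s⁻¹) := by gcongr
      _ = _ := by rw [hAB]; ring

theorem local_tonelli {ψ f : Rn n → ℝ} (hψ : AEStronglyMeasurable ψ volume)
    (hf : AEStronglyMeasurable f volume) {I : Set ℝ} (hI : MeasurableSet I) (hI0 : I ⊆ Ioi 0)
    (B : Set (Rn n)) {v : Rn n → ℝ≥0∞} (hv : AEMeasurable v volume) :
    ∫⁻ x in B, Sq ψ f I x * v x = ∫⁻ t in I, ∫⁻ y,
      ENNReal.ofReal ((cvl ψ t f y) ^ 2 / t ^ (n + 1)) * ∫⁻ x in B ∩ ball y t, v x := by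
  obtain ⟨H, hH, hHe, hS⟩ := Sq_joint hψ hf hI hI0
  set v' := hv.mk v with hv'
  have hv'm : Measurable v' := hv.measurable_mk
  have hve : v =ᵐ[volume] v' := hv.ae_eq_mk
  set Φ : Rn n × ℝ × Rn n → ℝ≥0∞ := fun q =>
    {q : Rn n × ℝ × Rn n | dist q.2.2 q.1 < q.2.1}.indicator (fun q => H q.2) q * v' q.1 with hΦ
  have m1 : Measurable Φ :=
    ((hH.comp measurable_snd).indicator dist_set_meas).mul (hv'm.comp measurable_fst)
  calc ∫⁻ x in B, Sq ψ f I x * v x = ∫⁻ x in B, ∫⁻ t in I, ∫⁻ y, Φ (x, t, y) := by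
        refine lintegral_congr_ae ?_
        filter_upwards [ae_restrict_of_ae hve] with x hx
        have m2 : Measurable (fun p : ℝ × Rn n =>
            {q : Rn n × ℝ × Rn n | dist q.2.2 q.1 < q.2.1}.indicator (fun q => H q.2)
              (x, p.1, p.2)) :=
          ((hH.comp measurable_snd).indicator dist_set_meas).comp (by fun_prop)
        rw [hS, hx, ← lintegral_mul_const _ m2.lintegral_prod_right']
        refine lintegral_congr fun t => ?_
        exact (lintegral_mul_const _ (m2.comp (measurable_prodMk_left (x := t)))).symm
    _ = ∫⁻ t in I, ∫⁻ x in B, ∫⁻ y, Φ (x, t, y) := by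
        rw [lintegral_lintegral_swap]
        have m2 : Measurable (fun p : (Rn n × ℝ) × Rn n => Φ (p.1.1, p.1.2, p.2)) :=
          m1.comp (by fun_prop)
        exact (m2.lintegral_prod_right').aemeasurable
    _ = ∫⁻ t in I, ∫⁻ y, ∫⁻ x in B, Φ (x, t, y) := by
        refine lintegral_congr fun t => ?_
        rw [lintegral_lintegral_swap]
        have m2 : Measurable (fun p : Rn n × Rn n => Φ (p.1, t, p.2)) := m1.comp (by fun_prop)
        exact m2.aemeasurable
    _ = _ := by
        refine setLIntegral_congr_fun hI fun t ht => ?_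
        refine lintegral_congr fun y => ?_
        rw [hHe t (hI0 ht) y, lintegral_congr_ae (ae_restrict_of_ae hve),
          ← lintegral_const_mul _ hv'm, inter_comm, ← Measure.restrict_restrict measurableSet_ball,
          ← lintegral_indicator measurableSet_ball]
        refine lintegral_congr fun x => ?_
        simp only [hΦ]
        by_cases hx : x ∈ ball y t
        · have hx' : dist y x < t := by rw [dist_comm]; exact hx
          rw [indicator_of_mem hx, indicator_of_mem (by exact hx')]
        · have hx' : ¬ dist y x < t := by rw [dist_comm]; exact hx
          rw [indicator_of_notMem hx, indicator_of_notMem (by exact hx'), zero_mul]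

theorem A1P.ae_pos {ω : Rn n → ℝ} {CA : ℝ} (h : A1P ω CA) (c : Rn n) {r : ℝ} (hr : 0 < r) :
    ∀ᵐ x ∂(volume.restrict (ball c r)), 0 < ω x := by
  filter_upwards [h.ae c r hr] with x hx
  have h1 := h.pos c r hr
  have h2 := vB_pos (n := n)
  have h3 := h.one_le
  by_contra hcon
  have h4 : ω x ≤ 0 := not_lt.1 hcon
  have : CA * (vB n * r ^ n) * ω x ≤ 0 := mul_nonpos_of_nonneg_of_nonpos (by positivity) h4
  linarith

theorem inner_bound {ψ ω f : Rn n → ℝ} {CA K : ℝ} (h : A1P ω CA) (hK : 0 < K)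
    {t : ℝ} (ht : 0 < t) (y : Rn n) (B : Set (Rn n)) :
    ENNReal.ofReal ((cvl ψ t f y) ^ 2 / t ^ (n + 1)) *
      (∫⁻ x in B ∩ ball y t, (ENNReal.ofReal (K * ω x))⁻¹) ≤
      ENNReal.ofReal (CA * vB n ^ 2 / K) * Dd ψ ω f t y := by
  have hv := vB_pos (n := n)
  have hCA := h.one_le
  have hW := h.pos y t ht
  have e1 : ∫⁻ x in B ∩ ball y t, (ENNReal.ofReal (K * ω x))⁻¹ ≤
      ENNReal.ofReal (CA * (vB n * t ^ n) / (K * wInt ω (ball y t)) * (vB n * t ^ n)) := by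
    refine (lintegral_mono_set inter_subset_right).trans ?_
    rw [ENNReal.ofReal_mul (by positivity), ← volume_ball_eq y ht, ← setLIntegral_const]
    refine lintegral_mono_ae ?_
    filter_upwards [h.ae y t ht, h.ae_pos y ht] with x hx hpos
    rw [← ENNReal.ofReal_inv_of_pos (by positivity)]
    apply ENNReal.ofReal_le_ofReal
    rw [inv_eq_one_div, div_le_div_iff₀ (by positivity) (by positivity)]
    nlinarith
  refine (mul_le_mul_right e1 _).trans (le_of_eq ?_)
  rw [Dd, ← ENNReal.ofReal_mul (by positivity), ← ENNReal.ofReal_mul (by positivity)]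
  congr 1
  field_simp; ring

theorem local_est (hn : 1 ≤ n) {C₁ C₂ δ γ : ℝ} (hC₁ : 0 < C₁) (hC₂ : 0 < C₂) (hδ : 0 < δ)
    (hγ : 0 < γ) {ψ : Rn n → ℝ} (hψ : PsiKernel n C₁ C₂ δ γ ψ) {ω : Rn n → ℝ} {CA : ℝ}
    (h : A1P ω CA) :
    ∃ C : ℝ, 0 ≤ C ∧ ∀ (f : Rn n → ℝ) (K : ℝ), BM ω f K → ∀ (c : Rn n) (r : ℝ), 0 < r →
      ∫⁻ x in ball c r, (Sq ψ f (Ioc 0 (2 * r)) x) ^ (1/2 : ℝ) ≤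
        ENNReal.ofReal (C * K * wInt ω (ball c r)) := by
  obtain ⟨CC, hCC, hcar⟩ := carleson hn hC₁ hC₂ hδ hγ hψ h
  have hn' : (1:ℝ) ≤ n := by exact_mod_cast hn
  have hv := vB_pos (n := n)
  have hCA := h.one_le
  refine ⟨CA * vB n ^ 2 * CC * (CA * (5 * n) ^ n) + 1, by positivity, ?_⟩
  intro f K hf c r hr
  have hK := hf.pos
  have hW := h.pos c r hr
  have hωm := h.loc.aestronglyMeasurable
  have hI0 : Ioc 0 (2 * r) ⊆ Ioi (0:ℝ) := fun t ht => ht.1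
  set v : Rn n → ℝ≥0∞ := fun x => (ENNReal.ofReal (K * ω x))⁻¹ with hvd
  have hKm : AEMeasurable (fun x => ENNReal.ofReal (K * ω x)) volume :=
    (hωm.aemeasurable.const_mul K).ennreal_ofReal
  have hvm : AEMeasurable v volume := hKm.inv
  set a : Rn n := WithLp.toLp 2 (fun i => c i - 4 * r) with ha
  have ha' : ∀ i, a i = c i - 4 * r := fun i => rfl
  have hsub1 : ball c (3 * r) ⊆ Qc a (8 * r) := by
    intro y hy i
    rw [mem_ball, dist_eq_norm] at hy
    have := (coord_le_norm (y - c) i).trans hy.le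
    rw [PiLp.sub_apply, abs_le] at this
    rw [ha']
    constructor <;> linarith
  have hsub2 : Qc a (8 * r) ⊆ ball c (5 * n * r) := by
    intro y hy
    rw [mem_ball, dist_eq_norm]
    have : ‖y - c‖ ≤ n * (4 * r) := by
      refine norm_le_of_coord (by positivity) fun i => ?_
      have := hy i
      rw [ha'] at this
      rw [PiLp.sub_apply, abs_le]
      constructor <;> linarith
    nlinarith
  have hwQ : wm ω (Qc a (8 * r)) ≤ ENNReal.ofReal (CA * (5 * n) ^ n * wInt ω (ball c r)) := by
    refine (measure_mono hsub2).trans ?_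
    rw [wm_ball h]
    apply ENNReal.ofReal_le_ofReal
    have := h.dbl (c := c) (c' := c) hr (show 0 < 5 * n * r by positivity)
      (ball_subset_ball (by nlinarith))
    rwa [mul_div_assoc, div_self hr.ne', mul_one] at this
  have e1 : ∫⁻ x in ball c r, Sq ψ f (Ioc 0 (2 * r)) x * v x ≤
      ENNReal.ofReal (CA * vB n ^ 2 * CC * (CA * (5 * n) ^ n) * K * wInt ω (ball c r)) := by
    rw [local_tonelli hψ.1.1 hf.ae_meas measurableSet_Ioc hI0 _ hvm]
    have e2 : ∀ t ∈ Ioc 0 (2 * r), ∫⁻ y, ENNReal.ofReal ((cvl ψ t f y) ^ 2 / t ^ (n + 1)) *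
        (∫⁻ x in ball c r ∩ ball y t, v x) ≤
        ENNReal.ofReal (CA * vB n ^ 2 / K) * ∫⁻ y in Qc a (8 * r), Dd ψ ω f t y := by
      intro t ht
      rw [← lintegral_const_mul' _ _ ENNReal.ofReal_ne_top, ← lintegral_indicator (Qc_meas _ _)]
      refine lintegral_mono fun y => ?_
      by_cases hy : y ∈ Qc a (8 * r)
      · rw [indicator_of_mem hy]
        exact inner_bound h hK ht.1 y _
      · rw [indicator_of_notMem hy]
        have : ball c r ∩ ball y t = ∅ := by
          rw [eq_empty_iff_forall_notMem]
          rintro x ⟨hx1, hx2⟩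
          apply hy
          apply hsub1
          rw [mem_ball] at hx1 hx2 ⊢
          have := dist_triangle_left y c x
          have := ht.2
          linarith
        rw [this]; simp
    refine (setLIntegral_mono' measurableSet_Ioc e2).trans ?_
    rw [lintegral_const_mul' _ _ ENNReal.ofReal_ne_top]
    have e3 : ∫⁻ t in Ioc 0 (2 * r), ∫⁻ y in Qc a (8 * r), Dd ψ ω f t y ≤
        ENNReal.ofReal (CC * K ^ 2) * ENNReal.ofReal (CA * (5 * n) ^ n * wInt ω (ball c r)) := by
      refine (lintegral_mono_set (Ioc_subset_Ioc_right (by linarith))).trans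
        ((hcar f K hf a (8 * r) (by positivity)).trans ?_)
      gcongr
    refine (mul_le_mul_right e3 _).trans (le_of_eq ?_)
    rw [← ENNReal.ofReal_mul (by positivity), ← ENNReal.ofReal_mul (by positivity)]
    congr 1
    field_simp
  calc ∫⁻ x in ball c r, (Sq ψ f (Ioc 0 (2 * r)) x) ^ (1/2 : ℝ)
      ≤ ∫⁻ x in ball c r, (Sq ψ f (Ioc 0 (2 * r)) x * v x + ENNReal.ofReal (K * ω x)) := by
        refine lintegral_mono_ae ?_
        filter_upwards [h.ae_pos c hr] with x hx
        have : 0 < K * ω x := by positivity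
        exact sqrt_young _ _ (by simpa using this) ENNReal.ofReal_ne_top
    _ = (∫⁻ x in ball c r, Sq ψ f (Ioc 0 (2 * r)) x * v x) +
          ∫⁻ x in ball c r, ENNReal.ofReal (K * ω x) := by
        rw [lintegral_add_right' _ hKm.restrict]
    _ ≤ ENNReal.ofReal (CA * vB n ^ 2 * CC * (CA * (5 * n) ^ n) * K * wInt ω (ball c r)) +
          ENNReal.ofReal (K * wInt ω (ball c r)) := by
        refine add_le_add e1 (le_of_eq ?_)
        rw [ENNReal.ofReal_mul hK.le, ← wm_ball h, wm_apply _ measurableSet_ball,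
          ← lintegral_const_mul' _ _ ENNReal.ofReal_ne_top]
        exact lintegral_congr fun x => ENNReal.ofReal_mul hK.le
    _ = _ := by
        rw [← ENNReal.ofReal_add (by positivity) (by positivity)]
        congr 1; ring

theorem large_est (hn : 1 ≤ n) {C₁ C₂ δ γ : ℝ} (hC₁ : 0 < C₁) (hδ : 0 < δ)
    {ψ : Rn n → ℝ} (hψ : PsiKernel n C₁ C₂ δ γ ψ) {ω : Rn n → ℝ} {CA : ℝ}
    (h : A1P ω CA) :
    ∃ C : ℝ, 0 ≤ C ∧ ∀ (f : Rn n → ℝ) (K : ℝ), BM ω f K → ∀ (c : Rn n) (r : ℝ), 0 < r →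
      ∀ x ∈ ball c r, ∀ x' ∈ ball c r,
        Sq ψ f (Ioi (2 * r)) x ≤ Sq ψ f (Ioi (2 * r)) x' +
          ENNReal.ofReal ((C * K * (wInt ω (ball c r) / r ^ n)) ^ 2) := by
  have hn' : (1:ℝ) ≤ n := by exact_mod_cast hn
  have hv := vB_pos (n := n)
  have hCA := h.one_le
  have hT := tailC_nonneg (n := n) (δ := δ) hCA
  refine ⟨C₁ * tailC n CA δ * (CA * 2 ^ n) * Real.sqrt (vB n * n), by positivity, ?_⟩
  intro f K hf c r hr x hx x' hx'
  have hK := hf.pos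
  have hW := h.pos c r hr
  set D := C₁ * tailC n CA δ * K * (CA * 2 ^ n * (wInt ω (ball c r) / r ^ n)) with hD
  have hD0 : 0 ≤ D := by positivity
  rw [mem_ball] at hx hx'
  have hxx : dist x x' < 2 * r := by
    have := dist_triangle_right x x' c
    linarith
  have hcv : ∀ t ∈ Ioi (2 * r), ∀ y ∈ ball x t, |cvl ψ t f y| ≤ D := by
    intro t ht y hy
    have ht' : 2 * r < t := ht
    have ht0 : 0 < t := by linarith
    refine (cvl_bound hC₁ hδ hψ h hf ht0 y).trans ?_
    refine mul_le_mul_of_nonneg_left ?_ (by positivity)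
    have hsub : ball c r ⊆ ball y (2 * t) := by
      refine ball_subset_ball' ?_
      rw [mem_ball] at hy
      have := dist_triangle_left c y x
      rw [dist_comm] at hy
      linarith
    have h1 := (h.mono (ball_subset_ball (show t ≤ 2 * t by linarith) : ball y t ⊆ ball y (2 * t))).trans
      (h.dbl hr (by positivity) hsub)
    rw [div_le_iff₀ (by positivity)]
    refine h1.trans (le_of_eq ?_)
    rw [div_pow, mul_pow]
    field_simp
  have hin : ∀ t ∈ Ioi (2 * r), ∫⁻ y in ball x t, ENNReal.ofReal ((cvl ψ t f y) ^ 2 / t ^ (n + 1)) ≤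
      (∫⁻ y in ball x' t, ENNReal.ofReal ((cvl ψ t f y) ^ 2 / t ^ (n + 1))) +
        ENNReal.ofReal (D ^ 2 * (vB n * n)) * ENNReal.ofReal ((2 * r / t) ^ (1:ℝ) / t) := by
    intro t ht
    have ht' : 2 * r < t := ht
    have ht0 : 0 < t := by linarith
    have hsub : ball x t ⊆ ball x' t ∪ (ball x t \ ball x (t - 2 * r)) := by
      intro y hy
      by_cases hyy : y ∈ ball x (t - 2 * r)
      · left
        rw [mem_ball] at hyy ⊢
        have := dist_triangle y x x'
        linarith
      · exact Or.inr ⟨hy, hyy⟩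
    refine (lintegral_mono_set hsub).trans ((lintegral_union_le _ _ _).trans (add_le_add le_rfl ?_))
    have hm : volume (ball x t \ ball x (t - 2 * r)) ≤ ENNReal.ofReal (vB n * (n * (2 * r / t) * t ^ n)) := by
      rw [measure_sdiff (ball_subset_ball (by linarith)) measurableSet_ball.nullMeasurableSet
        measure_ball_lt_top.ne, volume_ball_eq x ht0, volume_ball_eq x (by linarith),
        ← ENNReal.ofReal_sub _ (by have : 0 < t - 2 * r := by linarith
                                   positivity)]
      apply ENNReal.ofReal_le_ofReal
      have hb := one_add_mul_le_pow (a := -(2 * r / t)) (by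
        have : 2 * r / t < 1 := by rw [div_lt_one ht0]; exact ht'
        linarith) n
      have e : (t - 2 * r) ^ n = (1 + -(2 * r / t)) ^ n * t ^ n := by
        rw [← mul_pow]; congr 1; field_simp; ring
      rw [e, ← mul_sub]
      refine mul_le_mul_of_nonneg_left ?_ hv.le
      have : 0 < t ^ n := by positivity
      nlinarith
    calc ∫⁻ y in ball x t \ ball x (t - 2 * r), ENNReal.ofReal ((cvl ψ t f y) ^ 2 / t ^ (n + 1))
        ≤ ∫⁻ y in ball x t \ ball x (t - 2 * r), ENNReal.ofReal (D ^ 2 / t ^ (n + 1)) := by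
          refine setLIntegral_mono' (measurableSet_ball.diff measurableSet_ball) fun y hy => ?_
          apply ENNReal.ofReal_le_ofReal
          rw [← sq_abs]
          have := hcv t ht y hy.1
          gcongr
      _ ≤ ENNReal.ofReal (D ^ 2 / t ^ (n + 1)) * ENNReal.ofReal (vB n * (n * (2 * r / t) * t ^ n)) := by
          rw [setLIntegral_const]; gcongr
      _ = _ := by
          rw [← ENNReal.ofReal_mul (by positivity), ← ENNReal.ofReal_mul (by positivity),
            Real.rpow_one]
          congr 1
          field_simp; ring
  unfold Sq
  refine (setLIntegral_mono' measurableSet_Ioi hin).trans ?_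
  rw [lintegral_add_right _ (by fun_prop), lintegral_const_mul' _ _ ENNReal.ofReal_ne_top,
    lint_pow_large one_pos (by positivity), ← ENNReal.ofReal_mul (by positivity)]
  refine add_le_add le_rfl (le_of_eq ?_)
  congr 1
  have hs : Real.sqrt (vB n * n) ^ 2 = vB n * n := Real.sq_sqrt (by positivity)
  calc D ^ 2 * (vB n * n) * (1 / 1) = D ^ 2 * Real.sqrt (vB n * n) ^ 2 := by rw [hs]; ring
    _ = _ := by rw [hD]; ring

theorem Sq_split (ψ f : Rn n → ℝ) {a : ℝ} (ha : 0 < a) (x : Rn n) :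
    Sq ψ f (Ioi 0) x = Sq ψ f (Ioc 0 a) x + Sq ψ f (Ioi a) x := by
  unfold Sq
  rw [← lintegral_union measurableSet_Ioi, Ioc_union_Ioi_eq_Ioi ha.le]
  rw [Set.disjoint_left]
  intro t ht ht'
  exact absurd ht.2 (not_le.2 ht')

theorem Sfun_compare {ψ f : Rn n → ℝ} {a E : ℝ} (ha : 0 < a) (hE : 0 ≤ E) {x x' : Rn n}
    (h : Sq ψ f (Ioi a) x ≤ Sq ψ f (Ioi a) x' + ENNReal.ofReal (E ^ 2)) :
    Sfun ψ f x ≤ (Sq ψ f (Ioc 0 a) x) ^ (1/2 : ℝ) + Sfun ψ f x' + ENNReal.ofReal E := by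
  have e1 : ENNReal.ofReal E = (ENNReal.ofReal (E ^ 2)) ^ (1/2 : ℝ) := by
    rw [ENNReal.ofReal_rpow_of_nonneg (by positivity) (by norm_num), ← Real.sqrt_eq_rpow,
      Real.sqrt_sq hE]
  rw [Sfun_eq, Sfun_eq, e1]
  have hle : Sq ψ f (Ioi a) x' ≤ Sq ψ f (Ioi 0) x' := by
    rw [Sq_split ψ f ha x']; exact le_add_self
  rw [Sq_split ψ f ha x]
  have hr := fun u v : ℝ≥0∞ => ENNReal.rpow_add_le_add_rpow u v (p := (1/2 : ℝ))
    (by norm_num) (by norm_num)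
  calc _ ≤ _ := hr _ _
    _ ≤ (Sq ψ f (Ioc 0 a) x) ^ (1/2 : ℝ) +
        (Sq ψ f (Ioi 0) x' + ENNReal.ofReal (E ^ 2)) ^ (1/2 : ℝ) := by
      gcongr
      exact h.trans (by gcongr)
    _ ≤ _ := by
      rw [add_assoc]
      gcongr
      exact hr _ _

theorem conclusion (hn : 1 ≤ n) {C₁ C₂ δ γ : ℝ} (hC₁ : 0 < C₁) (hC₂ : 0 < C₂) (hδ : 0 < δ)
    (hγ : 0 < γ) {ψ : Rn n → ℝ} (hψ : PsiKernel n C₁ C₂ δ γ ψ) {ω : Rn n → ℝ} {CA : ℝ}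
    (h : A1P ω CA) :
    ∃ C : ℝ, 0 ≤ C ∧ ∀ (f : Rn n → ℝ) (K : ℝ), BM ω f K → ∀ x₀ : Rn n, Sfun ψ f x₀ < ⊤ →
      (∀ᵐ x ∂(volume : Measure (Rn n)), Sfun ψ f x < ⊤) ∧
      bloNorm ω (fun x => (Sfun ψ f x).toReal) ≤ ENNReal.ofReal (C * K) := by
  obtain ⟨D, hD0, hD⟩ := local_est hn hC₁ hC₂ hδ hγ hψ h
  obtain ⟨M, hM0, hM⟩ := large_est hn hC₁ hδ hψ h
  have hv : 0 < vB n := vB_pos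
  refine ⟨D + M * vB n, by positivity, fun f K hf x₀ hx₀ => ?_⟩
  have hK := hf.pos
  have hmeas : ∀ r : ℝ, Measurable (fun x => (Sq ψ f (Ioc 0 (2 * r)) x) ^ (1/2 : ℝ)) := fun r =>
    (Sq_measurable hψ.1.aestronglyMeasurable hf.loc.aestronglyMeasurable measurableSet_Ioc
      (fun t ht => ht.1)).pow_const _
  have hA : ∀ (c : Rn n) (r : ℝ), 0 < r → ∀ᵐ x ∂(volume.restrict (ball c r)),
      (Sq ψ f (Ioc 0 (2 * r)) x) ^ (1/2 : ℝ) < ⊤ := by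
    intro c r hr
    refine ae_lt_top (hmeas r) (ne_of_lt ?_)
    exact (hD f K hf c r hr).trans_lt ENNReal.ofReal_lt_top
  have hcmp : ∀ (c : Rn n) (r : ℝ), 0 < r → ∀ x ∈ ball c r, ∀ x' ∈ ball c r,
      Sfun ψ f x ≤ (Sq ψ f (Ioc 0 (2 * r)) x) ^ (1/2 : ℝ) + Sfun ψ f x' +
        ENNReal.ofReal (M * K * (wInt ω (ball c r) / r ^ n)) := by
    intro c r hr x hx x' hx'
    have hW := h.pos c r hr
    exact Sfun_compare (by positivity) (by positivity) (hM f K hf c r hr x hx x' hx')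
  have hfin : ∀ᵐ x ∂(volume : Measure (Rn n)), Sfun ψ f x < ⊤ := by
    have h1 : ∀ k : ℕ, ∀ᵐ x ∂(volume : Measure (Rn n)),
        x ∈ ball x₀ ((k : ℝ) + 1) → Sfun ψ f x < ⊤ := by
      intro k
      have hk : (0 : ℝ) < k + 1 := by positivity
      rw [← ae_restrict_iff' measurableSet_ball]
      filter_upwards [hA x₀ _ hk, ae_restrict_mem measurableSet_ball] with x hx hxb
      refine (hcmp x₀ _ hk x hxb x₀ (mem_ball_self hk)).trans_lt ?_
      exact ENNReal.add_lt_top.2 ⟨ENNReal.add_lt_top.2 ⟨hx, hx₀⟩, ENNReal.ofReal_lt_top⟩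
    filter_upwards [ae_all_iff.2 h1] with x hx
    obtain ⟨k, hk⟩ := exists_nat_gt (dist x x₀)
    exact hx k (by rw [mem_ball]; linarith)
  refine ⟨hfin, ?_⟩
  unfold bloNorm
  refine iSup_le fun c => iSup_le fun r => iSup_le fun hr => ENNReal.ofReal_le_ofReal ?_
  have hW := h.pos c r hr
  set E : ℝ := M * K * (wInt ω (ball c r) / r ^ n) with hE
  have hE0 : 0 ≤ E := by positivity
  unfold bloAvg
  rw [inv_mul_eq_div, div_le_iff₀ hW]
  set s : Rn n → ℝ := fun x => (Sfun ψ f x).toReal with hs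
  set A : Rn n → ℝ≥0∞ := fun x => (Sq ψ f (Ioc 0 (2 * r)) x) ^ (1/2 : ℝ) with hAdef
  set m := essInf s (volume.restrict (ball c r)) with hm
  have hne : (ae (volume.restrict (ball c r))).NeBot := by
    rw [ae_neBot, Ne, Measure.restrict_eq_zero]
    exact (measure_ball_pos _ _ hr).ne'
  have hbd : Filter.IsBoundedUnder (· ≥ ·) (ae (volume.restrict (ball c r))) s :=
    Filter.isBoundedUnder_of ⟨0, fun x => ENNReal.toReal_nonneg⟩
  have hlow := ae_essInf_le (μ := volume.restrict (ball c r)) (f := s) hbd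
  have hco : Filter.IsCoboundedUnder (· ≥ ·) (ae (volume.restrict (ball c r))) s := by
    by_contra hcon
    have h1 : ∀ N : ℕ, ∀ᵐ x ∂(volume.restrict (ball c r)), (N : ℝ) ≤ s x := by
      intro N
      by_contra hN
      apply hcon
      refine ⟨N, fun a ha => ?_⟩
      rw [Filter.eventually_map] at ha
      by_contra hlt
      apply hN
      filter_upwards [ha] with x hx
      have h3 : (N : ℝ) < a := not_le.1 hlt
      have h4 : a ≤ s x := hx
      linarith
    obtain ⟨x, hx⟩ := (ae_all_iff.2 h1).exists
    obtain ⟨N, hN⟩ := exists_nat_gt (s x)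
    exact absurd (hx N) (not_le.2 hN)
  have hup : ∀ᵐ x ∂(volume.restrict (ball c r)), s x - m ≤ (A x).toReal + E := by
    have hfr := ae_restrict_of_ae (s := ball c r) hfin
    filter_upwards [hA c r hr, hfr, ae_restrict_mem measurableSet_ball] with x hxA hxS hxb
    have : s x - (A x).toReal - E ≤ m := by
      refine Filter.le_liminf_of_le hco ?_
      filter_upwards [hfr, ae_restrict_mem measurableSet_ball] with x' hx' hxb'
      have h2 := hcmp c r hr x hxb x' hxb'
      have h3 := ENNReal.toReal_mono (ENNReal.add_lt_top.2 ⟨ENNReal.add_lt_top.2 ⟨hxA, hx'⟩,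
        ENNReal.ofReal_lt_top⟩).ne h2
      rw [ENNReal.toReal_add (ENNReal.add_lt_top.2 ⟨hxA, hx'⟩).ne ENNReal.ofReal_ne_top,
        ENNReal.toReal_add hxA.ne hx'.ne, ENNReal.toReal_ofReal hE0] at h3
      simp only [hs, hAdef]
      linarith
    linarith
  have hmain : ENNReal.ofReal (∫ x in ball c r, (s x - m)) ≤
      ENNReal.ofReal ((D + M * vB n) * K * wInt ω (ball c r)) := by
    calc ENNReal.ofReal (∫ x in ball c r, (s x - m))
        ≤ ‖∫ x in ball c r, (s x - m)‖ₑ := by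
          rw [← ofReal_norm]; exact ENNReal.ofReal_le_ofReal (Real.le_norm_self _)
      _ ≤ ∫⁻ x in ball c r, ‖s x - m‖ₑ := enorm_integral_le_lintegral_enorm _
      _ ≤ ∫⁻ x in ball c r, (A x + ENNReal.ofReal E) := by
          refine lintegral_mono_ae ?_
          filter_upwards [hup, hlow, hA c r hr] with x h1 h2 h3
          rw [← ofReal_norm, Real.norm_of_nonneg (sub_nonneg.2 h2)]
          refine (ENNReal.ofReal_le_ofReal h1).trans ?_
          rw [ENNReal.ofReal_add ENNReal.toReal_nonneg hE0, ENNReal.ofReal_toReal h3.ne]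
      _ = (∫⁻ x in ball c r, A x) + ENNReal.ofReal E * volume (ball c r) := by
          rw [lintegral_add_right _ measurable_const, setLIntegral_const]
      _ ≤ ENNReal.ofReal (D * K * wInt ω (ball c r)) + ENNReal.ofReal (E * (vB n * r ^ n)) := by
          refine add_le_add (hD f K hf c r hr) ?_
          rw [volume_ball_eq c hr, ENNReal.ofReal_mul hE0]
      _ = _ := by
          rw [← ENNReal.ofReal_add (by positivity) (by positivity)]
          congr 1
          rw [hE]; field_simp
  exact (ENNReal.ofReal_le_ofReal_iff (by positivity)).1 hmain

theorem bmo_blo_of_Sfun (n : ℕ) (hn : 1 ≤ n) (C₁ C₂ δ γ : ℝ)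
    (hC₁ : 0 < C₁) (hC₂ : 0 < C₂) (hδ : 0 < δ) (hγ : 0 < γ)
    (ψ : Rn n → ℝ) (hψ : PsiKernel n C₁ C₂ δ γ ψ)
    (ω : Rn n → ℝ) (hω : IsWeight ω) (hA1 : IsA1ball ω) :
    ∃ C : ℝ, 0 < C ∧ ∀ f : Rn n → ℝ, LocallyIntegrable f volume →
      bmoNorm ω f < ⊤ →
      ∀ x₀ : Rn n, Sfun ψ f x₀ < ⊤ →
        (∀ᵐ x ∂(volume : Measure (Rn n)), Sfun ψ f x < ⊤) ∧
        bloNorm ω (fun x => (Sfun ψ f x).toReal) ≤ ENNReal.ofReal C * bmoNorm ω f := by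

  obtain ⟨CA, h⟩ := exists_A1P hω hA1
  obtain ⟨C, hC0, hC⟩ := conclusion hn hC₁ hC₂ hδ hγ hψ h
  refine ⟨C + 1, by positivity, fun f hf hfin x₀ hx₀ => ?_⟩
  have hb : ∀ ε : ℝ, 0 < ε → BM ω f ((bmoNorm ω f).toReal + ε) := by
    intro ε hε
    refine BM.of_norm h hf (add_pos_of_nonneg_of_pos ENNReal.toReal_nonneg hε) ?_
    calc bmoNorm ω f = ENNReal.ofReal (bmoNorm ω f).toReal := (ENNReal.ofReal_toReal hfin.ne).symm
      _ ≤ _ := ENNReal.ofReal_le_ofReal (by linarith)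
  refine ⟨(hC f _ (hb 1 one_pos) x₀ hx₀).1, ?_⟩
  have h1 : bloNorm ω (fun x => (Sfun ψ f x).toReal) ≤
      ENNReal.ofReal (C * (bmoNorm ω f).toReal) := by
    refine ENNReal.le_of_forall_pos_le_add fun ε hε _ => ?_
    have hC1 : 0 < C + 1 := by positivity
    have hε' : (0 : ℝ) < ε / (C + 1) := div_pos (by exact_mod_cast hε) hC1
    refine (hC f _ (hb _ hε') x₀ hx₀).2.trans ?_
    rw [← ENNReal.ofReal_coe_nnreal (p := ε),
      ← ENNReal.ofReal_add (mul_nonneg hC0 ENNReal.toReal_nonneg) (NNReal.coe_nonneg ε)]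
    refine ENNReal.ofReal_le_ofReal ?_
    have h2 : C * ((ε : ℝ) / (C + 1)) ≤ ε := by
      rw [mul_div_assoc', div_le_iff₀ hC1]
      nlinarith [NNReal.coe_nonneg ε]
    linarith
  refine h1.trans ?_
  rw [ENNReal.ofReal_mul hC0, ENNReal.ofReal_toReal hfin.ne]
  gcongr
  linarith

end LPW
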